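/- Every planar graph with maximum degree at most three has a planar smooth 2-Lombardi drawing. -/

import Mathlib

open Set

noncomputable section

/-- A `Piece` is a parameterized circular arc or line segment in the plane `ℂ`. -/
inductive Piece : Type
  | arc (c : ℂ) (r θ₀ θ₁ : ℝ) : Piece
  | seg (p q : ℂ) : Piece

namespace Piece

/-- The parameterization of a piece over `[0,1]`. -/
def toFun : Piece → ℝ → ℂ
  | arc c r θ₀ θ₁, t => c + (r : ℂ) * Complex.exp (Complex.I * ((θ₀ + t * (θ₁ - θ₀) : ℝ) : ℂ))
  | seg p q, t => p + (t : ℂ) * (q - p)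

/-- Nondegeneracy: the parameterization has nonvanishing velocity. -/
def Nondeg : Piece → Prop
  | arc _ r θ₀ θ₁ => r ≠ 0 ∧ θ₀ ≠ θ₁
  | seg p q => p ≠ q

end Piece

/-- The direction of a vector, as an angle modulo `2π`. -/
def dirAngle (z : ℂ) : Real.Angle := (Complex.arg z : Real.Angle)

/-- `γ`, restricted to `[s,t]`, is an affine reparameterization of a single
nondegenerate circular arc or line segment. -/
def IsArcOn (γ : ℝ → ℂ) (s t : ℝ) : Prop :=
  ∃ P : Piece, P.Nondeg ∧ ∀ u ∈ Set.Icc (0 : ℝ) 1, γ (s + u * (t - s)) = P.toFun u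

/-- The curve `γ : [0,1] → ℂ` consists of at most `k` circular arcs (or segments). -/
def PolyArc (k : ℕ) (γ : ℝ → ℂ) : Prop :=
  ∃ m : ℕ, 0 < m ∧ m ≤ k ∧ ∃ f : ℕ → ℝ, f 0 = 0 ∧ f m = 1 ∧
    (∀ i < m, f i < f (i + 1)) ∧ ∀ i < m, IsArcOn γ (f i) (f (i + 1))

/-- A drawing of a simple graph in the plane: vertices go to distinct points, each edge is a
simple continuous curve between the points of its endpoints (traversed consistently in both
directions), and no edge passes through a vertex other than its endpoints. -/
structure GraphDrawing (V : Type*) (G : SimpleGraph V) where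
  pos : V → ℂ
  inj : Function.Injective pos
  curve : ∀ ⦃u v : V⦄, G.Adj u v → ℝ → ℂ
  cont : ∀ ⦃u v : V⦄ (h : G.Adj u v), ContinuousOn (curve h) (Set.Icc 0 1)
  source_eq : ∀ ⦃u v : V⦄ (h : G.Adj u v), curve h 0 = pos u
  target_eq : ∀ ⦃u v : V⦄ (h : G.Adj u v), curve h 1 = pos v
  symm : ∀ ⦃u v : V⦄ (h : G.Adj u v) (t : ℝ), curve h.symm t = curve h (1 - t)
  simple : ∀ ⦃u v : V⦄ (h : G.Adj u v), Set.InjOn (curve h) (Set.Icc 0 1)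
  vertexFree : ∀ ⦃u v : V⦄ (h : G.Adj u v) (w : V),
    pos w ∈ curve h '' Set.Icc 0 1 → w = u ∨ w = v

namespace GraphDrawing

variable {V : Type*} {G : SimpleGraph V} (D : GraphDrawing V G)

/-- Every edge of the drawing is drawn with at most `k` circular arcs. -/
def KArc (k : ℕ) : Prop := ∀ ⦃u v : V⦄ (h : G.Adj u v), PolyArc k (D.curve h)

/-- Every edge curve is continuously differentiable with nonvanishing derivative
(no sharp bends). -/
def Smooth : Prop := ∀ ⦃u v : V⦄ (h : G.Adj u v),
  ContDiffOn ℝ 1 (D.curve h) (Set.Icc 0 1) ∧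
    ∀ t ∈ Set.Icc (0 : ℝ) 1, derivWithin (D.curve h) (Set.Icc 0 1) t ≠ 0

/-- Perfect angular resolution: at each vertex `v`, the tangent directions of the incident
edge curves at `v` are equally spaced around `v`. -/
def PerfectRes : Prop := ∀ v : V,
  ∃ (θ : ℝ) (e : {u // G.Adj v u} ≃ Fin (Nat.card {u // G.Adj v u})),
    ∀ (u : V) (h : G.Adj v u), ∃ d : ℂ, d ≠ 0 ∧
      HasDerivWithinAt (D.curve h) d (Set.Icc 0 1) 0 ∧
      dirAngle d =
        ((θ + 2 * Real.pi * ((e ⟨u, h⟩ : Fin _) : ℕ) /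
            (Nat.card {u // G.Adj v u}) : ℝ) : Real.Angle)

/-- The drawing is planar (crossing-free): two distinct edges meet only at
common endpoints. -/
def NonCrossing : Prop := ∀ ⦃u v u' v' : V⦄ (h : G.Adj u v) (h' : G.Adj u' v'),
  s(u, v) ≠ s(u', v') →
    (D.curve h '' Set.Icc 0 1) ∩ (D.curve h' '' Set.Icc 0 1) ⊆
      ({D.pos u, D.pos v} ∩ {D.pos u', D.pos v'} : Set ℂ)

end GraphDrawing

/-- `G` has a Lombardi drawing: a drawing with one circular arc (or segment) per edge and
perfect angular resolution at every vertex. -/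
def HasLombardi (V : Type*) (G : SimpleGraph V) : Prop :=
  ∃ D : GraphDrawing V G, D.KArc 1 ∧ D.PerfectRes

/-! ### Grid graph and a discrete Jordan-type lemma -/

def gvec (d : Fin 4) : ℤ × ℤ := ![(1,0),(0,1),(-1,0),(0,-1)] d

theorem gvec_inj {d e : Fin 4} (h : gvec d = gvec e) : d = e := by
  revert h; fin_cases d <;> fin_cases e <;> simp [gvec]

theorem gvec_opp (d : Fin 4) : gvec (d + 2) = - gvec d := by
  fin_cases d <;> simp [gvec]

theorem gvec_ne (d : Fin 4) : gvec d ≠ 0 := by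
  fin_cases d <;> simp [gvec]

def gridG : SimpleGraph (ℤ × ℤ) where
  Adj p q := ∃ d, q = p + gvec d
  symm := ⟨by
    rintro p q ⟨d, rfl⟩
    exact ⟨d + 2, by rw [gvec_opp]; simp⟩⟩
  loopless := ⟨by
    rintro p ⟨d, h⟩
    exact gvec_ne d (by simpa using h)⟩

open Classical in
noncomputable def gdir (p q : ℤ × ℤ) : Fin 4 := if h : ∃ d, q = p + gvec d then h.choose else 0

theorem gdir_spec {p q : ℤ × ℤ} (h : gridG.Adj p q) : q = p + gvec (gdir p q) := by
  have h' : ∃ d, q = p + gvec d := h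
  unfold gdir
  rw [dif_pos h']
  exact h'.choose_spec

theorem gdir_unique {p q : ℤ × ℤ} {d : Fin 4} (h : q = p + gvec d) : gdir p q = d := by
  have h' : gridG.Adj p q := ⟨d, h⟩
  have := gdir_spec h'
  rw [h] at this
  have h2 := add_left_cancel this
  rw [h]
  exact (gvec_inj h2).symm

theorem gdir_swap {p q : ℤ × ℤ} (h : gridG.Adj p q) : gdir q p = gdir p q + 2 := by
  apply gdir_unique
  rw [gvec_opp]
  conv_rhs => rw [gdir_spec h]
  simp [gdir_unique rfl]

/-- counterclockwise order of three directions -/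
def ccw4 (a b c : Fin 4) : Prop := 0 < b - a ∧ b - a < c - a

instance (a b c : Fin 4) : Decidable (ccw4 a b c) := by unfold ccw4; infer_instance

theorem ccw4_rot {a b c : Fin 4} : ccw4 a b c → ccw4 b c a := by
  revert a b c; decide

theorem ccw4_asymm {a b c : Fin 4} : ccw4 a b c → ¬ ccw4 a c b := by
  revert a b c; decide

theorem ccw4_total {a b c : Fin 4} : a ≠ b → a ≠ c → b ≠ c → ccw4 a b c ∨ ccw4 a c b := by
  revert a b c; decide

theorem ccw4_ne {a b c : Fin 4} : ccw4 a b c → a ≠ b ∧ a ≠ c ∧ b ≠ c := by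
  revert a b c; decide

theorem potential_exists (f : ℤ × ℤ → Fin 4 → ZMod 2)
    (hanti : ∀ p d, f p d = f (p + gvec d) (d + 2))
    (hcl : ∀ p, ∑ d, f p d = 0)
    (B : ℤ) (hB : ∀ p : ℤ × ℤ, p.1 ≤ B → ∀ d, f p d = 0) :
    ∃ X : ℤ × ℤ → Fin 4 → ZMod 2, (∀ p d, X p d = X p (d - 1) + f p d) ∧
      (∀ p d, X p d = X (p + gvec d) (d + 1)) := by
  let χ : ℤ → ℤ → ZMod 2 := fun m n => ∑ k ∈ Finset.Ioc B m, f (k, n) 1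
  have hIoc : ∀ m : ℤ, B < m → Finset.Ioc B m = insert m (Finset.Ioc B (m-1)) := by
    intro m hm; ext x; simp only [Finset.mem_Ioc, Finset.mem_insert]; omega
  have hx : ∀ m n, χ m n = χ (m-1) n + f (m,n) 1 := by
    intro m n
    by_cases hm : B < m
    · simp only [χ]
      rw [hIoc m hm, Finset.sum_insert (by simp), add_comm]
    · have h1 : Finset.Ioc B m = ∅ := by ext x; simp; omega
      have h2 : Finset.Ioc B (m-1) = ∅ := by ext x; simp; omega
      simp only [χ, h1, h2, Finset.sum_empty]
      rw [hB _ (by simpa using hm)]; simp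
  have h3 : ∀ m n, f (m,n) 3 = f (m,n-1) 1 := by
    intro m n; rw [hanti]; simp [gvec]; rfl
  have h2 : ∀ m n, f (m,n) 2 = f (m-1,n) 0 := by
    intro m n; rw [hanti]; simp [gvec]; rfl
  have two : ∀ x : ZMod 2, x + x = 0 := CharTwo.add_self_eq_zero
  have hy : ∀ n m, χ m n = χ m (n-1) + f (m,n) 0 := by
    intro n m
    by_cases hm : m ≤ B
    · have h1 : Finset.Ioc B m = ∅ := by ext x; simp; omega
      simp only [χ, h1, Finset.sum_empty]
      rw [hB _ (by simpa using hm)]; simp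
    · push Not at hm
      induction m, hm.le using Int.leInduction with
      | base => omega
      | succ m hmB ih =>
        have ih' : χ m n = χ m (n-1) + f (m,n) 0 := by
          rcases eq_or_lt_of_le hmB with h | h
          · subst h
            simp only [χ, Finset.Ioc_self, Finset.sum_empty]
            rw [hB _ (by simp)]; simp
          · exact ih h
        have hc := hcl (m+1, n)
        rw [Fin.sum_univ_four, h2, h3] at hc
        have e1 := hx (m+1) n
        have e2 := hx (m+1) (n-1)
        simp only [add_sub_cancel_right] at e1 e2 hc
        rw [e1, e2, ih']
        linear_combination hc + (-1) * two (f (m+1,n-1) 1) - two (f (m+1, n) 0)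
  let X : ℤ × ℤ → Fin 4 → ZMod 2 := fun p d =>
    ![χ p.1 p.2, χ (p.1-1) p.2, χ (p.1-1) (p.2-1), χ p.1 (p.2-1)] d
  refine ⟨X, ?_, ?_⟩
  · rintro ⟨m, n⟩ d
    fin_cases d
    · exact hy n m
    · show χ (m-1) n = χ m n + f (m,n) 1
      rw [hx m n]; linear_combination - two (f (m,n) 1)
    · show χ (m-1) (n-1) = χ (m-1) n + f (m,n) 2
      rw [h2, hy n (m-1)]; linear_combination - two (f (m-1,n) 0)
    · show χ m (n-1) = χ (m-1) (n-1) + f (m,n) 3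
      rw [h3, hx m (n-1)]
  · rintro ⟨m, n⟩ d
    fin_cases d <;> simp [X, gvec, sub_eq_add_neg]

/-- edge-indicator of a sequence -/
def ef (g : ℕ → ℤ × ℤ) (n : ℕ) (x : ℤ × ℤ) (d : Fin 4) : ZMod 2 :=
  ∑ i ∈ Finset.range n, ((if x = g i ∧ x + gvec d = g (i+1) then 1 else 0)
    + (if x = g (i+1) ∧ x + gvec d = g i then 1 else 0))

theorem ef_anti (g n x d) : ef g n x d = ef g n (x + gvec d) (d + 2) := by
  unfold ef
  apply Finset.sum_congr rfl
  intro i _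
  rw [gvec_opp, add_comm]
  simp [and_comm]

theorem ef_sum (g : ℕ → ℤ × ℤ) (n : ℕ) (hg : ∀ i < n, gridG.Adj (g i) (g (i+1))) (x) :
    ∑ d, ef g n x d = (if x = g 0 then 1 else 0) + (if x = g n then 1 else 0) := by
  unfold ef
  rw [Finset.sum_comm]
  induction n with
  | zero => simp; split_ifs <;> decide
  | succ n ih =>
    rw [Finset.sum_range_succ, ih (fun i hi => hg i (by omega))]
    have key : ∀ p q, gridG.Adj p q →
        (∑ d, (if x = p ∧ x + gvec d = q then (1 : ZMod 2) else 0)) = if x = p then 1 else 0 := by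
      intro p q h
      split_ifs with hx
      · subst hx
        rw [Finset.sum_eq_single (gdir x q)]
        · simp [← gdir_spec h]
        · intro d _ hd
          rw [if_neg]
          rintro ⟨_, h2⟩
          exact hd (gdir_unique h2.symm).symm
        · simp
      · simp [hx]
    rw [Finset.sum_add_distrib, key _ _ (hg n (by omega)), key _ _ (hg n (by omega)).symm]
    have two : ∀ x : ZMod 2, x + x = 0 := CharTwo.add_self_eq_zero
    linear_combination two (if x = g n then (1 : ZMod 2) else 0)

theorem ef_off (g : ℕ → ℤ × ℤ) (n : ℕ) (x d) (h : ∀ i ≤ n, x ≠ g i) : ef g n x d = 0 := by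
  unfold ef
  apply Finset.sum_eq_zero
  intro i hi
  have := Finset.mem_range.1 hi
  simp [h i (by omega), h (i+1) (by omega)]

theorem ef_on (g : ℕ → ℤ × ℤ) (n : ℕ) (hi : InjOn g {i | i ≤ n}) (hg : ∀ i < n, gridG.Adj (g i) (g (i+1)))
    (j) (hj : j ≤ n) (d : Fin 4) :
    ef g n (g j) d = (if j < n ∧ d = gdir (g j) (g (j+1)) then 1 else 0) +
      (if 0 < j ∧ d = gdir (g j) (g (j-1)) then 1 else 0) := by
  unfold ef
  rw [Finset.sum_add_distrib]
  congr 1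
  · by_cases h : j < n
    · rw [Finset.sum_eq_single j]
      · have : (g j + gvec d = g (j+1)) ↔ d = gdir (g j) (g (j+1)) := by
          constructor
          · intro h; exact (gdir_unique h.symm).symm
          · intro h'; rw [h']; exact (gdir_spec (hg j h)).symm
        simp [h, this]
      · intro i hi' hij
        rw [if_neg]
        rintro ⟨h1, _⟩
        exact hij (hi hj (by have := Finset.mem_range.1 hi'; simp; omega) h1).symm
      · simp; omega
    · rw [if_neg (by tauto)]
      apply Finset.sum_eq_zero
      intro i hi'
      have := Finset.mem_range.1 hi'
      rw [if_neg]
      rintro ⟨h1, _⟩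
      have := (hi hj (by simp; omega) h1)
      omega
  · by_cases h : 0 < j
    · obtain ⟨k, rfl⟩ : ∃ k, j = k + 1 := ⟨j-1, by omega⟩
      rw [Finset.sum_eq_single k]
      · have : (g (k+1) + gvec d = g k) ↔ d = gdir (g (k+1)) (g k) := by
          constructor
          · intro h; exact (gdir_unique h.symm).symm
          · intro h'; rw [h']; exact (gdir_spec (hg k (by omega)).symm).symm
        simp [this]
      · intro i hi' hij
        rw [if_neg]
        rintro ⟨h1, _⟩
        have := (hi hj (by have := Finset.mem_range.1 hi'; simp; omega) h1)
        omega
      · simp; omega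
    · rw [if_neg (by tauto)]
      apply Finset.sum_eq_zero
      intro i hi'
      have := Finset.mem_range.1 hi'
      rw [if_neg]
      rintro ⟨h1, _⟩
      have := (hi hj (by simp; omega) h1)
      omega

theorem theta_seq (g1 g2 g3 : ℕ → ℤ × ℤ) (n1 n2 n3 : ℕ)
    (hn1 : 0 < n1) (hn2 : 0 < n2) (hn3 : 0 < n3)
    (i1 : InjOn g1 {i | i ≤ n1}) (i2 : InjOn g2 {i | i ≤ n2}) (i3 : InjOn g3 {i | i ≤ n3})
    (a1 : ∀ i < n1, gridG.Adj (g1 i) (g1 (i+1)))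
    (a2 : ∀ i < n2, gridG.Adj (g2 i) (g2 (i+1)))
    (a3 : ∀ i < n3, gridG.Adj (g3 i) (g3 (i+1)))
    (s2 : g2 0 = g1 0) (s3 : g3 0 = g1 0) (t2 : g2 n2 = g1 n1) (t3 : g3 n3 = g1 n1)
    (d12 : ∀ i j, i ≤ n1 → j ≤ n2 → g1 i = g2 j → (i = 0 ∨ i = n1))
    (d13 : ∀ i j, i ≤ n1 → j ≤ n3 → g1 i = g3 j → (j = 0 ∨ j = n3))
    (d23 : ∀ i j, i ≤ n2 → j ≤ n3 → g2 i = g3 j → (j = 0 ∨ j = n3))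
    (hy : ccw4 (gdir (g1 0) (g1 1)) (gdir (g2 0) (g2 1)) (gdir (g3 0) (g3 1)))
    (hz : ccw4 (gdir (g1 n1) (g1 (n1-1))) (gdir (g2 n2) (g2 (n2-1))) (gdir (g3 n3) (g3 (n3-1)))) :
    False := by
  have two : ∀ x : ZMod 2, x + x = 0 := CharTwo.add_self_eq_zero
  let f : ℤ × ℤ → Fin 4 → ZMod 2 := fun x d => ef g1 n1 x d + ef g2 n2 x d
  obtain ⟨B, hB⟩ : ∃ B : ℤ, ∀ p : ℤ × ℤ, p.1 ≤ B → ∀ d, f p d = 0 := by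
    obtain ⟨B1, h1⟩ := ((Finset.range (n1+1)).image (fun i => (g1 i).1)).bddBelow
    obtain ⟨B2, h2⟩ := ((Finset.range (n2+1)).image (fun i => (g2 i).1)).bddBelow
    refine ⟨min B1 B2 - 1, fun p hp d => ?_⟩
    simp only [f]
    rw [ef_off, ef_off, add_zero]
    · intro i hi h
      have := h2 (a := (g2 i).1) (by simp; exact ⟨i, by omega, rfl⟩)
      rw [← h] at this; omega
    · intro i hi h
      have := h1 (a := (g1 i).1) (by simp; exact ⟨i, by omega, rfl⟩)
      rw [← h] at this; omega
  obtain ⟨X, hX1, hX2⟩ := potential_exists f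
    (fun p d => by simp only [f]; rw [ef_anti g1, ef_anti g2])
    (fun p => by
      simp only [f]
      rw [Finset.sum_add_distrib, ef_sum _ _ a1, ef_sum _ _ a2, s2, t2]
      exact two _) B hB
  -- f on g3 interior
  have hf3 : ∀ j, 0 < j → j < n3 → ∀ d, f (g3 j) d = 0 := by
    intro j h1 h2 d
    simp only [f]
    rw [ef_off, ef_off, add_zero]
    · intro i hi h; have := d23 i j hi h2.le h.symm; omega
    · intro i hi h; have := d13 i j hi h2.le h.symm; omega
  have hf1 : ∀ j, 0 < j → j < n1 → ∀ d, f (g1 j) d = (if d = gdir (g1 j) (g1 (j+1)) then 1 else 0) +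
      (if d = gdir (g1 j) (g1 (j-1)) then 1 else 0) := by
    intro j h1 h2 d
    simp only [f]
    rw [ef_on _ _ i1 a1 j h2.le, ef_off g2, add_zero]
    · simp [h1, h2]
    · intro i hi h; have := d12 j i h2.le hi h; omega
  have hfy : ∀ d, f (g1 0) d = (if d = gdir (g1 0) (g1 1) then 1 else 0) + 
      (if d = gdir (g2 0) (g2 1) then 1 else 0) := by
    intro d
    simp only [f]
    rw [ef_on _ _ i1 a1 0 (by omega)]
    rw [← s2, ef_on _ _ i2 a2 0 (by omega)]
    simp [hn1, hn2, s2]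
  have hfz : ∀ d, f (g1 n1) d = (if d = gdir (g1 n1) (g1 (n1-1)) then 1 else 0) + 
      (if d = gdir (g2 n2) (g2 (n2-1)) then 1 else 0) := by
    intro d
    simp only [f]
    rw [ef_on _ _ i1 a1 n1 (by omega)]
    rw [← t2, ef_on _ _ i2 a2 n2 (by omega)]
    simp [hn1, hn2, t2]
  -- left tracking step
  have step : ∀ (g : ℕ → ℤ × ℤ) j, gridG.Adj (g j) (g (j+1)) →
      X (g j) (gdir (g j) (g (j+1))) = X (g (j+1)) (gdir (g (j+1)) (g j) - 1) := by
    intro g j h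
    rw [hX2, ← gdir_spec h, gdir_swap h]
    congr 1
    generalize gdir (g j) (g (j+1)) = d
    revert d; decide
  have left1 : ∀ j, j < n1 → X (g1 0) (gdir (g1 0) (g1 1)) = X (g1 j) (gdir (g1 j) (g1 (j+1))) := by
    intro j
    induction j with
    | zero => simp
    | succ j ih =>
      intro hj
      rw [ih (by omega), step g1 j (a1 j (by omega))]
      have hne : gdir (g1 (j+1)) (g1 (j+1+1)) ≠ gdir (g1 (j+1)) (g1 j) := by
        intro h
        have e1 := gdir_spec (a1 (j+1) hj)
        have e2 := gdir_spec (a1 j (by omega)).symm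
        rw [h, ← e2] at e1
        have := i1 (by simp; omega) (by simp; omega) e1
        omega
      have hj' := hf1 (j+1) (by omega) hj
      simp only [add_tsub_cancel_right] at hj'
      have hx := hX1 (g1 (j+1))
      simp only [hj'] at hx
      generalize gdir (g1 (j+1)) (g1 (j+1+1)) = a at *
      generalize gdir (g1 (j+1)) (g1 j) = b at *
      generalize X (g1 (j+1)) = Y at *
      clear * - hx hne
      have h0 := hx 0
      have h1 := hx 1
      have h2 := hx 2
      have h3 := hx 3
      clear hx
      fin_cases a <;> fin_cases b <;> simp at * <;> simp_all [add_assoc, CharTwo.add_self_eq_zero]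
  have left3 : ∀ j, j < n3 → ∀ d, d = gdir (g3 j) (g3 (j+1)) →
      X (g3 0) (gdir (g3 0) (g3 1)) = X (g3 j) d := by
    intro j
    induction j with
    | zero => intro _ d h; rw [h]
    | succ j ih =>
      intro hj d hd
      rw [ih (by omega) _ rfl, step g3 j (a3 j (by omega))]
      have hx := hX1 (g3 (j+1))
      simp only [hf3 (j+1) (by omega) hj, add_zero] at hx
      generalize gdir (g3 (j+1)) (g3 j) = b at *
      generalize X (g3 (j+1)) = Y at *
      clear * - hx
      have h0 := hx 0
      have h1 := hx 1
      have h2 := hx 2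
      have h3 := hx 3
      clear hx
      fin_cases d <;> fin_cases b <;> simp at * <;> simp_all
  have L1 := left1 (n1-1) (by omega)
  have L3 := left3 (n3-1) (by omega) _ rfl
  rw [step g1 (n1-1) (a1 _ (by omega))] at L1
  rw [step g3 (n3-1) (a3 _ (by omega))] at L3
  rw [show n1 - 1 + 1 = n1 by omega] at L1
  rw [show n3 - 1 + 1 = n3 by omega] at L3
  have hxy := hX1 (g1 0)
  have hxz := hX1 (g1 n1)
  rw [s3] at L3 hy
  rw [t3] at L3 hz
  rw [s2] at hy
  rw [t2] at hz
  simp only [hfy] at hxy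
  simp only [hfz] at hxz
  rw [s2] at hxy
  rw [t2] at hxz
  generalize X (g1 0) = Y at *
  generalize X (g1 n1) = Z at *
  generalize gdir (g1 0) (g1 1) = p1 at *
  generalize gdir (g1 0) (g2 1) = p2 at *
  generalize gdir (g1 0) (g3 1) = p3 at *
  generalize gdir (g1 n1) (g1 (n1-1)) = q1 at *
  generalize gdir (g1 n1) (g2 (n2-1)) = q2 at *
  generalize gdir (g1 n1) (g3 (n3-1)) = q3 at *
  clear * - hxy hxz hy hz L1 L3
  have A : Y p1 = Y p3 + 1 := by
    clear * - hxy hy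
    have h0 := hxy 0
    have h1 := hxy 1
    have h2 := hxy 2
    have h3 := hxy 3
    clear hxy
    revert hy
    fin_cases p1 <;> fin_cases p2 <;> fin_cases p3 <;> simp [ccw4] at * <;> simp_all [add_assoc, CharTwo.add_self_eq_zero] <;> decide
  have A' : Z (q1-1) = Z (q3-1) := by
    clear * - hxz hz
    have h0 := hxz 0
    have h1 := hxz 1
    have h2 := hxz 2
    have h3 := hxz 3
    clear hxz
    revert hz
    fin_cases q1 <;> fin_cases q2 <;> fin_cases q3 <;> simp [ccw4] at * <;> simp_all [add_assoc, CharTwo.add_self_eq_zero] <;> decide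
  rw [L1, L3, A'] at A
  have : ∀ x : ZMod 2, x = x + 1 → False := by decide
  exact this _ A

/-- three internally disjoint grid paths cannot have the same rotation at both ends -/
theorem grid_theta {y z : ℤ × ℤ} (hyz : y ≠ z) (P1 P2 P3 : gridG.Walk y z)
    (h1 : P1.IsPath) (h2 : P2.IsPath) (h3 : P3.IsPath)
    (d12 : ∀ x ∈ P1.support, x ∈ P2.support → x = y ∨ x = z)
    (d13 : ∀ x ∈ P1.support, x ∈ P3.support → x = y ∨ x = z)
    (d23 : ∀ x ∈ P2.support, x ∈ P3.support → x = y ∨ x = z)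
    (hy : ccw4 (gdir y P1.snd) (gdir y P2.snd) (gdir y P3.snd))
    (hz : ccw4 (gdir z P1.penultimate) (gdir z P2.penultimate) (gdir z P3.penultimate)) : False := by
  have pos : ∀ P : gridG.Walk y z, 0 < P.length := by
    intro P
    rcases Nat.eq_zero_or_pos P.length with h | h
    · exact absurd (SimpleGraph.Walk.eq_of_length_eq_zero h) hyz
    · exact h
  have aux : ∀ P Q : gridG.Walk y z, P.IsPath → (∀ x ∈ Q.support, x ∈ P.support → x = y ∨ x = z) →
      ∀ i j, i ≤ Q.length → j ≤ P.length → Q.getVert i = P.getVert j → j = 0 ∨ j = P.length := by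
    intro P Q hP hd i j hi hj h
    have hm := hd (Q.getVert i) (Q.getVert_mem_support i) (h ▸ P.getVert_mem_support j)
    rw [h] at hm
    rcases hm with hm | hm
    · left; exact hP.getVert_injOn (by simpa using hj) (by simp) (by simpa using hm)
    · right; exact hP.getVert_injOn (by simpa using hj) (by simp) (by simpa using hm)
  refine theta_seq P1.getVert P2.getVert P3.getVert P1.length P2.length P3.length
    (pos _) (pos _) (pos _) h1.getVert_injOn h2.getVert_injOn h3.getVert_injOn
    (fun i hi => P1.adj_getVert_succ hi) (fun i hi => P2.adj_getVert_succ hi)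
    (fun i hi => P3.adj_getVert_succ hi) (by simp) (by simp) (by simp) (by simp)
    (fun i j hi hj h => aux P1 P2 h1 (fun x a b => d12 x b a) j i hj hi h.symm)
    (aux P3 P1 h3 d13) (aux P3 P2 h3 d23) (by simpa using hy) (by simpa using hz)

/-! ### From a topological drawing to a grid model -/

section WalkConn
variable {P : Type*} {H : SimpleGraph P}

def RIn (H : SimpleGraph P) (A : Set P) (x y : P) : Prop :=
  ∃ p : H.Walk x y, ∀ z ∈ p.support, z ∈ A

theorem RIn.refl {A : Set P} {x : P} (hx : x ∈ A) : RIn H A x x :=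
  ⟨SimpleGraph.Walk.nil, by simpa using hx⟩

theorem RIn.symm {A : Set P} {x y : P} (h : RIn H A x y) : RIn H A y x := by
  obtain ⟨p, hp⟩ := h
  exact ⟨p.reverse, by simpa using hp⟩

theorem RIn.trans {A : Set P} {x y z : P} (h : RIn H A x y) (h' : RIn H A y z) : RIn H A x z := by
  obtain ⟨p, hp⟩ := h
  obtain ⟨q, hq⟩ := h'
  refine ⟨p.append q, fun w hw => ?_⟩
  rcases (SimpleGraph.Walk.mem_support_append_iff _ _).1 hw with h | h
  · exact hp _ h
  · exact hq _ h

theorem RIn.mono {A B : Set P} (hAB : A ⊆ B) {x y : P} (h : RIn H A x y) : RIn H B x y := by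
  obtain ⟨p, hp⟩ := h
  exact ⟨p, fun z hz => hAB (hp z hz)⟩

theorem RIn.step {A : Set P} {x y : P} (h : H.Adj x y) (hx : x ∈ A) (hy : y ∈ A) : RIn H A x y :=
  ⟨SimpleGraph.Walk.cons h SimpleGraph.Walk.nil, by simp [hx, hy]⟩

def WConn (H : SimpleGraph P) (A : Set P) : Prop := ∀ x ∈ A, ∀ y ∈ A, RIn H A x y

theorem trim_walk [DecidableEq P] {A B C : Set P} (hA : WConn H A) (hB : (A ∩ B).Nonempty) (hC : (A ∩ C).Nonempty) :
    ∃ b ∈ B, ∃ c ∈ C, ∃ p : H.Walk b c, p.IsPath ∧ (∀ z ∈ p.support, z ∈ A) ∧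
      (∀ z ∈ p.support, z ∈ B → z = b) ∧ (∀ z ∈ p.support, z ∈ C → z = c) := by
  classical
  let Q : ℕ → Prop := fun n => ∃ b ∈ B, ∃ c ∈ C, ∃ p : H.Walk b c, (∀ z ∈ p.support, z ∈ A) ∧ p.length = n
  have hQ : ∃ n, Q n := by
    obtain ⟨b, hbA, hb⟩ := hB
    obtain ⟨c, hcA, hc⟩ := hC
    obtain ⟨p, hp⟩ := hA b hbA c hcA
    exact ⟨_, b, hb, c, hc, p, hp, rfl⟩
  obtain ⟨b, hb, c, hc, p, hp, hl⟩ := Nat.find_spec hQ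
  have hmin : ∀ b' ∈ B, ∀ c' ∈ C, ∀ q : H.Walk b' c', (∀ z ∈ q.support, z ∈ A) → p.length ≤ q.length := by
    intro b' hb' c' hc' q hq
    rw [hl]
    exact Nat.find_min' hQ ⟨b', hb', c', hc', q, hq, rfl⟩
  have hs : p.bypass.support ⊆ p.support := p.support_bypass_subset_support
  have hl2 : p.bypass.length ≤ p.length := p.length_bypass_le_length
  refine ⟨b, hb, c, hc, p.bypass, p.bypass_isPath, fun z hz => hp z (hs hz), ?_, ?_⟩
  · intro z hz hzB
    have h1 := hmin z hzB c hc (p.bypass.dropUntil z hz)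
      (fun w hw => hp w (hs (SimpleGraph.Walk.support_dropUntil_subset_support _ hz hw)))
    have h2 := congrArg SimpleGraph.Walk.length (SimpleGraph.Walk.take_spec p.bypass hz)
    rw [SimpleGraph.Walk.length_append] at h2
    have h3 : (p.bypass.takeUntil z hz).length = 0 := by omega
    exact (SimpleGraph.Walk.eq_of_length_eq_zero h3).symm
  · intro z hz hzC
    have h1 := hmin b hb z hzC (p.bypass.takeUntil z hz)
      (fun w hw => hp w (hs (SimpleGraph.Walk.support_takeUntil_subset_support _ hz hw)))
    have h2 := congrArg SimpleGraph.Walk.length (SimpleGraph.Walk.take_spec p.bypass hz)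
    rw [SimpleGraph.Walk.length_append] at h2
    have h3 : (p.bypass.dropUntil z hz).length = 0 := by omega
    exact (SimpleGraph.Walk.eq_of_length_eq_zero h3)

theorem take_drop_share [DecidableEq P] {x y c : P} (p : H.Walk x y) (hp : p.IsPath) (hc : c ∈ p.support) (z : P)
    (h1 : z ∈ (p.takeUntil c hc).support) (h2 : z ∈ (p.dropUntil c hc).support) : z = c := by
  have hsp := SimpleGraph.Walk.take_spec p hc
  rw [← hsp] at hp
  by_contra hne
  have h2' : z ∈ (p.dropUntil c hc).support.tail := by
    rw [← SimpleGraph.Walk.cons_tail_support] at h2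
    rcases List.mem_cons.1 h2 with h | h
    · exact absurd h hne
    · exact h
  have hnd := hp.support_nodup
  rw [SimpleGraph.Walk.support_append, List.nodup_append] at hnd
  exact hnd.2.2 z h1 z h2' rfl

theorem tripod [DecidableEq P] {A : Set P} (hA : WConn H A) (x : Fin 3 → P) (hx : ∀ i, x i ∈ A) :
    ∃ c ∈ A, ∃ q : ∀ i, H.Walk c (x i), (∀ i, ∀ z ∈ (q i).support, z ∈ A) ∧
      ∀ i j, i ≠ j → ∀ z ∈ (q i).support, z ∈ (q j).support → z = c := by
  obtain ⟨p0, hp0⟩ := hA _ (hx 0) _ (hx 1)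
  let p := p0.bypass
  have hp : ∀ z ∈ p.support, z ∈ A := fun z hz => hp0 z (p0.support_bypass_subset_support hz)
  have hpp : p.IsPath := p0.bypass_isPath
  obtain ⟨b, hb, c, hc, q, hq, hqA, hqB, hqC⟩ := trim_walk (B := {x 2}) (C := {z | z ∈ p.support}) hA
    ⟨x 2, hx 2, rfl⟩ ⟨x 0, hx 0, by simp [p]⟩
  have hb' : b = x 2 := hb
  subst hb'
  have hc' : c ∈ p.support := hc
  let q' : ∀ i : Fin 3, H.Walk c (x i) := Fin.cons (p.takeUntil c hc').reverse
    (Fin.cons (p.dropUntil c hc') (Fin.cons q.reverse (fun i => i.elim0)))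
  have e0 : q' 0 = (p.takeUntil c hc').reverse := rfl
  have e1 : q' 1 = (p.dropUntil c hc') := rfl
  have e2 : q' 2 = q.reverse := rfl
  have s0 : ∀ z ∈ (q' 0).support, z ∈ p.support := by
    intro z hz; rw [e0] at hz; simp at hz
    exact SimpleGraph.Walk.support_takeUntil_subset_support _ hc' hz
  have s1 : ∀ z ∈ (q' 1).support, z ∈ p.support := by
    intro z hz; rw [e1] at hz
    exact SimpleGraph.Walk.support_dropUntil_subset_support _ hc' hz
  have s2 : ∀ z ∈ (q' 2).support, z ∈ q.support := by
    intro z hz; rw [e2] at hz; simpa using hz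
  refine ⟨c, hp _ hc', q', ?_, ?_⟩
  · intro i z hz
    fin_cases i
    · exact hp _ (s0 z hz)
    · exact hp _ (s1 z hz)
    · exact hqA _ (s2 z hz)
  · have h01 : ∀ z ∈ (q' 0).support, z ∈ (q' 1).support → z = c := by
      intro z h0 h1
      rw [e0] at h0; rw [e1] at h1; simp at h0
      exact take_drop_share p hpp hc' z h0 h1
    have h02 : ∀ z ∈ (q' 0).support, z ∈ (q' 2).support → z = c := by
      intro z h0 h1
      exact hqC z (s2 z h1) (s0 z h0)
    have h12 : ∀ z ∈ (q' 1).support, z ∈ (q' 2).support → z = c := by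
      intro z h0 h1
      exact hqC z (s2 z h1) (s1 z h0)
    intro i j hij z hi hj
    fin_cases i <;> fin_cases j
    · exact absurd rfl hij
    · exact h01 z hi hj
    · exact h02 z hi hj
    · exact h01 z hj hi
    · exact absurd rfl hij
    · exact h12 z hi hj
    · exact h02 z hj hi
    · exact h12 z hj hi
    · exact absurd rfl hij

end WalkConn

/-- A combinatorial model of a plane graph by paths in a graph `H`. -/
structure PathModel {V P : Type*} (G : SimpleGraph V) (H : SimpleGraph P) where
  pt : V → P
  inj : Function.Injective pt
  path : ∀ ⦃u v : V⦄, G.Adj u v → H.Walk (pt u) (pt v)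
  isPath : ∀ ⦃u v : V⦄ (h : G.Adj u v), (path h).IsPath
  symm : ∀ ⦃u v : V⦄ (h : G.Adj u v), path h.symm = (path h).reverse
  cross : ∀ ⦃u v u' v' : V⦄ (h : G.Adj u v) (h' : G.Adj u' v'), s(u, v) ≠ s(u', v') →
    ∀ x ∈ (path h).support, x ∈ (path h').support → ∃ w, x = pt w ∧ (w = u ∨ w = v) ∧ (w = u' ∨ w = v')
  free : ∀ ⦃u v : V⦄ (h : G.Adj u v) w, pt w ∈ (path h).support → w = u ∨ w = v

theorem exists_fin3_cover {V : Type*} [Finite V] (Q : V → Prop) (hQ : Nat.card {u // Q u} ≤ 3) (h : ∃ u, Q u) :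
    ∃ f : Fin 3 → V, (∀ i, Q (f i)) ∧ ∀ u, Q u → ∃ i, f i = u := by
  classical
  obtain ⟨u0, hu0⟩ := h
  have e := Finite.equivFin {u // Q u}
  let f : Fin 3 → {u // Q u} := fun i => if hi : (i : ℕ) < Nat.card {u // Q u} then e.symm ⟨i, hi⟩ else ⟨u0, hu0⟩
  refine ⟨fun i => (f i).1, fun i => (f i).2, fun u hu => ?_⟩
  have hlt := (e ⟨u, hu⟩).2
  refine ⟨⟨(e ⟨u, hu⟩ : ℕ), by omega⟩, ?_⟩
  simp [f]

theorem pathModel_of_sets {V P : Type*} [Finite V] (G : SimpleGraph V) (H : SimpleGraph P)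
    (hdeg : ∀ v : V, Nat.card {u // G.Adj v u} ≤ 3)
    (SV : V → Set P) (SE : V → V → Set P)
    (hne : ∀ v, (SV v).Nonempty) (hcv : ∀ v, WConn H (SV v)) (hce : ∀ u v, G.Adj u v → WConn H (SE u v))
    (hEs : ∀ u v, SE u v = SE v u)
    (hVV : ∀ v w, v ≠ w → Disjoint (SV v) (SV w))
    (hEE : ∀ u v u' v', s(u,v) ≠ s(u',v') → Disjoint (SE u v) (SE u' v'))
    (hEV : ∀ u v w, w ≠ u → w ≠ v → Disjoint (SE u v) (SV w))
    (hm : ∀ u v, G.Adj u v → (SE u v ∩ SV u).Nonempty) :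
    Nonempty (PathModel G H) := by
  classical
  let _ : LinearOrder V := by
    have e := Finite.equivFin V
    exact LinearOrder.lift' e e.injective
  -- edge paths
  have hQ : ∀ u v, G.Adj u v → ∃ b ∈ SV u, ∃ c ∈ SV v, ∃ p : H.Walk b c,
      (∀ z ∈ p.support, z ∈ SE u v) ∧
      (∀ z ∈ p.support, z ∈ SV u → z = b) ∧ (∀ z ∈ p.support, z ∈ SV v → z = c) := by
    intro u v h
    obtain ⟨b, hb, c, hc, p, -, h1, h2, h3⟩ := trim_walk (hce u v h) (hm u v h) 
      (by have := hm v u h.symm; rwa [hEs] at this)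
    exact ⟨b, hb, c, hc, p, h1, h2, h3⟩
  choose b hb c hc Q hQ1 hQ2 hQ3 using hQ
  let t : V → V → P := fun u v => if h : G.Adj u v then
    (if u < v then b u v h else c v u h.symm) else (hne u).some
  have ht : ∀ u v, t u v ∈ SV u := by
    intro u v
    simp only [t]
    split_ifs with h1 h2
    · exact hb _ _ _
    · exact hc _ _ _
    · exact (hne u).some_mem
  have hT : ∀ v, ∃ p0 ∈ SV v, ∃ T : ∀ u, G.Adj v u → H.Walk p0 (t v u),
      (∀ u h, ∀ z ∈ (T u h).support, z ∈ SV v) ∧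
      ∀ u h u' h', u ≠ u' → ∀ z ∈ (T u h).support, z ∈ (T u' h').support → z = p0 := by
    intro v
    by_cases hv : ∃ u, G.Adj v u
    · obtain ⟨f, hf, hf'⟩ := exists_fin3_cover _ (hdeg v) hv
      obtain ⟨p0, hp0, q, hq1, hq2⟩ := tripod (hcv v) (fun i => t v (f i)) (fun i => ht _ _)
      choose i hi using hf'
      refine ⟨p0, hp0, fun u h => (q (i u h)).copy rfl (by rw [hi]), ?_, ?_⟩
      · intro u h z hz
        rw [SimpleGraph.Walk.support_copy] at hz
        exact hq1 _ z hz
      · intro u h u' h' hne z hz hz'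
        rw [SimpleGraph.Walk.support_copy] at hz hz'
        refine hq2 _ _ ?_ z hz hz'
        intro he
        exact hne (by rw [← hi u h, ← hi u' h', he])
    · push Not at hv
      exact ⟨_, (hne v).some_mem, fun u h => absurd h (hv u), fun u h => absurd h (hv u), fun u h => absurd h (hv u)⟩
  choose pt hpt T hT1 hT2 using hT
  have hπ : ∀ u v (h : G.Adj u v), u < v → ∃ p : H.Walk (pt u) (pt v), p.IsPath ∧
      ∀ x ∈ p.support, x ∈ (T u v h).support ∨ x ∈ (T v u h.symm).support ∨ 
        (x ∈ SE u v ∧ ∀ w, x ∉ SV w) := by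
    intro u v h huv
    have e1 : t u v = b u v h := by simp [t, h, huv]
    have e2 : t v u = c u v h := by simp [t, h.symm, huv.not_gt]
    let W := ((T u v h).append ((Q u v h).copy e1.symm e2.symm)).append (T v u h.symm).reverse
    refine ⟨W.bypass, W.bypass_isPath, fun x hx => ?_⟩
    have hx' := W.support_bypass_subset_support hx
    simp only [W, SimpleGraph.Walk.mem_support_append_iff, SimpleGraph.Walk.support_reverse, List.mem_reverse,
      SimpleGraph.Walk.support_copy] at hx'
    rcases hx' with (hx' | hx') | hx'
    · exact Or.inl hx'
    · by_cases h1 : x ∈ SV u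
      · left
        rw [hQ2 u v h x hx' h1, ← e1]; simp
      by_cases h2 : x ∈ SV v
      · right; left
        rw [hQ3 u v h x hx' h2, ← e2]; simp
      · right; right
        refine ⟨hQ1 u v h x hx', fun w hw => ?_⟩
        by_cases hwu : w = u
        · subst hwu; exact h1 hw
        by_cases hwv : w = v
        · subst hwv; exact h2 hw
        exact Set.disjoint_left.1 (hEV u v w hwu hwv) (hQ1 u v h x hx') hw
    · exact Or.inr (Or.inl hx')
  choose π hπ1 hπ2 using hπ
  let path : ∀ ⦃u v : V⦄, G.Adj u v → H.Walk (pt u) (pt v) := fun u v h =>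
    if huv : u < v then π u v h huv else
      (π v u h.symm (lt_of_le_of_ne (not_lt.1 huv) h.ne')).reverse
  have hsup : ∀ ⦃u v : V⦄ (h : G.Adj u v), ∀ x ∈ (path h).support,
      (x ∈ (T u v h).support ∨ x ∈ (T v u h.symm).support ∨ (x ∈ SE u v ∧ ∀ w, x ∉ SV w)) := by
    intro u v h x hx
    by_cases huv : u < v
    · simp only [path, huv, dif_pos] at hx
      exact hπ2 u v h huv x hx
    · simp only [path, huv, dif_neg, not_false_eq_true, SimpleGraph.Walk.support_reverse, List.mem_reverse] at hx
      have := hπ2 v u h.symm _ x hx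
      rw [hEs] at this
      tauto
  have hSVu : ∀ x v w, x ∈ SV v → x ∈ SV w → v = w := by
    intro x v w h1 h2
    by_contra hne
    exact Set.disjoint_left.1 (hVV v w hne) h1 h2
  have hptinj : Function.Injective pt := by
    intro v w hvw
    exact hSVu (pt v) v w (hpt v) (hvw ▸ hpt w)
  have hTT : ∀ u v (h : G.Adj u v) u' v' (h' : G.Adj u' v') x, (u ≠ u' ∨ v ≠ v') → x ∈ (T u v h).support →
      x ∈ (T u' v' h').support → u = u' ∧ x = pt u := by
    intro u v h u' v' h' x hne hx hx'
    have := hSVu x u u' (hT1 _ _ _ _ hx) (hT1 _ _ _ _ hx')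
    subst this
    refine ⟨rfl, hT2 u v h v' h' ?_ x hx hx'⟩
    tauto
  refine ⟨⟨pt, hptinj, path, ?_, ?_, ?_, ?_⟩⟩
  · intro u v h
    by_cases huv : u < v
    · simp only [path, huv, dif_pos]; exact hπ1 _ _ _ _
    · simp only [path, huv, dif_neg, not_false_eq_true]; exact (hπ1 _ _ _ _).reverse
  · intro u v h
    rcases lt_or_gt_of_ne h.ne with huv | huv
    · simp only [path, huv, huv.not_gt, dif_pos, dif_neg, not_false_eq_true]
    · simp only [path, huv, huv.not_gt, dif_pos, dif_neg, not_false_eq_true, SimpleGraph.Walk.reverse_reverse]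
  · intro u v u' v' h h' hne x hx hx'
    have hne1 : u ≠ u' ∨ v ≠ v' := by
      by_contra hcon; push Not at hcon; exact hne (by rw [hcon.1, hcon.2])
    have hne2 : u ≠ v' ∨ v ≠ u' := by
      by_contra hcon; push Not at hcon; exact hne (by rw [hcon.1, hcon.2, Sym2.eq_swap])
    rcases hsup h x hx with h1 | h1 | ⟨h1, h1'⟩ <;> rcases hsup h' x hx' with h2 | h2 | ⟨h2, h2'⟩
    · obtain ⟨e1, e2⟩ := hTT _ _ _ _ _ _ x hne1 h1 h2
      exact ⟨u, e2, by tauto, by tauto⟩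
    · obtain ⟨e1, e2⟩ := hTT _ _ _ _ _ _ x hne2 h1 h2
      exact ⟨u, e2, by tauto, by tauto⟩
    · exact absurd (hT1 _ _ _ _ h1) (h2' _)
    · obtain ⟨e1, e2⟩ := hTT _ _ _ _ _ _ x hne2.symm h1 h2
      exact ⟨v, e2, by tauto, by tauto⟩
    · obtain ⟨e1, e2⟩ := hTT _ _ _ _ _ _ x hne1.symm h1 h2
      exact ⟨v, e2, by tauto, by tauto⟩
    · exact absurd (hT1 _ _ _ _ h1) (h2' _)
    · exact absurd (hT1 _ _ _ _ h2) (h1' _)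
    · exact absurd (hT1 _ _ _ _ h2) (h1' _)
    · exact absurd h2 (Set.disjoint_left.1 (hEE u v u' v' hne) h1)
  · intro u v h w hw
    rcases hsup h _ hw with h1 | h1 | ⟨h1, h1'⟩
    · exact Or.inl (hSVu _ _ _ (hpt w) (hT1 _ _ _ _ h1))
    · exact Or.inr (hSVu _ _ _ (hpt w) (hT1 _ _ _ _ h1))
    · exact absurd (hpt w) (h1' w)

/-! discretization -/

def discr (N : ℝ) (K : Set ℂ) : Set (ℤ × ℤ) :=
  {p | ∃ x ∈ K, |N * x.re - p.1| ≤ 1 ∧ |N * x.im - p.2| ≤ 1}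

theorem discr_mono {N : ℝ} {K K' : Set ℂ} (h : K ⊆ K') : discr N K ⊆ discr N K' := by
  rintro p ⟨x, hx, h1⟩
  exact ⟨x, h hx, h1⟩

theorem hline (A : Set (ℤ × ℤ)) (m n : ℤ) (k : ℕ) (h : ∀ i ≤ k, (m + (i:ℤ), n) ∈ A) :
    RIn gridG A (m, n) (m + (k:ℤ), n) := by
  induction k with
  | zero => simpa using RIn.refl (by simpa using h 0 le_rfl)
  | succ k ih =>
    refine (ih (fun i hi => h i (by omega))).trans (RIn.step ⟨0, ?_⟩ (h k (by omega)) (h (k+1) le_rfl))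
    simp [gvec]; ring

theorem vline (A : Set (ℤ × ℤ)) (m n : ℤ) (k : ℕ) (h : ∀ i ≤ k, (m, n + (i:ℤ)) ∈ A) :
    RIn gridG A (m, n) (m, n + (k:ℤ)) := by
  induction k with
  | zero => simpa using RIn.refl (by simpa using h 0 le_rfl)
  | succ k ih =>
    refine (ih (fun i hi => h i (by omega))).trans (RIn.step ⟨1, ?_⟩ (h k (by omega)) (h (k+1) le_rfl))
    simp [gvec]; ring

theorem discr_box (N : ℝ) (x : ℂ) : WConn gridG (discr N {x}) := by
  have mem : ∀ m n : ℤ, (m, n) ∈ discr N {x} ↔ (|N * x.re - m| ≤ 1 ∧ |N * x.im - n| ≤ 1) := by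
    intro m n; simp [discr]
  have hor : ∀ m m' n : ℤ, m ≤ m' → (m,n) ∈ discr N {x} → (m',n) ∈ discr N {x} →
      RIn gridG (discr N {x}) (m,n) (m',n) := by
    intro m m' n hmm h h'
    obtain ⟨k, rfl⟩ := Int.le.dest hmm
    apply hline
    intro i hi
    rw [mem, abs_le, abs_le] at *
    push_cast at *
    have : (i:ℝ) ≤ k := by exact_mod_cast hi
    have : (0:ℝ) ≤ i := by positivity
    refine ⟨⟨by linarith, by linarith⟩, h.2⟩
  have ver : ∀ m n n' : ℤ, n ≤ n' → (m,n) ∈ discr N {x} → (m,n') ∈ discr N {x} →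
      RIn gridG (discr N {x}) (m,n) (m,n') := by
    intro m n n' hmm h h'
    obtain ⟨k, rfl⟩ := Int.le.dest hmm
    apply vline
    intro i hi
    rw [mem, abs_le, abs_le] at *
    push_cast at *
    have : (i:ℝ) ≤ k := by exact_mod_cast hi
    have : (0:ℝ) ≤ i := by positivity
    refine ⟨h.1, ⟨by linarith, by linarith⟩⟩
  rintro ⟨m, n⟩ h ⟨m', n'⟩ h'
  have hmid : (m', n) ∈ discr N {x} := by rw [mem] at *; exact ⟨h'.1, h.2⟩
  refine RIn.trans (y := (m', n)) ?_ ?_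
  · rcases le_total m m' with hh | hh
    · exact hor _ _ _ hh h hmid
    · exact (hor _ _ _ hh hmid h).symm
  · rcases le_total n n' with hh | hh
    · exact ver _ _ _ hh hmid h'
    · exact (ver _ _ _ hh h' hmid).symm

theorem discr_conn (N : ℝ) (hN : 0 < N) (K : Set ℂ) (hK : IsPreconnected K) : WConn gridG (discr N K) := by
  let rd : ℂ → ℤ × ℤ := fun x => (round (N * x.re), round (N * x.im))
  have rd_self : ∀ x, rd x ∈ discr N {x} := by
    intro x
    refine ⟨x, rfl, ?_, ?_⟩
    · exact (abs_sub_round _).trans (by norm_num)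
    · exact (abs_sub_round _).trans (by norm_num)
  have sub : ∀ x ∈ K, discr N {x} ⊆ discr N K := fun x hx => discr_mono (by simpa using hx)
  have key : ∀ x ∈ K, ∀ y ∈ K, RIn gridG (discr N K) (rd x) (rd y) := by
    intro x hx y hy
    refine hK.induction₂ (fun x y => RIn gridG (discr N K) (rd x) (rd y)) ?_ ?_ ?_ hx hy
    · intro x hx
      have : ∀ᶠ y in nhds x, dist y x < 1/(2*N) := Metric.ball_mem_nhds x (by positivity)
      filter_upwards [nhdsWithin_le_nhds this] with y hy
      refine (discr_box N x _ (rd_self x) (rd y) ?_).mono (sub x hx)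
      have hd : dist y x * N ≤ 1/2 := by
        rw [lt_div_iff₀ (by positivity)] at hy; nlinarith
      rw [dist_eq_norm] at hd
      refine ⟨x, rfl, ?_, ?_⟩
      · have h1 := abs_sub_round (N * y.re)
        have h2 : |N * x.re - N * y.re| ≤ 1/2 := by
          rw [← mul_sub, abs_mul, abs_of_pos hN, abs_sub_comm]
          have := Complex.abs_re_le_norm (y - x)
          simp only [Complex.sub_re] at this
          nlinarith
        calc |N * x.re - (rd y).1| ≤ |N * x.re - N * y.re| + |N * y.re - (rd y).1| := abs_sub_le _ _ _
          _ ≤ 1/2 + 1/2 := add_le_add h2 h1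
          _ = 1 := by norm_num
      · have h1 := abs_sub_round (N * y.im)
        have h2 : |N * x.im - N * y.im| ≤ 1/2 := by
          rw [← mul_sub, abs_mul, abs_of_pos hN, abs_sub_comm]
          have := Complex.abs_im_le_norm (y - x)
          simp only [Complex.sub_im] at this
          nlinarith
        calc |N * x.im - (rd y).2| ≤ |N * x.im - N * y.im| + |N * y.im - (rd y).2| := abs_sub_le _ _ _
          _ ≤ 1/2 + 1/2 := add_le_add h2 h1
          _ = 1 := by norm_num
    · intro x y z _ _ _ h1 h2; exact h1.trans h2
    · intro x y _ _ h; exact h.symm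
  have box : ∀ p ∈ discr N K, ∃ x ∈ K, RIn gridG (discr N K) p (rd x) := by
    rintro p ⟨x, hx, h1⟩
    exact ⟨x, hx, (discr_box N x p ⟨x, rfl, h1⟩ _ (rd_self x)).mono (sub x hx)⟩
  intro p hp q hq
  obtain ⟨x, hx, h1⟩ := box p hp
  obtain ⟨y, hy, h2⟩ := box q hq
  exact (h1.trans (key x hx y hy)).trans h2.symm

theorem discr_nonempty (N : ℝ) (K : Set ℂ) (hK : K.Nonempty) : (discr N K).Nonempty := by
  obtain ⟨x, hx⟩ := hK
  refine ⟨(round (N * x.re), round (N * x.im)), x, hx, ?_, ?_⟩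
  · exact (abs_sub_round _).trans (by norm_num)
  · exact (abs_sub_round _).trans (by norm_num)

theorem discr_disjoint {K K' : Set ℂ} (hK : IsCompact K) (hK' : IsCompact K') (hd : Disjoint K K') :
    ∀ᶠ N : ℝ in Filter.atTop, Disjoint (discr N K) (discr N K') := by
  obtain ⟨δ, hδ, h⟩ : ∃ δ > 0, ∀ x ∈ K, ∀ y ∈ K', δ ≤ dist x y := by
    rcases K.eq_empty_or_nonempty with rfl | hne
    · exact ⟨1, one_pos, by simp⟩
    rcases K'.eq_empty_or_nonempty with rfl | hne'
    · exact ⟨1, one_pos, by simp⟩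
    obtain ⟨p, hp, hmin⟩ := (hK.prod hK').exists_isMinOn (hne.prod hne')
      (f := fun p : ℂ × ℂ => dist p.1 p.2) (by fun_prop)
    refine ⟨dist p.1 p.2, ?_, fun x hx y hy => hmin (a := (x, y)) ⟨hx, hy⟩⟩
    rw [gt_iff_lt, dist_pos]
    rintro he
    exact Set.disjoint_left.1 hd hp.1 (he ▸ hp.2)
  filter_upwards [Filter.eventually_gt_atTop (4/δ)] with N hN
  rw [div_lt_iff₀ hδ] at hN
  have hNpos : 0 < N := by nlinarith
  rw [Set.disjoint_left]
  rintro p ⟨x, hx, h1, h2⟩ ⟨y, hy, h3, h4⟩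
  have hxy := h x hx y hy
  rw [dist_eq_norm] at hxy
  have h5 : |(x-y).re| + |(x-y).im| ≤ 4/N := by
    rw [le_div_iff₀ hNpos]
    have a1 : |(x-y).re| * N ≤ 2 := by
      rw [show ∀ a : ℝ, |a| * N = |a * N| from fun a => by rw [abs_mul, abs_of_pos hNpos]]
      rw [abs_le] at *
      simp only [Complex.sub_re]
      constructor <;> nlinarith
    have a2 : |(x-y).im| * N ≤ 2 := by
      rw [show ∀ a : ℝ, |a| * N = |a * N| from fun a => by rw [abs_mul, abs_of_pos hNpos]]
      rw [abs_le] at *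
      simp only [Complex.sub_im]
      constructor <;> nlinarith
    nlinarith
  have h6 := Complex.norm_le_abs_re_add_abs_im (x-y)
  have h7 : δ ≤ 4/N := by linarith
  rw [le_div_iff₀ hNpos] at h7
  nlinarith

theorem exists_gridModel {V : Type*} [Finite V] (G : SimpleGraph V)
    (hdeg : ∀ v : V, Nat.card {u // G.Adj v u} ≤ 3)
    (D : GraphDrawing V G) (hD : D.NonCrossing) : Nonempty (PathModel G gridG) := by
  let KV : V → Set ℂ := fun v => {D.pos v} ∪ ⋃ u, ⋃ h : G.Adj v u, D.curve h '' Icc 0 (1/3)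
  let KE : V → V → Set ℂ := fun u v => ⋃ h : G.Adj u v, D.curve h '' Icc (1/3) (2/3)
  have i1 : Icc (0:ℝ) (1/3) ⊆ Icc 0 1 := Icc_subset_Icc le_rfl (by norm_num)
  have i2 : Icc (1/3:ℝ) (2/3) ⊆ Icc 0 1 := Icc_subset_Icc (by norm_num) (by norm_num)
  have cKV : ∀ v, IsCompact (KV v) := fun v => isCompact_singleton.union
    (isCompact_iUnion fun u => isCompact_iUnion fun h => isCompact_Icc.image_of_continuousOn ((D.cont h).mono i1))
  have cKE : ∀ u v, IsCompact (KE u v) := fun u v => 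
    (isCompact_iUnion fun h => isCompact_Icc.image_of_continuousOn ((D.cont h).mono i2))
  have pKV : ∀ v, IsPreconnected (KV v) := by
    intro v
    have : KV v = ⋃₀ (insert {D.pos v} {s | ∃ u, ∃ h : G.Adj v u, s = D.curve h '' Icc 0 (1/3)}) := by
      ext z
      simp only [KV, mem_union, mem_singleton_iff, mem_iUnion, sUnion_insert, mem_sUnion, mem_ofPred_eq]
      constructor
      · rintro (h | ⟨u, h, hz⟩)
        · exact Or.inl h
        · exact Or.inr ⟨_, ⟨u, h, rfl⟩, hz⟩
      · rintro (h | ⟨_, ⟨u, h, rfl⟩, hz⟩)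
        · exact Or.inl h
        · exact Or.inr ⟨u, h, hz⟩
    rw [this]
    refine isPreconnected_sUnion (D.pos v) _ ?_ ?_
    · rintro s (rfl | ⟨u, h, rfl⟩)
      · rfl
      · exact ⟨0, by norm_num, D.source_eq h⟩
    · rintro s (rfl | ⟨u, h, rfl⟩)
      · exact isPreconnected_singleton
      · exact isPreconnected_Icc.image _ ((D.cont h).mono i1)
  have pKE : ∀ u v, G.Adj u v → IsPreconnected (KE u v) := by
    intro u v h
    have : KE u v = D.curve h '' Icc (1/3) (2/3) := by simp [KE, h]
    rw [this]
    exact isPreconnected_Icc.image _ ((D.cont h).mono i2)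
  have sKE : ∀ u v, KE u v ⊆ KE v u := by
    intro u v z hz
    simp only [KE, mem_iUnion] at hz ⊢
    obtain ⟨h, t, ht, rfl⟩ := hz
    refine ⟨h.symm, 1 - t, ⟨by linarith [ht.2], by linarith [ht.1]⟩, ?_⟩
    rw [D.symm h]; simp
  -- end point facts
  have e0 : ∀ ⦃u v⦄ (h : G.Adj u v) t, t ∈ Icc (0:ℝ) 1 → D.curve h t = D.pos u → t = 0 := by
    intro u v h t ht he
    exact D.simple h ht (by simp) (by rw [he, D.source_eq])
  have e1 : ∀ ⦃u v⦄ (h : G.Adj u v) t, t ∈ Icc (0:ℝ) 1 → D.curve h t = D.pos v → t = 1 := by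
    intro u v h t ht he
    exact D.simple h ht (by simp) (by rw [he, D.target_eq])
  have posK : ∀ v w, v ≠ w → D.pos v ∉ KV w := by
    intro v w hne hz
    simp only [KV, mem_union, mem_singleton_iff, mem_iUnion] at hz
    rcases hz with hz | ⟨u, h, t, ht, hz⟩
    · exact hne (D.inj hz)
    · rcases D.vertexFree h v ⟨t, i1 ht, hz⟩ with rfl | rfl
      · exact hne rfl
      · have := e1 h t (i1 ht) hz
        rw [this] at ht; norm_num at ht
  have dVV : ∀ v w, v ≠ w → Disjoint (KV v) (KV w) := by
    intro v w hne
    rw [Set.disjoint_left]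
    intro z hz hz'
    have hzv : z ≠ D.pos v := by rintro rfl; exact posK v w hne hz'
    have hzw : z ≠ D.pos w := by rintro rfl; exact posK w v hne.symm hz
    simp only [KV, mem_union, mem_singleton_iff, mem_iUnion, hzv, hzw, false_or] at hz hz'
    obtain ⟨u, h, t, ht, rfl⟩ := hz
    obtain ⟨u', h', t', ht', he⟩ := hz'
    by_cases hs : s(v,u) = s(w,u')
    · rw [Sym2.eq_iff] at hs
      rcases hs with hs | ⟨rfl, rfl⟩
      · exact hne hs.1
      · have := D.symm h t'
        rw [this] at he
        have := D.simple h (by constructor <;> linarith [ht'.1, ht'.2]) (i1 ht) he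
        linarith [ht'.1, ht'.2, ht.1, ht.2]
    · have hm := hD h h' hs ⟨⟨t, i1 ht, rfl⟩, ⟨t', i1 ht', he⟩⟩
      rcases hm.1 with hm | hm
      · exact hzv hm
      · have := e1 h t (i1 ht) hm
        rw [this] at ht; norm_num at ht
  have dEE : ∀ u v u' v', s(u,v) ≠ s(u',v') → Disjoint (KE u v) (KE u' v') := by
    intro u v u' v' hs
    rw [Set.disjoint_left]
    intro z hz hz'
    simp only [KE, mem_iUnion] at hz hz'
    obtain ⟨h, t, ht, rfl⟩ := hz
    obtain ⟨h', t', ht', he⟩ := hz'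
    have hm := hD h h' hs ⟨⟨t, i2 ht, rfl⟩, ⟨t', i2 ht', he⟩⟩
    rcases hm.1 with hm | hm
    · have := e0 h t (i2 ht) hm
      rw [this] at ht; norm_num at ht
    · have := e1 h t (i2 ht) hm
      rw [this] at ht; norm_num at ht
  have dEV : ∀ u v w, w ≠ u → w ≠ v → Disjoint (KE u v) (KV w) := by
    intro u v w hwu hwv
    rw [Set.disjoint_left]
    intro z hz hz'
    simp only [KE, KV, mem_union, mem_singleton_iff, mem_iUnion] at hz hz'
    obtain ⟨h, t, ht, rfl⟩ := hz
    rcases hz' with he | ⟨u', h', t', ht', he⟩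
    · rcases D.vertexFree h w ⟨t, i2 ht, he⟩ with h | h
      · exact hwu h
      · exact hwv h
    · have hs : s(u,v) ≠ s(w,u') := by
        intro hs
        rw [Sym2.eq_iff] at hs
        rcases hs with hs | hs
        · exact hwu hs.1.symm
        · exact hwv hs.2.symm
      have hm := hD h h' hs ⟨⟨t, i2 ht, rfl⟩, ⟨t', i1 ht', he⟩⟩
      rcases hm.1 with hm | hm
      · have := e0 h t (i2 ht) hm
        rw [this] at ht; norm_num at ht
      · have := e1 h t (i2 ht) hm
        rw [this] at ht; norm_num at ht
  have hmeet : ∀ u v, G.Adj u v → (KE u v ∩ KV u).Nonempty := by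
    intro u v h
    refine ⟨D.curve h (1/3), ?_, ?_⟩
    · simp only [KE, mem_iUnion]; exact ⟨h, 1/3, by norm_num, rfl⟩
    · simp only [KV, mem_union, mem_iUnion]; exact Or.inr ⟨v, h, 1/3, by norm_num, rfl⟩
  have E1 : ∀ᶠ N : ℝ in Filter.atTop, ∀ v w, v ≠ w → Disjoint (discr N (KV v)) (discr N (KV w)) := by
    rw [Filter.eventually_all]; intro v
    rw [Filter.eventually_all]; intro w
    rw [Filter.eventually_imp_distrib_left]; intro hne
    exact discr_disjoint (cKV v) (cKV w) (dVV v w hne)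
  have E2 : ∀ᶠ N : ℝ in Filter.atTop, ∀ u v u' v', s(u,v) ≠ s(u',v') →
      Disjoint (discr N (KE u v)) (discr N (KE u' v')) := by
    rw [Filter.eventually_all]; intro u
    rw [Filter.eventually_all]; intro v
    rw [Filter.eventually_all]; intro u'
    rw [Filter.eventually_all]; intro v'
    rw [Filter.eventually_imp_distrib_left]; intro hne
    exact discr_disjoint (cKE u v) (cKE u' v') (dEE u v u' v' hne)
  have E3 : ∀ᶠ N : ℝ in Filter.atTop, ∀ u v w, w ≠ u → w ≠ v →
      Disjoint (discr N (KE u v)) (discr N (KV w)) := by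
    rw [Filter.eventually_all]; intro u
    rw [Filter.eventually_all]; intro v
    rw [Filter.eventually_all]; intro w
    rw [Filter.eventually_imp_distrib_left]; intro h1
    rw [Filter.eventually_imp_distrib_left]; intro h2
    exact discr_disjoint (cKE u v) (cKV w) (dEV u v w h1 h2)
  obtain ⟨N, h1, h2, h3, hN⟩ := (E1.and (E2.and (E3.and (Filter.eventually_gt_atTop 0)))).exists
  refine pathModel_of_sets G gridG hdeg (fun v => discr N (KV v)) (fun u v => discr N (KE u v))
    (fun v => discr_nonempty N _ ⟨D.pos v, by simp [KV]⟩)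
    (fun v => discr_conn N hN _ (pKV v)) (fun u v h => discr_conn N hN _ (pKE u v h))
    (fun u v => congrArg _ (Set.Subset.antisymm (sKE u v) (sKE v u))) h1 h2 h3 ?_
  intro u v h
  obtain ⟨p, hp⟩ := discr_nonempty N _ (hmeet u v h)
  exact ⟨p, discr_mono inter_subset_left hp, discr_mono inter_subset_right hp⟩

/-! ### Rotation systems from grid models -/

theorem isPath_append' {P : Type*} {H : SimpleGraph P} {a b c : P} {p : H.Walk a b} {q : H.Walk b c}
    (hp : p.IsPath) (hq : q.IsPath) (h : ∀ z ∈ p.support, z ∈ q.support → z = b) :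
    (p.append q).IsPath := by
  rw [SimpleGraph.Walk.isPath_def, SimpleGraph.Walk.support_append, List.nodup_append]
  have hqn := hq.support_nodup
  rw [← SimpleGraph.Walk.cons_tail_support, List.nodup_cons] at hqn
  refine ⟨hp.support_nodup, hqn.2, ?_⟩
  rintro z hz w hw rfl
  have := h z hz (List.mem_of_mem_tail hw)
  subst this
  exact hqn.1 hw

/-- rotation data on a graph, with the theta property -/
structure Rot {V : Type*} (G : SimpleGraph V) where
  o : V → V → V → V → Prop
  rot : ∀ {v a b c}, o v a b c → o v b c a
  asymm : ∀ {v a b c}, o v a b c → ¬ o v a c b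
  total : ∀ {v a b c}, G.Adj v a → G.Adj v b → G.Adj v c → a ≠ b → a ≠ c → b ≠ c →
    o v a b c ∨ o v a c b
  theta : ∀ {y z : V}, y ≠ z → ∀ (p1 p2 p3 : G.Walk y z), p1.IsPath → p2.IsPath → p3.IsPath →
    (∀ x ∈ p1.support, x ∈ p2.support → x = y ∨ x = z) →
    (∀ x ∈ p1.support, x ∈ p3.support → x = y ∨ x = z) →
    (∀ x ∈ p2.support, x ∈ p3.support → x = y ∨ x = z) →
    o y p1.snd p2.snd p3.snd → o z p1.penultimate p2.penultimate p3.penultimate → False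

namespace PathModel
variable {V : Type*} {G : SimpleGraph V} (M : PathModel G gridG)

def lift : ∀ {u v : V}, G.Walk u v → gridG.Walk (M.pt u) (M.pt v)
  | _, _, .nil => .nil
  | _, _, .cons h p => (M.path h).append (lift p)

theorem lift_append {u v w : V} (p : G.Walk u v) (q : G.Walk v w) :
    M.lift (p.append q) = (M.lift p).append (M.lift q) := by
  induction p with
  | nil => simp [lift]
  | cons h p ih => simp [lift, ih, SimpleGraph.Walk.append_assoc]

theorem lift_reverse {u v : V} (p : G.Walk u v) : M.lift p.reverse = (M.lift p).reverse := by
  induction p with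
  | nil => simp [lift]
  | cons h p ih =>
    rw [SimpleGraph.Walk.reverse_cons, lift_append, ih]
    simp [lift, M.symm h]

theorem mem_lift {u v : V} (p : G.Walk u v) (x) (hx : x ∈ (M.lift p).support) :
    (∃ a b, ∃ h : G.Adj a b, s(a,b) ∈ p.edges ∧ x ∈ (M.path h).support) ∨ (x = M.pt u ∧ p.Nil) := by
  induction p with
  | nil => right; simpa [lift] using hx
  | cons h p ih =>
    left
    simp only [lift, SimpleGraph.Walk.mem_support_append_iff] at hx
    rcases hx with hx | hx
    · exact ⟨_, _, h, by simp, hx⟩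
    · rcases ih hx with ⟨a, b, h', hab, hx'⟩ | ⟨rfl, _⟩
      · exact ⟨a, b, h', by simp [hab], hx'⟩
      · exact ⟨_, _, h, by simp, by simp⟩

theorem lift_isPath {u v : V} (p : G.Walk u v) (hp : p.IsPath) : (M.lift p).IsPath := by
  induction p with
  | nil => simp [lift]
  | cons h p ih =>
    rw [SimpleGraph.Walk.cons_isPath_iff] at hp
    refine isPath_append' (M.isPath h) (ih hp.1) ?_
    intro z hz hz'
    rcases M.mem_lift p z hz' with ⟨a, b, h', hab, hx'⟩ | ⟨rfl, _⟩
    · have ha := p.fst_mem_support_of_mem_edges hab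
      have hb := p.snd_mem_support_of_mem_edges hab
      obtain ⟨w, rfl, hw1, hw2⟩ := M.cross h h' (by
        intro he
        rw [Sym2.eq_iff] at he
        rcases he with ⟨rfl, _⟩ | ⟨rfl, _⟩
        · exact hp.2 ha
        · exact hp.2 hb) z hz hx'
      rcases hw1 with rfl | rfl
      · exfalso; rcases hw2 with rfl | rfl
        · exact hp.2 ha
        · exact hp.2 hb
      · rfl
    · rfl

open Classical in
noncomputable def dirn (v a : V) : Fin 4 := if h : G.Adj v a then gdir (M.pt v) (M.path h).snd else 0

theorem path_not_nil {u v : V} (h : G.Adj u v) : ¬ (M.path h).Nil := by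
  intro hn
  exact h.ne (M.inj hn.eq)

theorem dirn_ne {v a b : V} (ha : G.Adj v a) (hb : G.Adj v b) (hab : a ≠ b) : M.dirn v a ≠ M.dirn v b := by
  intro he
  simp only [dirn, ha, hb, dif_pos] at he
  have e1 := gdir_spec ((M.path ha).adj_snd (M.path_not_nil ha))
  have e2 := gdir_spec ((M.path hb).adj_snd (M.path_not_nil hb))
  rw [he, ← e2] at e1
  obtain ⟨w, hw, hw1, hw2⟩ := M.cross ha hb (by
    intro h; rw [Sym2.eq_iff] at h
    rcases h with h | h
    · exact hab h.2
    · exact ha.ne h.2.symm) (M.path ha).snd ((M.path ha).getVert_mem_support 1)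
      (e1 ▸ (M.path hb).getVert_mem_support 1)
  have hwv : w = v := by
    rcases hw1 with h | h
    · exact h
    · rcases hw2 with h' | h'
      · exact h'
      · exact absurd (h.symm.trans h') hab
  have := (M.path ha).adj_snd (M.path_not_nil ha)
  rw [hw, hwv] at this
  exact gridG.loopless.irrefl _ this

theorem snd_lift {y z : V} (p : G.Walk y z) (hyz : y ≠ z) :
    gdir (M.pt y) (M.lift p).snd = M.dirn y p.snd := by
  cases p with
  | nil => exact absurd rfl hyz
  | cons h p =>
    have h1 : (SimpleGraph.Walk.cons h p).snd = _ := SimpleGraph.Walk.snd_cons p h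
    rw [h1]
    simp only [dirn, h, dif_pos, lift]
    congr 1
    simp only [SimpleGraph.Walk.snd, SimpleGraph.Walk.getVert_append]
    have : 0 < (M.path h).length := by
      rcases Nat.eq_zero_or_pos (M.path h).length with h0 | h0
      · exact absurd (M.inj (SimpleGraph.Walk.eq_of_length_eq_zero h0)) h.ne
      · exact h0
    by_cases h2 : 1 < (M.path h).length
    · rw [if_pos h2]
    · rw [if_neg h2]
      have : (M.path h).length = 1 := by omega
      rw [this]; simp
      conv_rhs => rw [← this]
      simp

theorem snd_eq_of_edge {y z : V} (p : G.Walk y z) (hp : p.IsPath) (h : s(y,z) ∈ p.edges) : p.snd = z := by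
  cases p with
  | nil => simp at h
  | cons h' p =>
    rw [SimpleGraph.Walk.cons_isPath_iff] at hp
    rw [SimpleGraph.Walk.snd_cons]
    simp only [SimpleGraph.Walk.edges_cons, List.mem_cons] at h
    rcases h with h | h
    · rw [Sym2.eq_iff] at h
      rcases h with h | h
      · exact h.2.symm
      · exact absurd h.1 h'.ne
    · exact absurd (p.fst_mem_support_of_mem_edges h) hp.2

theorem lift_share {y z : V} (hyz : y ≠ z) (p q : G.Walk y z) (hp : p.IsPath) (hq : q.IsPath)
    (hd : ∀ x ∈ p.support, x ∈ q.support → x = y ∨ x = z) (hs : p.snd ≠ q.snd) (x)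
    (hx : x ∈ (M.lift p).support) (hx' : x ∈ (M.lift q).support) : x = M.pt y ∨ x = M.pt z := by
  rcases M.mem_lift p x hx with ⟨a, b, h, hab, hxa⟩ | ⟨_, h⟩
  swap
  · exact absurd h.eq hyz
  rcases M.mem_lift q x hx' with ⟨a', b', h', hab', hxa'⟩ | ⟨_, h⟩
  swap
  · exact absurd h.eq hyz
  have ha := p.fst_mem_support_of_mem_edges hab
  have hb := p.snd_mem_support_of_mem_edges hab
  have ha' := q.fst_mem_support_of_mem_edges hab'
  have hb' := q.snd_mem_support_of_mem_edges hab'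
  by_cases he : s(a,b) = s(a',b')
  · exfalso
    have ha2 := q.fst_mem_support_of_mem_edges (he ▸ hab')
    have hb2 := q.snd_mem_support_of_mem_edges (he ▸ hab')
    have h1 := hd a ha ha2
    have h2 := hd b hb hb2
    have h3 : s(a,b) = s(y,z) := by
      have := h.ne
      rcases h1 with rfl | rfl <;> rcases h2 with rfl | rfl
      · exact absurd rfl this
      · rfl
      · exact Sym2.eq_swap
      · exact absurd rfl this
    rw [snd_eq_of_edge p hp (h3 ▸ hab), snd_eq_of_edge q hq (h3 ▸ he ▸ hab')] at hs
    exact hs rfl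
  · obtain ⟨w, rfl, hw1, hw2⟩ := M.cross h h' he x hxa hxa'
    have k1 : w ∈ p.support := by rcases hw1 with rfl | rfl <;> assumption
    have k2 : w ∈ q.support := by rcases hw2 with rfl | rfl <;> assumption
    rcases hd w k1 k2 with rfl | rfl
    · exact Or.inl rfl
    · exact Or.inr rfl

noncomputable def toRot : Rot G where
  o v a b c := ccw4 (M.dirn v a) (M.dirn v b) (M.dirn v c)
  rot h := ccw4_rot h
  asymm h := ccw4_asymm h
  total ha hb hc hab hac hbc := ccw4_total (M.dirn_ne ha hb hab) (M.dirn_ne ha hc hac) (M.dirn_ne hb hc hbc)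
  theta := by
    intro y z hyz p1 p2 p3 h1 h2 h3 d12 d13 d23 hy hz
    have hne := ccw4_ne hy
    have n12 : p1.snd ≠ p2.snd := fun h => hne.1 (by rw [h])
    have n13 : p1.snd ≠ p3.snd := fun h => hne.2.1 (by rw [h])
    have n23 : p2.snd ≠ p3.snd := fun h => hne.2.2 (by rw [h])
    refine grid_theta (fun h => hyz (M.inj h)) (M.lift p1) (M.lift p2) (M.lift p3)
      (M.lift_isPath _ h1) (M.lift_isPath _ h2) (M.lift_isPath _ h3)
      (M.lift_share hyz p1 p2 h1 h2 d12 n12) (M.lift_share hyz p1 p3 h1 h3 d13 n13)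
      (M.lift_share hyz p2 p3 h2 h3 d23 n23) ?_ ?_
    · rw [M.snd_lift _ hyz, M.snd_lift _ hyz, M.snd_lift _ hyz]; exact hy
    · have key : ∀ p : G.Walk y z, gdir (M.pt z) (M.lift p).penultimate = M.dirn z p.penultimate := by
        intro p
        have := M.snd_lift p.reverse hyz.symm
        rw [lift_reverse, SimpleGraph.Walk.snd_reverse, SimpleGraph.Walk.snd_reverse] at this
        exact this
      rw [key, key, key]; exact hz

end PathModel

/-! ### The depth-first certificate -/

section Certificate
open scoped Classical
variable {V : Type*} {G : SimpleGraph V}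

/-- The neighbours of `v` are exactly the members of the duplicate-free list `l`. -/
def Nb (G : SimpleGraph V) (v : V) (l : List V) : Prop := l.Nodup ∧ ∀ x, G.Adj v x ↔ x ∈ l

/-- The component of `v` outside `X`. -/
def comp (G : SimpleGraph V) (X : Set V) (v : V) : Set V := {y | RIn G Xᶜ v y}

theorem RIn.right {A : Set V} {x y : V} (h : RIn G A x y) : y ∈ A := by
  obtain ⟨p, hp⟩ := h
  exact hp _ p.end_mem_support

theorem RIn.left {A : Set V} {x y : V} (h : RIn G A x y) : x ∈ A := by
  obtain ⟨p, hp⟩ := h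
  exact hp _ p.start_mem_support

theorem RIn.path {A : Set V} {x y : V} (h : RIn G A x y) : ∃ p : G.Walk x y, p.IsPath ∧ ∀ z ∈ p.support, z ∈ A := by
  obtain ⟨p, hp⟩ := h
  exact ⟨p.bypass, p.bypass_isPath, fun z hz => hp z (p.support_bypass_subset_support hz)⟩

theorem comp_notMem {X : Set V} {v y : V} (h : y ∈ comp G X v) : y ∉ X := RIn.right h

theorem self_mem_comp {X : Set V} {v : V} (h : v ∉ X) : v ∈ comp G X v := RIn.refl h

theorem comp_eq_of_mem {X : Set V} {a b : V} (h : b ∈ comp G X a) : comp G X b = comp G X a := by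
  ext y
  exact ⟨fun h' => RIn.trans h h', fun h' => RIn.trans (RIn.symm h) h'⟩

theorem comp_wconn (X : Set V) (v : V) : WConn G (comp G X v) := by
  have key : ∀ y ∈ comp G X v, RIn G (comp G X v) v y := by
    rintro y ⟨p, hp⟩
    refine ⟨p, fun z hz => ⟨p.takeUntil z hz, fun w hw => hp w (SimpleGraph.Walk.support_takeUntil_subset_support _ hz hw)⟩⟩
  intro x hx y hy
  exact (key x hx).symm.trans (key y hy)

theorem mem_comp_insert {X : Set V} {v y : V} (hv : v ∉ X) :
    y ∈ comp G X v ↔ y = v ∨ ∃ a, G.Adj v a ∧ a ∉ X ∧ y ∈ comp G (insert v X) a := by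
  constructor
  · intro h
    obtain ⟨p, hp, hX⟩ := RIn.path h
    cases p with
    | nil => exact Or.inl rfl
    | @cons _ a _ hva q =>
      rw [SimpleGraph.Walk.cons_isPath_iff] at hp
      right
      refine ⟨a, hva, hX a (by simp), q, fun z hz => ?_⟩
      rintro (rfl | hzX)
      · exact hp.2 hz
      · exact hX z (by simp [hz]) hzX
  · rintro (rfl | ⟨a, hva, haX, h⟩)
    · exact self_mem_comp hv
    · exact (RIn.step hva hv haX).trans (RIn.mono (compl_subset_compl.2 (subset_insert _ _)) h)

theorem comp_closed {X : Set V} {v x y : V} (hx : x ∈ comp G X v) (hxy : G.Adj x y) (hy : y ∉ X) :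
    y ∈ comp G X v := RIn.trans hx (RIn.step hxy (comp_notMem hx) hy)

theorem wconn_insert {X : Set V} {u v : V} (hX : WConn G X) (hu : u ∈ X) (h : G.Adj u v) :
    WConn G (insert v X) := by
  have key : ∀ x ∈ insert v X, RIn G (insert v X) u x := by
    rintro x (rfl | hx)
    · exact RIn.step h (mem_insert_of_mem _ hu) (mem_insert _ _)
    · exact (hX u hu x hx).mono (subset_insert _ _)
  intro x hx y hy
  exact (key x hx).symm.trans (key y hy)

/-- DFS certificates. -/
inductive Dfs (G : SimpleGraph V) : Set V → V → V → Set V → List (V × V) → Prop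
  | leaf0 {X u v} : u ∈ X → v ∉ X → Nb G v [u] → Dfs G X u v {v} []
  | leaf1 {X u v y} : u ∈ X → v ∉ X → y ∈ X → Nb G v [u, y] → Dfs G X u v {v} [(v, y)]
  | leaf2 {X u v y y'} : u ∈ X → v ∉ X → y ∈ X → y' ∈ X → Nb G v [u, y, y'] →
      Dfs G X u v {v} [(v, y'), (v, y)]
  | pass {X u v a S L} : u ∈ X → v ∉ X → Nb G v [u, a] → Dfs G (insert v X) v a S L →
      Dfs G X u v (insert v S) L
  | s1 {X u v y a S L} : u ∈ X → v ∉ X → y ∈ X → Nb G v [u, y, a] → Dfs G (insert v X) v a S L →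
      Dfs G X u v (insert v S) (L ++ [(v, y)])
  | s2 {X u v y a S L} : u ∈ X → v ∉ X → y ∈ X → Nb G v [u, a, y] → Dfs G (insert v X) v a S L →
      Dfs G X u v (insert v S) ((v, y) :: L)
  | pop {X u v a b S L} : u ∈ X → v ∉ X → Nb G v [u, a, b] → Dfs G (insert v X) v a S ((b, v) :: L) →
      Dfs G X u v (insert v S) L
  | branch {X u v a b S₁ L₁ S₂ L₂} : u ∈ X → v ∉ X → Nb G v [u, a, b] →
      Dfs G (insert v X) v a S₁ L₁ → Dfs G (insert v X) v b S₂ L₂ → Disjoint S₁ S₂ →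
      Dfs G X u v (insert v (S₁ ∪ S₂)) (L₂ ++ L₁)

/-- A hook: a path from `c` entering `X` only at its last vertex, through the dart `w`. -/
structure Hook (G : SimpleGraph V) (X : Set V) (c : V) (w : V × V) (q : G.Walk c w.1) : Prop where
  path : q.IsPath
  pen : q.penultimate = w.2
  only : ∀ z ∈ q.support, z ∈ X → z = w.1

def Inv3 (R : Rot G) (X : Set V) (W : List (V × V)) : Prop :=
  ∀ w1 w2 w3, [w1, w2, w3].Sublist W → ∀ c ∉ X, ∀ (q1 : G.Walk c w1.1) (q2 : G.Walk c w2.1) (q3 : G.Walk c w3.1),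
    Hook G X c w1 q1 → Hook G X c w2 q2 → Hook G X c w3 q3 →
    (∀ z ∈ q1.support, z ∈ q2.support → z = c ∨ z ∈ X) →
    (∀ z ∈ q1.support, z ∈ q3.support → z = c ∨ z ∈ X) →
    (∀ z ∈ q2.support, z ∈ q3.support → z = c ∨ z ∈ X) →
    R.o c q1.snd q2.snd q3.snd

theorem snd_concat' {a b c : V} (p : G.Walk a b) (h : G.Adj b c) (hp : ¬ p.Nil) : (p.concat h).snd = p.snd := by
  cases p with
  | nil => simp at hp
  | cons h' q => simp [SimpleGraph.Walk.concat_cons]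

theorem Hook.mk' {X : Set V} {c : V} {w : V × V} (p : G.Walk c w.2) (hp : p.IsPath) (hX : ∀ z ∈ p.support, z ∉ X)
    (h : G.Adj w.2 w.1) (hw : w.1 ∈ X) : Hook G X c w (p.concat h) := by
  refine ⟨hp.concat (fun h' => hX _ h' hw) h, by simp, fun z hz hzX => ?_⟩
  rw [SimpleGraph.Walk.support_concat, List.mem_append] at hz
  rcases hz with hz | hz
  · exact absurd hzX (hX z hz)
  · simpa using hz

theorem inv3_step {R : Rot G} {X : Set V} {u v a : V} {rest : List (V × V)} (hu : u ∈ X) (hv : v ∉ X) (huv : G.Adj u v)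
    (hr : ∀ d ∈ rest, d.1 ∈ X) (hI : Inv3 R X ((u, v) :: rest)) : Inv3 R (insert v X) ((v, a) :: rest) := by
  intro w1 w2 w3 hs c hc q1 q2 q3 h1 h2 h3 d12 d13 d23
  have hcv : c ≠ v := fun h => hc (h ▸ mem_insert _ _)
  have hcX : c ∉ X := fun h => hc (mem_insert_of_mem _ h)
  have conv : ∀ w : V × V, ∀ q : G.Walk c w.1, w ∈ rest → Hook G (insert v X) c w q →
      Hook G X c w q ∧ v ∉ q.support := by
    intro w q hw h
    refine ⟨⟨h.path, h.pen, fun z hz hzX => h.only z hz (mem_insert_of_mem _ hzX)⟩, fun hvq => ?_⟩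
    have := h.only v hvq (mem_insert _ _)
    exact hv (this ▸ hr w hw)
  rcases List.sublist_cons_iff.1 hs with hs | ⟨r, hr1, hs⟩
  · obtain ⟨k1, n1⟩ := conv w1 q1 (hs.subset (by simp)) h1
    obtain ⟨k2, n2⟩ := conv w2 q2 (hs.subset (by simp)) h2
    obtain ⟨k3, n3⟩ := conv w3 q3 (hs.subset (by simp)) h3
    have sh : ∀ z : V, z ≠ v → (z = c ∨ z ∈ insert v X) → z = c ∨ z ∈ X := by
      rintro z hz (h | h | h)
      · exact Or.inl h
      · exact absurd h hz
      · exact Or.inr h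
    exact hI w1 w2 w3 (hs.cons _) c hcX q1 q2 q3 k1 k2 k3
      (fun z hz hz' => sh z (fun h => n1 (h ▸ hz)) (d12 z hz hz'))
      (fun z hz hz' => sh z (fun h => n1 (h ▸ hz)) (d13 z hz hz'))
      (fun z hz hz' => sh z (fun h => n2 (h ▸ hz)) (d23 z hz hz'))
  · simp only [List.cons.injEq] at hr1
    obtain ⟨rfl, rfl⟩ := hr1
    obtain ⟨k2, n2⟩ := conv w2 q2 (hs.subset (by simp)) h2
    obtain ⟨k3, n3⟩ := conv w3 q3 (hs.subset (by simp)) h3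
    have hnil : ¬ q1.Nil := fun h => hcv h.eq
    have sh : ∀ z : V, z ≠ v → (z = c ∨ z ∈ insert v X) → z = c ∨ z ∈ X := by
      rintro z hz (h | h | h)
      · exact Or.inl h
      · exact absurd h hz
      · exact Or.inr h
    have hX1 : ∀ z ∈ q1.support, z ∉ X := by
      intro z hz hzX
      have : z = v := h1.only z hz (mem_insert_of_mem _ hzX)
      exact hv (this ▸ hzX)
    have := hI (u, v) w2 w3 (hs.cons_cons _) c hcX (q1.concat huv.symm) q2 q3
      (Hook.mk' (w := (u,v)) q1 h1.path hX1 huv.symm hu) k2 k3 ?_ ?_ (fun z hz hz' => sh z (fun h => n2 (h ▸ hz)) (d23 z hz hz'))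
    · rwa [snd_concat' _ _ hnil] at this
    · intro z hz hz'
      rw [SimpleGraph.Walk.support_concat, List.mem_append] at hz
      rcases hz with hz | hz
      · exact sh z (fun h => n2 (h ▸ hz')) (d12 z hz hz')
      · right; simp at hz; exact hz ▸ hu
    · intro z hz hz'
      rw [SimpleGraph.Walk.support_concat, List.mem_append] at hz
      rcases hz with hz | hz
      · exact sh z (fun h => n3 (h ▸ hz')) (d13 z hz hz')
      · right; simp at hz; exact hz ▸ hu

theorem snd_mem' {a b : V} (p : G.Walk a b) : p.snd ∈ p.support := SimpleGraph.Walk.getVert_mem_support _ _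

theorem adj_snd' {a b : V} (p : G.Walk a b) (h : a ≠ b) : G.Adj a p.snd := 
  p.adj_snd (fun h' => h h'.eq)

/-- hooks to the same target through different darts have different first steps -/
theorem snd_ne {X : Set V} {c : V} {w w' : V × V} {q : G.Walk c w.1} {q' : G.Walk c w'.1} (hw : w.1 ∈ X)
    (hc : c ∉ X) (hq : Hook G X c w q) (hq' : Hook G X c w' q') (hww : w ≠ w')
    (hw' : w'.1 ∈ X)
    (hd : ∀ z ∈ q.support, z ∈ q'.support → z = c ∨ z ∈ X) : q.snd ≠ q'.snd := by
  have one : ∀ (w : V × V) (q : G.Walk c w.1), Hook G X c w q → w.1 ∈ X → q.snd ∈ X → w = (q.snd, c) := by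
    intro w q hq hw h
    have h1 := hq.only _ (snd_mem' _) h
    have h2 : q.penultimate = c := by
      have hcw : c ≠ w.1 := fun h => hc (h ▸ hw)
      rcases w with ⟨w1, w2⟩
      cases q with
      | nil => exact absurd rfl hcw
      | cons h' q'' =>
        simp at h1
        subst h1
        have := hq.path
        rw [SimpleGraph.Walk.cons_isPath_iff] at this
        have := SimpleGraph.Walk.isPath_iff_nil.1 this.1
        rw [← SimpleGraph.Walk.eq_nil_iff_nil] at this
        subst this
        rfl
    rw [hq.pen] at h2
    exact Prod.ext h1.symm h2
  intro he
  have h1 : q.snd ∈ X := by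
    rcases hd q.snd (snd_mem' _) (he ▸ snd_mem' _) with h | h
    · exact absurd h.symm (adj_snd' q (fun h => hc (h ▸ hw))).ne
    · exact h
  exact hww ((one w q hq hw h1).trans ((he ▸ one w' q' hq' hw' (he ▸ h1)).symm))

theorem inv3_step2 {R : Rot G} {X : Set V} {u v a b : V} {rest : List (V × V)} (hX : WConn G X) (hu : u ∈ X) (hv : v ∉ X)
    (huv : G.Adj u v) (hab : a ≠ b) (ho : R.o v a u b)
    (hr : ∀ d ∈ rest, d.1 ∈ X) (hI : Inv3 R X ((u, v) :: rest)) :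
    Inv3 R (insert v X) ((v, a) :: (v, b) :: rest) := by
  have I1 := inv3_step (a := a) hu hv huv hr hI
  have I2 := inv3_step (a := b) hu hv huv hr hI
  intro w1 w2 w3 hs
  rcases List.sublist_cons_iff.1 hs with hs' | ⟨r, hr1, hs'⟩
  · exact I2 w1 w2 w3 hs'
  simp only [List.cons.injEq] at hr1
  obtain ⟨rfl, rfl⟩ := hr1
  rcases List.sublist_cons_iff.1 hs' with hs'' | ⟨r, hr1, hs''⟩
  · exact I1 _ w2 w3 (hs''.cons_cons _)
  simp only [List.cons.injEq] at hr1
  obtain ⟨rfl, rfl⟩ := hr1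
  have hw3 : w3 ∈ rest := hs''.subset (by simp)
  have hw3X := hr _ hw3
  intro c hc q1 q2 q3 h1 h2 h3 d12 d13 d23
  have hcv : c ≠ v := fun h => hc (h ▸ mem_insert _ _)
  have hcw : c ≠ w3.1 := fun h => hc (h ▸ mem_insert_of_mem _ hw3X)
  have hvw : v ≠ w3.1 := fun h => hv (h ▸ hw3X)
  have n12 := snd_ne (w := (v,a)) (w' := (v,b)) (mem_insert _ _) hc h1 h2 (by simp [hab]) (mem_insert _ _) d12
  have n13 := snd_ne (w := (v,a)) (mem_insert _ _) hc h1 h3 (fun h => hvw (by rw [← h])) (mem_insert_of_mem _ hw3X) d13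
  have n23 := snd_ne (w := (v,b)) (mem_insert _ _) hc h2 h3 (fun h => hvw (by rw [← h])) (mem_insert_of_mem _ hw3X) d23
  refine (R.total (adj_snd' q1 hcv) (adj_snd' q2 hcv) (adj_snd' q3 hcw) n12 n13 n23).resolve_right fun hbad => ?_
  obtain ⟨p, hp, hpX⟩ := (hX u hu w3.1 hw3X).path
  have hpath : (p.append q3.reverse).IsPath := isPath_append' hp h3.path.reverse (fun z hz hz' =>
    h3.only z (by simpa using hz') (mem_insert_of_mem _ (hpX z hz)))
  have hpv : v ∉ (p.append q3.reverse).support := by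
    intro h
    rcases (SimpleGraph.Walk.mem_support_append_iff _ _).1 h with h | h
    · exact hv (hpX v h)
    · exact hvw (h3.only v (by simpa using h) (mem_insert _ _))
  have hpen : (SimpleGraph.Walk.cons huv.symm (p.append q3.reverse)).penultimate = q3.snd := by
    rw [← SimpleGraph.Walk.snd_reverse, SimpleGraph.Walk.reverse_cons, SimpleGraph.Walk.reverse_append,
      SimpleGraph.Walk.reverse_reverse]
    cases q3 with
    | nil => exact absurd rfl hcw
    | cons h q => simp
  have sh : ∀ (w : V) (q : G.Walk c v), Hook G (insert v X) c (v, w) q →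
      (∀ z ∈ q.support, z ∈ q3.support → z = c ∨ z ∈ insert v X) →
      ∀ x ∈ q.reverse.support, x ∈ (SimpleGraph.Walk.cons huv.symm (p.append q3.reverse)).support → x = v ∨ x = c := by
    intro w q hq hd x hx hx'
    have hx : x ∈ q.support := by simpa using hx
    have hon : x ∈ insert v X → x = v := fun h => hq.only x hx h
    rw [SimpleGraph.Walk.support_cons, List.mem_cons, SimpleGraph.Walk.mem_support_append_iff] at hx'
    rcases hx' with h | h | h
    · exact Or.inl h
    · exact Or.inl (hon (mem_insert_of_mem _ (hpX x h)))
    · rcases hd x hx (by simpa using h) with h | h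
      · exact Or.inr h
      · exact Or.inl (hon h)
  refine R.theta hcv.symm q1.reverse (SimpleGraph.Walk.cons huv.symm (p.append q3.reverse)) q2.reverse
    h1.path.reverse ((SimpleGraph.Walk.cons_isPath_iff _ _).2 ⟨hpath, hpv⟩) h2.path.reverse
    (sh a q1 h1 d13) ?_ (fun x hx hx' => sh b q2 h2 d23 x hx' hx) ?_ ?_
  · intro x hx hx'
    have hx : x ∈ q1.support := by simpa using hx
    have hx' : x ∈ q2.support := by simpa using hx'
    rcases d12 x hx hx' with h | h
    · exact Or.inr h
    · exact Or.inl (h1.only x hx h)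
  · rw [SimpleGraph.Walk.snd_reverse, SimpleGraph.Walk.snd_reverse, h1.pen, h2.pen]
    simpa using ho
  · rw [SimpleGraph.Walk.penultimate_reverse, SimpleGraph.Walk.penultimate_reverse, hpen]
    exact hbad

end Certificate

/-! ### Exploring the graph -/

section Explore
open scoped Classical
variable {V : Type*} {G : SimpleGraph V}

theorem Nb.perm {v : V} {l l' : List V} (h : Nb G v l) (hp : l.Perm l') : Nb G v l' :=
  ⟨hp.nodup_iff.1 h.1, fun x => (h.2 x).trans hp.mem_iff⟩

theorem exists_nb [Finite V] {v : V} (hdeg : Nat.card {u // G.Adj v u} ≤ 3) :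
    Nb G v [] ∨ (∃ a, Nb G v [a]) ∨ (∃ a b, Nb G v [a, b]) ∨ ∃ a b c, Nb G v [a, b, c] := by
  have := Fintype.ofFinite V
  have hN : Nb G v (Finset.univ.filter (fun u => G.Adj v u)).toList :=
    ⟨Finset.nodup_toList _, by simp⟩
  have hl : (Finset.univ.filter (fun u => G.Adj v u)).toList.length ≤ 3 := by
    rw [Finset.length_toList, ← Fintype.card_subtype, ← Nat.card_eq_fintype_card]; exact hdeg
  generalize (Finset.univ.filter (fun u => G.Adj v u)).toList = l at hN hl
  match l, hN, hl with
  | [], h, _ => exact Or.inl h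
  | [a], h, _ => exact Or.inr (Or.inl ⟨a, h⟩)
  | [a, b], h, _ => exact Or.inr (Or.inr (Or.inl ⟨a, b, h⟩))
  | [a, b, c], h, _ => exact Or.inr (Or.inr (Or.inr ⟨a, b, c, h⟩))
  | _ :: _ :: _ :: _ :: _, _, h => simp at h; omega

theorem exists_nb_of_adj [Finite V] {v u : V} (hdeg : Nat.card {u // G.Adj v u} ≤ 3) (hu : G.Adj v u) :
    Nb G v [u] ∨ (∃ a, Nb G v [u, a]) ∨ (∃ a b, Nb G v [u, a, b]) := by
  rcases exists_nb hdeg with h | ⟨a, h⟩ | ⟨a, b, h⟩ | ⟨a, b, c, h⟩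
  · have := (h.2 u).1 hu; simp at this
  · have := (h.2 u).1 hu; simp at this; subst this; exact Or.inl h
  · have := (h.2 u).1 hu; simp at this
    rcases this with rfl | rfl
    · exact Or.inr (Or.inl ⟨_, h⟩)
    · exact Or.inr (Or.inl ⟨a, h.perm (List.Perm.swap _ _ _)⟩)
  · have := (h.2 u).1 hu; simp at this
    rcases this with rfl | rfl | rfl
    · exact Or.inr (Or.inr ⟨_, _, h⟩)
    · exact Or.inr (Or.inr ⟨a, c, h.perm (List.Perm.swap _ _ _)⟩)
    · exact Or.inr (Or.inr ⟨a, b, h.perm (by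
        have : [a, b, u] = [a, b] ++ [u] := rfl
        rw [this]; exact List.perm_append_comm)⟩)

structure Ex (R : Rot G) (X : Set V) (u v : V) (rest : List (V × V)) : Prop where
  conn : WConn G X
  hu : u ∈ X
  hv : v ∉ X
  adj : G.Adj u v
  nodup : ((u, v) :: rest).Nodup
  tail : ∀ d ∈ rest, d.1 ∈ X
  dart : ∀ d ∈ rest, G.Adj d.1 d.2
  edge : ∀ x ∈ X, ∀ y ∈ comp G X v, G.Adj x y → (x, y) ∈ (u, v) :: rest
  inv : Inv3 R X ((u, v) :: rest)

/-- the strand list seen from the component `S` -/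
noncomputable def fl (S : Set V) (rest : List (V × V)) : List (V × V) := (rest.filter (fun d => decide (d.2 ∈ S))).map Prod.swap

theorem fl_congr {S S' : Set V} {rest : List (V × V)} (h : ∀ d ∈ rest, d.2 ∈ S ↔ d.2 ∈ S') : fl S rest = fl S' rest := by
  unfold fl
  congr 1
  apply List.filter_congr
  intro d hd
  simp [h d hd]

theorem fl_append (S : Set V) (l l' : List (V × V)) : fl S (l ++ l') = fl S l ++ fl S l' := by
  simp [fl]

theorem fl_cons_mem {S : Set V} {d : V × V} (hd : d.2 ∈ S) (l : List (V × V)) : fl S (d :: l) = d.swap :: fl S l := by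
  simp [fl, hd]

theorem fl_cons_notMem {S : Set V} {d : V × V} (hd : d.2 ∉ S) (l : List (V × V)) : fl S (d :: l) = fl S l := by
  simp [fl, hd]

theorem fl_union {A B : Set V} {l : List (V × V)} (hAB : Disjoint A B)
    (h : l.Pairwise (fun w w' => ¬ (w.2 ∈ A ∧ w'.2 ∈ B))) : fl (A ∪ B) l = fl B l ++ fl A l := by
  induction l with
  | nil => simp [fl]
  | cons d l ih =>
    rw [List.pairwise_cons] at h
    by_cases hA : d.2 ∈ A
    · have hB : d.2 ∉ B := fun hB => hAB.notMem_of_mem_left hA hB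
      have h0 : fl B l = [] := by
        simp only [fl, List.map_eq_nil_iff, List.filter_eq_nil_iff, decide_eq_true_eq]
        exact fun x hx hxB => h.1 x hx ⟨hA, hxB⟩
      rw [fl_cons_mem (S := A ∪ B) (Or.inl hA), fl_cons_notMem hB, fl_cons_mem hA, ih h.2, h0]
      simp
    · by_cases hB : d.2 ∈ B
      · rw [fl_cons_mem (S := A ∪ B) (Or.inr hB), fl_cons_mem hB, fl_cons_notMem hA, ih h.2]; simp
      · rw [fl_cons_notMem hA, fl_cons_notMem hB, fl_cons_notMem (by simp [hA, hB]), ih h.2]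

namespace Ex
variable {R : Rot G} {X : Set V} {u v : V} {rest : List (V × V)}

theorem head_v (h : Ex R X u v rest) {d : V × V} (hd : d ∈ rest) (hdv : d.2 = v) : G.Adj v d.1 ∧ d.1 ≠ u ∧ d = (d.1, v) := by
  obtain ⟨x, y⟩ := d
  simp at hdv; subst hdv
  refine ⟨(h.dart _ hd).symm, ?_, rfl⟩
  rintro rfl
  exact (List.nodup_cons.1 h.nodup).1 hd

theorem sub_comp (h : Ex R X u v rest) {a : V} (ha : G.Adj v a) (haX : a ∉ X) :
    comp G (insert v X) a ⊆ comp G X v := fun _ hy => (mem_comp_insert h.hv).2 (Or.inr ⟨a, ha, haX, hy⟩)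

theorem child (h : Ex R X u v rest) {a : V} (ha : G.Adj v a) (haX : a ∉ X)
    (honly : ∀ y, G.Adj v y → y ∈ comp G (insert v X) a → y = a) : Ex R (insert v X) v a rest where
  conn := wconn_insert h.conn h.hu h.adj
  hu := mem_insert _ _
  hv := by
    rintro (h' | h')
    · exact ha.ne h'.symm
    · exact haX h'
  adj := ha
  nodup := List.nodup_cons.2 ⟨fun hm => h.hv (h.tail _ hm), (List.nodup_cons.1 h.nodup).2⟩
  tail d hd := mem_insert_of_mem _ (h.tail d hd)
  dart := h.dart
  edge := by
    rintro x (rfl | hx) y hy hxy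
    · rw [honly y hxy hy]; simp
    · have := h.edge x hx y (h.sub_comp ha haX hy) hxy
      rcases List.mem_cons.1 this with h' | h'
      · exfalso
        simp only [Prod.mk.injEq] at h'
        exact comp_notMem hy (h'.2 ▸ mem_insert _ _)
      · exact List.mem_cons_of_mem _ h'
  inv := inv3_step h.hu h.hv h.adj h.tail h.inv

theorem child2 (h : Ex R X u v rest) {a b : V} (hn : Nb G v [u, a, b]) (haX : a ∉ X) (hbX : b ∉ X)
    (ho : R.o v a u b) : Ex R (insert v X) v a ((v, b) :: rest) := by
  have ha : G.Adj v a := (hn.2 a).2 (by simp)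
  have hb : G.Adj v b := (hn.2 b).2 (by simp)
  have hab : a ≠ b := by
    have := hn.1; simp at this; exact this.2
  constructor
  · exact wconn_insert h.conn h.hu h.adj
  · exact mem_insert _ _
  · rintro (h' | h')
    · exact ha.ne h'.symm
    · exact haX h'
  · exact ha
  · simp only [List.nodup_cons, List.mem_cons, Prod.mk.injEq, not_or]
    refine ⟨⟨by simp [hab], fun hm => h.hv (h.tail _ hm)⟩, fun hm => h.hv (h.tail _ hm), (List.nodup_cons.1 h.nodup).2⟩
  · intro d hd
    rcases List.mem_cons.1 hd with rfl | hd
    · exact mem_insert _ _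
    · exact mem_insert_of_mem _ (h.tail d hd)
  · intro d hd
    rcases List.mem_cons.1 hd with rfl | hd
    · exact hb
    · exact h.dart d hd
  · rintro x (rfl | hx) y hy hxy
    · have := (hn.2 y).1 hxy
      simp at this
      rcases this with rfl | rfl | rfl
      · exact absurd (mem_insert_of_mem _ h.hu) (comp_notMem hy)
      · simp
      · simp
    · have := h.edge x hx y (h.sub_comp ha haX hy) hxy
      rcases List.mem_cons.1 this with h' | h'
      · exfalso
        simp only [Prod.mk.injEq] at h'
        exact comp_notMem hy (h'.2 ▸ mem_insert _ _)
      · exact List.mem_cons_of_mem _ (List.mem_cons_of_mem _ h')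
  · exact inv3_step2 h.conn h.hu h.hv h.adj hab ho h.tail h.inv

theorem comp_leaf (h : Ex R X u v rest) (hX : ∀ y, G.Adj v y → y ∈ X) : comp G X v = {v} := by
  ext y
  rw [mem_comp_insert h.hv]
  simp only [mem_singleton_iff, or_iff_left_iff_imp]
  rintro ⟨a, ha, haX, -⟩
  exact absurd (hX a ha) haX

theorem comp_one (h : Ex R X u v rest) {a : V} (ha : G.Adj v a) (haX : a ∉ X) (hX : ∀ y, G.Adj v y → y ∉ X → y ∈ comp G (insert v X) a) :
    comp G X v = insert v (comp G (insert v X) a) := by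
  ext y
  rw [mem_comp_insert h.hv, mem_insert_iff]
  refine or_congr Iff.rfl ⟨?_, fun hy => ⟨a, ha, haX, hy⟩⟩
  rintro ⟨b, hb, hbX, hy⟩
  rwa [comp_eq_of_mem (hX b hb hbX)] at hy

theorem fl_leaf (h : Ex R X u v rest) (l : List V) (hl : l.Nodup) (hm : ∀ y, y ∈ l ↔ G.Adj v y ∧ y ≠ u ∧ y ∈ X) :
    (fl {v} rest).Perm (l.map (fun y => (v, y))) := by
  have h1 : (rest.filter (fun d => decide (d.2 ∈ ({v} : Set V)))).Perm (l.map (fun y => (y, v))) := by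
    rw [List.perm_ext_iff_of_nodup]
    · rintro ⟨x, y⟩
      simp only [mem_singleton_iff, List.mem_filter, decide_eq_true_eq, List.mem_map, Prod.mk.injEq]
      constructor
      · rintro ⟨hd, rfl⟩
        exact ⟨x, (hm x).2 ⟨(h.dart _ hd).symm, (h.head_v hd rfl).2.1, h.tail _ hd⟩, rfl, rfl⟩
      · rintro ⟨x', hx', rfl, rfl⟩
        obtain ⟨k1, k2, k3⟩ := (hm x').1 hx'
        have := h.edge x' k3 v (self_mem_comp h.hv) k1.symm
        rcases List.mem_cons.1 this with h' | h'
        · simp at h'; exact absurd h' k2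
        · exact ⟨h', rfl⟩
    · exact ((List.nodup_cons.1 h.nodup).2).filter _
    · exact hl.map (fun a b hab => (Prod.mk.inj hab).1)
  have := h1.map Prod.swap
  simpa [fl, Function.comp_def] using this

theorem split (h : Ex R X u v rest) {y a : V} (hn : Nb G v [u, y, a]) (hy : y ∈ X) (haX : a ∉ X) :
    fl (comp G X v) rest = (v, y) :: fl (comp G (insert v X) a) rest ∨
    fl (comp G X v) rest = fl (comp G (insert v X) a) rest ++ [(v, y)] := by
  have ha : G.Adj v a := (hn.2 a).2 (by simp)
  have hvy : G.Adj v y := (hn.2 y).2 (by simp)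
  have huy : u ≠ y := by have := hn.1; simp at this; tauto
  have hcomp : comp G X v = insert v (comp G (insert v X) a) := by
    refine h.comp_one ha haX fun z hz hzX => ?_
    have := (hn.2 z).1 hz
    simp at this
    rcases this with rfl | rfl | rfl
    · exact absurd h.hu hzX
    · exact absurd hy hzX
    · exact self_mem_comp (by rintro (h' | h'); exacts [ha.ne h'.symm, haX h'])
  set S := comp G (insert v X) a with hS
  have hvS : v ∉ S := fun h' => comp_notMem h' (mem_insert _ _)
  have hSX : ∀ z ∈ S, z ∉ X := fun z hz hzX => comp_notMem hz (mem_insert_of_mem _ hzX)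
  have hd0 : (y, v) ∈ rest := by
    rcases List.mem_cons.1 (h.edge y hy v (self_mem_comp h.hv) hvy.symm) with h' | h'
    · simp at h'; exact absurd h'.symm huy
    · exact h'
  obtain ⟨l1, l2, hl⟩ := List.append_of_mem hd0
  have hnd : (l1 ++ (y, v) :: l2).Nodup := hl ▸ (List.nodup_cons.1 h.nodup).2
  have hnd2 : (y, v) ∉ l1 ∧ (y, v) ∉ l2 := by
    have := (List.nodup_middle.1 hnd)
    rw [List.nodup_cons] at this
    simpa using this.1
  have hne : ∀ d ∈ rest, d ≠ (y, v) → (d.2 ∈ comp G X v ↔ d.2 ∈ S) := by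
    intro d hd hdne
    rw [hcomp, mem_insert_iff]
    refine or_iff_right fun hdv => ?_
    obtain ⟨k1, k2, k3⟩ := h.head_v hd hdv
    have := (hn.2 _).1 k1
    simp at this
    rcases this with h' | h' | h'
    · exact k2 h'
    · exact hdne (h' ▸ k3)
    · exact haX (h' ▸ h.tail _ hd)
  have e1 : fl (comp G X v) l1 = fl S l1 := fl_congr fun d hd => hne d (by rw [hl]; simp [hd]) (fun h' => hnd2.1 (h' ▸ hd))
  have e2 : fl (comp G X v) l2 = fl S l2 := fl_congr fun d hd => hne d (by rw [hl]; simp [hd]) (fun h' => hnd2.2 (h' ▸ hd))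
  have e3 : fl (comp G X v) rest = fl S l1 ++ (v, y) :: fl S l2 := by
    rw [hl, fl_append, fl_cons_mem (by simpa using self_mem_comp h.hv), e1, e2]; rfl
  have e4 : fl S rest = fl S l1 ++ fl S l2 := by
    rw [hl, fl_append, fl_cons_notMem (by simpa using hvS)]
  rw [e3, e4]
  by_cases k1 : fl S l1 = []
  · left; simp [k1]
  by_cases k2 : fl S l2 = []
  · right; simp [k2]
  exfalso
  have ex : ∀ l, fl S l ≠ [] → ∃ w ∈ l, w.2 ∈ S := by
    intro l hl
    by_contra hcon
    push Not at hcon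
    apply hl
    simp only [fl, List.map_eq_nil_iff, List.filter_eq_nil_iff, decide_eq_true_eq]
    exact hcon
  obtain ⟨w1, hw1, hw1S⟩ := ex l1 k1
  obtain ⟨w2, hw2, hw2S⟩ := ex l2 k2
  have hw1r : w1 ∈ rest := by rw [hl]; simp [hw1]
  have hw2r : w2 ∈ rest := by rw [hl]; simp [hw2]
  obtain ⟨c, hcS, q, hqS, hqd⟩ := tripod (H := G) (comp_wconn (insert v X) a) ![a, w1.2, w2.2] (by
    intro i; fin_cases i
    · exact self_mem_comp (by rintro (h' | h'); exacts [ha.ne h'.symm, haX h'])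
    · exact hw1S
    · exact hw2S)
  have hbp : ∀ i, ∀ z ∈ (q i).bypass.support, z ∈ (q i).support := fun i z hz => (q i).support_bypass_subset_support hz
  have hcX : c ∉ X := hSX c hcS
  -- the three hooks
  let pa : G.Walk c a := (q 0).bypass
  let p1 : G.Walk c w1.2 := (q 1).bypass
  let p2 : G.Walk c w2.2 := (q 2).bypass
  have hpa : pa.IsPath := (q 0).bypass_isPath
  have hp1 : p1.IsPath := (q 1).bypass_isPath
  have hp2 : p2.IsPath := (q 2).bypass_isPath
  have hpaS : ∀ z ∈ pa.support, z ∈ S := fun z hz => hqS 0 z (hbp 0 z hz)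
  have hp1S : ∀ z ∈ p1.support, z ∈ S := fun z hz => hqS 1 z (hbp 1 z hz)
  have hp2S : ∀ z ∈ p2.support, z ∈ S := fun z hz => hqS 2 z (hbp 2 z hz)
  have da1 : ∀ z ∈ pa.support, z ∈ p1.support → z = c := fun z hz hz' => hqd 0 1 (by decide) z (hbp 0 z hz) (hbp 1 z hz')
  have da2 : ∀ z ∈ pa.support, z ∈ p2.support → z = c := fun z hz hz' => hqd 0 2 (by decide) z (hbp 0 z hz) (hbp 2 z hz')
  have d12 : ∀ z ∈ p1.support, z ∈ p2.support → z = c := fun z hz hz' => hqd 1 2 (by decide) z (hbp 1 z hz) (hbp 2 z hz')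
  have hav : (pa.concat ha.symm).IsPath := hpa.concat (fun h' => hvS (hpaS v h')) ha.symm
  have havX : ∀ z ∈ (pa.concat ha.symm).support, z ∉ X := by
    intro z hz
    rw [SimpleGraph.Walk.support_concat, List.mem_append] at hz
    rcases hz with hz | hz
    · exact hSX z (hpaS z hz)
    · simp at hz; exact hz ▸ h.hv
  have memc : ∀ {x : V} (hx : G.Adj v x), x ∈ X → ∀ z ∈ ((pa.concat ha.symm).concat hx).support, z ∈ S → z ∈ pa.support := by
    intro x hx hxX z hz hzS
    rw [SimpleGraph.Walk.support_concat, List.mem_append, SimpleGraph.Walk.support_concat, List.mem_append] at hz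
    rcases hz with (hz | hz) | hz
    · exact hz
    · simp at hz; exact absurd hzS (hz ▸ hvS)
    · simp at hz; exact absurd (hz ▸ hxX) (hSX z hzS)
  have memw : ∀ {x y : V} (p : G.Walk c x) (hxy : G.Adj x y), ∀ z ∈ (p.concat hxy).support, y ∈ X → z ∈ p.support ∨ z ∈ X := by
    intro x y p hxy z hz hyX
    rw [SimpleGraph.Walk.support_concat, List.mem_append] at hz
    rcases hz with hz | hz
    · exact Or.inl hz
    · simp at hz; exact Or.inr (hz ▸ hyX)
  have t1 := h.tail w1 hw1r
  have t2 := h.tail w2 hw2r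
  have a1 := (h.dart w1 hw1r).symm
  have a2 := (h.dart w2 hw2r).symm
  have H1 := Hook.mk' p1 hp1 (fun z hz => hSX z (hp1S z hz)) a1 t1
  have H2 := Hook.mk' p2 hp2 (fun z hz => hSX z (hp2S z hz)) a2 t2
  have s12 : ∀ z ∈ (p1.concat a1).support, z ∈ (p2.concat a2).support → z = c ∨ z ∈ X := by
    intro z hz hz'
    rcases memw p1 a1 z hz t1 with hz | hz
    · rcases memw p2 a2 z hz' t2 with hz' | hz'
      · exact Or.inl (d12 z hz hz')
      · exact Or.inr hz'
    · exact Or.inr hz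
  have sa1 : ∀ {x : V} (hx : G.Adj v x), x ∈ X → ∀ z ∈ ((pa.concat ha.symm).concat hx).support, z ∈ (p1.concat a1).support → z = c ∨ z ∈ X := by
    intro x hx hxX z hz hz'
    rcases memw p1 a1 z hz' t1 with hz' | hz'
    · exact Or.inl (da1 z (memc hx hxX z hz (hp1S z hz')) hz')
    · exact Or.inr hz'
  have sa2 : ∀ {x : V} (hx : G.Adj v x), x ∈ X → ∀ z ∈ ((pa.concat ha.symm).concat hx).support, z ∈ (p2.concat a2).support → z = c ∨ z ∈ X := by
    intro x hx hxX z hz hz'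
    rcases memw p2 a2 z hz' t2 with hz' | hz'
    · exact Or.inl (da2 z (memc hx hxX z hz (hp2S z hz')) hz')
    · exact Or.inr hz'
  have hnil : ¬ (pa.concat ha.symm).Nil := by
    intro h'
    exact hvS (h'.eq ▸ hcS)
  have o1 := h.inv (u, v) w1 w2 (by
    rw [hl]
    refine List.Sublist.cons_cons _ ?_
    refine (List.singleton_sublist.2 hw1).append (l₁ := [w1]) (r₁ := [w2]) ((List.singleton_sublist.2 hw2).cons _)) c hcX
    ((pa.concat ha.symm).concat h.adj.symm) _ _ (Hook.mk' (w := (u, v)) _ hav havX h.adj.symm h.hu) H1 H2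
    (sa1 h.adj.symm h.hu) (sa2 h.adj.symm h.hu) s12
  have o2 := h.inv w1 (y, v) w2 (by
    rw [hl]
    refine List.Sublist.cons _ ?_
    refine (List.singleton_sublist.2 hw1).append (l₁ := [w1]) (r₁ := [(y, v), w2]) ((List.singleton_sublist.2 hw2).cons_cons _)) c hcX
    _ ((pa.concat ha.symm).concat hvy) _ H1 (Hook.mk' (w := (y, v)) _ hav havX hvy hy) H2
    (fun z hz hz' => sa1 hvy hy z hz' hz) s12 (sa2 hvy hy)
  rw [snd_concat' _ _ hnil] at o1 o2
  exact R.asymm (R.rot o1) o2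

end Ex

theorem explore [Finite V] (hdeg : ∀ v : V, Nat.card {u // G.Adj v u} ≤ 3) (R : Rot G) (n : ℕ) :
    ∀ (X : Set V) (u v : V) (rest : List (V × V)), Xᶜ.ncard = n → Ex R X u v rest →
      Dfs G X u v (comp G X v) (fl (comp G X v) rest) := by
  induction n using Nat.strong_induction_on with
  | _ n ih =>
  intro X u v rest hcard h
  have IH : ∀ a rest', Ex R (insert v X) v a rest' →
      Dfs G (insert v X) v a (comp G (insert v X) a) (fl (comp G (insert v X) a) rest') := by
    intro a rest' h'
    refine ih _ ?_ _ _ _ _ rfl h'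
    rw [← hcard]
    refine Set.ncard_lt_ncard ⟨compl_subset_compl.2 (subset_insert _ _), fun hs => ?_⟩ (Set.toFinite _)
    exact hs h.hv (mem_insert _ _)
  have selfc : ∀ a, G.Adj v a → a ∉ X → a ∈ comp G (insert v X) a := fun a ha haX =>
    self_mem_comp (by rintro (h' | h'); exacts [ha.ne h'.symm, haX h'])
  rcases exists_nb_of_adj (hdeg v) h.adj.symm with hn | ⟨a, hn⟩ | ⟨a, b, hn⟩
  · have hX : ∀ y, G.Adj v y → y ∈ X := by
      intro y hy; have := (hn.2 y).1 hy; simp at this; exact this ▸ h.hu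
    rw [h.comp_leaf hX]
    have := h.fl_leaf [] (by simp) (by
      intro y; simp only [List.not_mem_nil, ne_eq, false_iff, not_and]
      intro hy hne; have := (hn.2 y).1 hy; simp at this; exact absurd this hne)
    rw [List.map_nil, List.perm_nil] at this
    rw [this]
    exact Dfs.leaf0 h.hu h.hv hn
  · have hua : u ≠ a := by have := hn.1; simp at this; exact this
    have ha : G.Adj v a := (hn.2 a).2 (by simp)
    by_cases haX : a ∈ X
    · have hX : ∀ y, G.Adj v y → y ∈ X := by
        intro y hy; have := (hn.2 y).1 hy; simp at this
        rcases this with rfl | rfl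
        exacts [h.hu, haX]
      rw [h.comp_leaf hX]
      have := h.fl_leaf [a] (by simp) (by
        intro y; rw [hn.2 y]; simp only [List.mem_cons, List.not_mem_nil, or_false]
        constructor
        · rintro rfl; exact ⟨Or.inr rfl, hua.symm, haX⟩
        · tauto)
      rw [List.map_singleton, List.perm_singleton] at this
      rw [this]
      exact Dfs.leaf1 h.hu h.hv haX hn
    · have hc := h.comp_one ha haX (by
        intro y hy hyX; have := (hn.2 y).1 hy; simp at this
        rcases this with rfl | rfl
        · exact absurd h.hu hyX
        · exact selfc _ hy hyX)
      have hf : fl (comp G X v) rest = fl (comp G (insert v X) a) rest := by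
        refine fl_congr fun d hd => ?_
        rw [hc, mem_insert_iff]
        refine or_iff_right fun hdv => ?_
        obtain ⟨k1, k2, k3⟩ := h.head_v hd hdv
        have := (hn.2 _).1 k1
        simp at this
        rcases this with h' | h'
        · exact k2 h'
        · exact haX (h' ▸ h.tail _ hd)
      rw [hf, hc]
      refine Dfs.pass h.hu h.hv hn (IH a rest (h.child ha haX fun y hy hyc => ?_))
      have := (hn.2 y).1 hy; simp at this
      rcases this with rfl | rfl
      · exact absurd (mem_insert_of_mem _ h.hu) (comp_notMem hyc)
      · rfl
  · have spl : ∀ y a, Nb G v [u, y, a] → y ∈ X → a ∉ X → Dfs G X u v (comp G X v) (fl (comp G X v) rest) := by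
      intro y a hn hy haX
      have ha : G.Adj v a := (hn.2 a).2 (by simp)
      have hc := h.comp_one ha haX (by
        intro z hz hzX; have := (hn.2 z).1 hz; simp at this
        rcases this with rfl | rfl | rfl
        · exact absurd h.hu hzX
        · exact absurd hy hzX
        · exact selfc _ hz hzX)
      have hE := IH a rest (h.child ha haX fun z hz hzc => by
        have := (hn.2 z).1 hz; simp at this
        rcases this with rfl | rfl | rfl
        · exact absurd (mem_insert_of_mem _ h.hu) (comp_notMem hzc)
        · exact absurd (mem_insert_of_mem _ hy) (comp_notMem hzc)
        · rfl)
      rcases h.split hn hy haX with e | e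
      · rw [e, hc]
        exact Dfs.s2 h.hu h.hv hy (hn.perm (List.Perm.cons _ (List.Perm.swap _ _ _))) hE
      · rw [e, hc]
        exact Dfs.s1 h.hu h.hv hy hn hE
    have hsw := hn.perm (List.Perm.cons _ (List.Perm.swap _ _ _) : [u, a, b].Perm [u, b, a])
    have hnd := hn.1
    simp only [List.nodup_cons, List.mem_cons, List.not_mem_nil, or_false, not_or, not_false_eq_true, List.nodup_nil, and_true] at hnd
    by_cases haX : a ∈ X
    · by_cases hbX : b ∈ X
      · have hX : ∀ y, G.Adj v y → y ∈ X := by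
          intro y hy; have := (hn.2 y).1 hy; simp at this
          rcases this with rfl | rfl | rfl
          exacts [h.hu, haX, hbX]
        rw [h.comp_leaf hX]
        have := h.fl_leaf [a, b] (by simp [hnd.2]) (by
          intro y; rw [hn.2 y]; simp only [List.mem_cons, List.not_mem_nil, or_false]
          constructor
          · rintro (rfl | rfl)
            · exact ⟨Or.inr (Or.inl rfl), fun h => hnd.1.1 h.symm, haX⟩
            · exact ⟨Or.inr (Or.inr rfl), fun h => hnd.1.2 h.symm, hbX⟩
          · tauto)
        simp only [List.map_cons, List.map_nil] at this
        have hp : fl {v} rest = [(v, a), (v, b)] ∨ fl {v} rest = [(v, b), (v, a)] := by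
          have hlen := this.length_eq
          match fl {v} rest, this, hlen with
          | [x, y], hp, _ =>
            have hx := (hp.mem_iff (a := x)).1 (by simp)
            have hy := (hp.mem_iff (a := y)).1 (by simp)
            have h1 := (hp.mem_iff (a := (v, a))).2 (by simp)
            have h2 := (hp.mem_iff (a := (v, b))).2 (by simp)
            have hne : (v, a) ≠ (v, b) := by simp [hnd.2]
            simp only [List.mem_cons, List.not_mem_nil, or_false] at hx hy h1 h2
            rcases hx with rfl | rfl
            · rcases hy with rfl | rfl
              · exfalso; rcases h2 with h2 | h2 <;> exact hne h2.symm
              · exact Or.inl rfl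
            · rcases hy with rfl | rfl
              · exact Or.inr rfl
              · exfalso; rcases h1 with h2 | h2 <;> exact hne h2
        rcases hp with e | e
        · rw [e]; exact Dfs.leaf2 h.hu h.hv hbX haX hsw
        · rw [e]; exact Dfs.leaf2 h.hu h.hv haX hbX hn
      · exact spl a b hn haX hbX
    · by_cases hbX : b ∈ X
      · exact spl b a hsw hbX haX
      -- two unexplored neighbours
      have main : ∀ a b, Nb G v [u, a, b] → a ∉ X → b ∉ X → R.o v u b a →
          Dfs G X u v (comp G X v) (fl (comp G X v) rest) := by
        clear hnd hsw hn haX hbX a b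
        intro a b hn haX hbX ho
        have ha : G.Adj v a := (hn.2 a).2 (by simp)
        have hb : G.Adj v b := (hn.2 b).2 (by simp)
        have hv2 : ∀ d ∈ rest, d.2 ≠ v := by
          intro d hd hdv
          obtain ⟨k1, k2, k3⟩ := h.head_v hd hdv
          have := (hn.2 _).1 k1
          simp at this
          rcases this with h' | h' | h'
          · exact k2 h'
          · exact haX (h' ▸ h.tail _ hd)
          · exact hbX (h' ▸ h.tail _ hd)
        by_cases hba : b ∈ comp G (insert v X) a
        · have hc := h.comp_one ha haX (by
            intro z hz hzX; have := (hn.2 z).1 hz; simp at this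
            rcases this with rfl | rfl | rfl
            · exact absurd h.hu hzX
            · exact selfc _ hz hzX
            · exact hba)
          have hE := IH a _ (h.child2 hn haX hbX (R.rot (R.rot ho)))
          rw [fl_cons_mem (by simpa using hba)] at hE
          have hf : fl (comp G X v) rest = fl (comp G (insert v X) a) rest := by
            refine fl_congr fun d hd => ?_
            rw [hc, mem_insert_iff]
            exact or_iff_right (hv2 d hd)
          rw [hf, hc]
          exact Dfs.pop h.hu h.hv hn hE
        · have hab : a ∉ comp G (insert v X) b := fun h' => hba (by
            rw [comp_eq_of_mem h']; exact selfc b hb hbX)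
          have hdis : Disjoint (comp G (insert v X) a) (comp G (insert v X) b) := by
            rw [Set.disjoint_left]
            intro z hz hz'
            apply hba
            rw [← comp_eq_of_mem hz, comp_eq_of_mem hz']
            exact selfc b hb hbX
          have hE1 := IH a rest (h.child ha haX fun z hz hzc => by
            have := (hn.2 z).1 hz; simp at this
            rcases this with rfl | rfl | rfl
            · exact absurd (mem_insert_of_mem _ h.hu) (comp_notMem hzc)
            · rfl
            · exact absurd hzc hba)
          have hE2 := IH b rest (h.child hb hbX fun z hz hzc => by
            have := (hn.2 z).1 hz; simp at this
            rcases this with rfl | rfl | rfl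
            · exact absurd (mem_insert_of_mem _ h.hu) (comp_notMem hzc)
            · exact absurd hzc hab
            · rfl)
          have hc : comp G X v = insert v (comp G (insert v X) a ∪ comp G (insert v X) b) := by
            ext y
            rw [mem_comp_insert h.hv, mem_insert_iff, mem_union]
            refine or_congr Iff.rfl ⟨?_, ?_⟩
            · rintro ⟨x, hx, hxX, hy⟩
              have := (hn.2 x).1 hx; simp at this
              rcases this with rfl | rfl | rfl
              · exact absurd h.hu hxX
              · exact Or.inl hy
              · exact Or.inr hy
            · rintro (hy | hy)
              · exact ⟨a, ha, haX, hy⟩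
              · exact ⟨b, hb, hbX, hy⟩
          have hf : fl (comp G X v) rest = fl (comp G (insert v X) b) rest ++ fl (comp G (insert v X) a) rest := by
            rw [← fl_union hdis]
            · refine fl_congr fun d hd => ?_
              rw [hc, mem_insert_iff]
              exact or_iff_right (hv2 d hd)
            · rw [List.pairwise_iff_forall_sublist]
              rintro w w' hs ⟨hw, hw'⟩
              have hwr : w ∈ rest := hs.subset (by simp)
              have hwr' : w' ∈ rest := hs.subset (by simp)
              obtain ⟨p, hp, hpA⟩ := RIn.path (comp_wconn (insert v X) a a (selfc a ha haX) w.2 hw)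
              obtain ⟨p', hp', hpB⟩ := RIn.path (comp_wconn (insert v X) b b (selfc b hb hbX) w'.2 hw')
              have hvp : v ∉ p.support := fun h' => comp_notMem (hpA v h') (mem_insert _ _)
              have hvp' : v ∉ p'.support := fun h' => comp_notMem (hpB v h') (mem_insert _ _)
              have nX : ∀ z ∈ (SimpleGraph.Walk.cons ha p).support, z ∉ X := by
                intro z hz
                rw [SimpleGraph.Walk.support_cons, List.mem_cons] at hz
                rcases hz with rfl | hz
                · exact h.hv
                · exact fun hzX => comp_notMem (hpA z hz) (mem_insert_of_mem _ hzX)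
              have nX' : ∀ z ∈ (SimpleGraph.Walk.cons hb p').support, z ∉ X := by
                intro z hz
                rw [SimpleGraph.Walk.support_cons, List.mem_cons] at hz
                rcases hz with rfl | hz
                · exact h.hv
                · exact fun hzX => comp_notMem (hpB z hz) (mem_insert_of_mem _ hzX)
              have t := h.tail w hwr
              have t' := h.tail w' hwr'
              have ad := (h.dart w hwr).symm
              have ad' := (h.dart w' hwr').symm
              have := h.inv (u, v) w w' (hs.cons_cons _) v h.hv
                ((SimpleGraph.Walk.nil : G.Walk v v).concat h.adj.symm)
                ((SimpleGraph.Walk.cons ha p).concat ad) ((SimpleGraph.Walk.cons hb p').concat ad')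
                (Hook.mk' (w := (u, v)) _ (by simp) (by simpa using h.hv) h.adj.symm h.hu)
                (Hook.mk' _ ((SimpleGraph.Walk.cons_isPath_iff _ _).2 ⟨hp, hvp⟩) nX ad t)
                (Hook.mk' _ ((SimpleGraph.Walk.cons_isPath_iff _ _).2 ⟨hp', hvp'⟩) nX' ad' t')
                (by
                  intro z hz _
                  rw [SimpleGraph.Walk.support_concat, List.mem_append] at hz
                  rcases hz with hz | hz <;> simp at hz
                  · exact Or.inl hz
                  · exact Or.inr (hz ▸ h.hu))
                (by
                  intro z hz _
                  rw [SimpleGraph.Walk.support_concat, List.mem_append] at hz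
                  rcases hz with hz | hz <;> simp at hz
                  · exact Or.inl hz
                  · exact Or.inr (hz ▸ h.hu))
                (by
                  intro z hz hz'
                  rw [SimpleGraph.Walk.support_concat, List.mem_append, SimpleGraph.Walk.support_cons, List.mem_cons] at hz hz'
                  rcases hz with (hz | hz) | hz
                  · exact Or.inl hz
                  · rcases hz' with (hz' | hz') | hz'
                    · exact Or.inl hz'
                    · exact absurd (hpB z hz') (hdis.notMem_of_mem_left (hpA z hz))
                    · simp at hz'; exact Or.inr (hz' ▸ t')
                  · simp at hz; exact Or.inr (hz ▸ t))
              rw [snd_concat' (SimpleGraph.Walk.cons ha p) _ (by simp), snd_concat' (SimpleGraph.Walk.cons hb p') _ (by simp)] at this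
              simp only [SimpleGraph.Walk.snd_cons] at this
              exact R.asymm ho (by simpa [SimpleGraph.Walk.concat] using this)
          rw [hf, hc]
          exact Dfs.branch h.hu h.hv hn hE1 hE2 hdis
      have ha : G.Adj v a := (hn.2 a).2 (by simp)
      have hb : G.Adj v b := (hn.2 b).2 (by simp)
      rcases R.total h.adj.symm hb ha (fun h => hnd.1.2 h) (fun h => hnd.1.1 h) (fun h => hnd.2 h.symm) with ho | ho
      · exact main a b hn haX hbX ho
      · exact main b a hsw hbX haX ho

end Explore

/-! ### Root certificates -/

section RootCert
open scoped Classical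
variable {V : Type*} {G : SimpleGraph V}

inductive RootC (G : SimpleGraph V) (r : V) : Set V → Prop
  | d0 : Nb G r [] → RootC G r {r}
  | d1 {a S} : Nb G r [a] → Dfs G {r} r a S [] → RootC G r (insert r S)
  | d2 {a b S} : Nb G r [a, b] → Dfs G {r} r a S [(b, r)] → RootC G r (insert r S)
  | d2s {a b S₁ S₂} : Nb G r [a, b] → Dfs G {r} r a S₁ [] → Dfs G {r} r b S₂ [] → Disjoint S₁ S₂ →
      RootC G r (insert r (S₁ ∪ S₂))
  | d3 {a b z S} : Nb G r [a, b, z] → Dfs G {r} r a S [(b, r), (z, r)] → RootC G r (insert r S)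
  | d3s {a b z S₁ S₂} : Nb G r [a, b, z] → Dfs G {r} r a S₁ [(z, r)] → Dfs G {r} r b S₂ [] → Disjoint S₁ S₂ →
      RootC G r (insert r (S₁ ∪ S₂))

theorem rootEx {R : Rot G} {r a : V} {l : List V} (hn : Nb G r (a :: l)) (l' : List V) (hl' : l'.Sublist l)
    (hall : ∀ y ∈ l, y ∈ comp G {r} a → y ∈ l')
    (hI : Inv3 R {r} ((r, a) :: l'.map (fun y => (r, y)))) :
    Ex R {r} r a (l'.map (fun y => (r, y))) where
  conn := by
    rintro x rfl y rfl
    exact RIn.refl rfl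
  hu := rfl
  hv := fun h => ((hn.2 a).2 (by simp)).ne h.symm
  adj := (hn.2 a).2 (by simp)
  nodup := by
    have : ((r, a) :: l'.map (fun y => (r, y))) = (a :: l').map (fun y => (r, y)) := rfl
    rw [this]
    exact (hn.1.sublist (hl'.cons_cons _)).map (fun a b hab => (Prod.mk.inj hab).2)
  tail := by
    intro d hd
    obtain ⟨y, -, rfl⟩ := List.mem_map.1 hd
    rfl
  dart := by
    intro d hd
    obtain ⟨y, hy, rfl⟩ := List.mem_map.1 hd
    exact (hn.2 y).2 (List.mem_cons_of_mem _ (hl'.subset hy))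
  edge := by
    rintro x rfl y hy hxy
    rcases List.mem_cons.1 ((hn.2 y).1 hxy) with rfl | h
    · simp
    · exact List.mem_cons_of_mem _ (List.mem_map.2 ⟨y, hall y h hy, rfl⟩)
  inv := hI

theorem inv3_short {R : Rot G} {X : Set V} {W : List (V × V)} (h : W.length ≤ 2) : Inv3 R X W := by
  intro w1 w2 w3 hs
  have := hs.length_le
  simp at this; omega

theorem inv3_root {R : Rot G} {r a b z : V} (hn : Nb G r [a, b, z]) (ho : R.o r a z b) :
    Inv3 R {r} [(r, a), (r, b), (r, z)] := by
  intro w1 w2 w3 hs c hc q1 q2 q3 h1 h2 h3 d12 d13 d23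
  have := hs.eq_of_length (by simp)
  simp only [List.cons.injEq, and_true] at this
  obtain ⟨rfl, rfl, rfl⟩ := this
  have hnd := hn.1
  simp only [List.nodup_cons, List.mem_cons, List.not_mem_nil, or_false, not_or, not_false_eq_true, List.nodup_nil, and_true] at hnd
  have hcr : c ≠ r := hc
  have n12 := snd_ne (X := {r}) (w := (r, a)) (w' := (r, b)) rfl hc h1 h2 (by simp [hnd.1]) rfl d12
  have n13 := snd_ne (X := {r}) (w := (r, a)) (w' := (r, z)) rfl hc h1 h3 (by simp [hnd.1]) rfl d13
  have n23 := snd_ne (X := {r}) (w := (r, b)) (w' := (r, z)) rfl hc h2 h3 (by simp [hnd.2]) rfl d23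
  refine (R.total (adj_snd' q1 hcr) (adj_snd' q2 hcr) (adj_snd' q3 hcr) n12 n13 n23).resolve_right fun hbad => ?_
  have cv : ∀ {q q' : G.Walk c r}, (∀ z ∈ q.support, z ∈ q'.support → z = c ∨ z ∈ ({r} : Set V)) →
      ∀ z ∈ q.reverse.support, z ∈ q'.reverse.support → z = r ∨ z = c := by
    intro q q' h z hz hz'
    exact (h z (by simpa using hz) (by simpa using hz')).symm
  refine R.theta hcr.symm q1.reverse q3.reverse q2.reverse h1.path.reverse h3.path.reverse h2.path.reverse
    (cv d13) (cv d12) (cv fun z hz hz' => d23 z hz' hz) ?_ ?_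
  · rw [SimpleGraph.Walk.snd_reverse, SimpleGraph.Walk.snd_reverse, SimpleGraph.Walk.snd_reverse, h1.pen, h2.pen, h3.pen]
    exact ho
  · rw [SimpleGraph.Walk.penultimate_reverse, SimpleGraph.Walk.penultimate_reverse, SimpleGraph.Walk.penultimate_reverse]
    exact hbad

theorem root_comp {r y : V} : y ∈ comp G ∅ r ↔ y = r ∨ ∃ a, G.Adj r a ∧ y ∈ comp G {r} a := by
  rw [mem_comp_insert (by simp)]
  simp

variable [Finite V]

theorem root_low (hdeg : ∀ v : V, Nat.card {u // G.Adj v u} ≤ 3) (R : Rot G) {r : V}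
    (h : Nb G r [] ∨ (∃ a, Nb G r [a]) ∨ (∃ a b, Nb G r [a, b])) : RootC G r (comp G ∅ r) := by
  have E : ∀ {a rest}, Ex R {r} r a rest → Dfs G {r} r a (comp G {r} a) (fl (comp G {r} a) rest) :=
    fun h => explore hdeg R _ _ _ _ _ rfl h
  have selfc : ∀ {a}, G.Adj r a → a ∈ comp G {r} a := fun ha => self_mem_comp (fun h => ha.ne h.symm)
  rcases h with hn | ⟨a, hn⟩ | ⟨a, b, hn⟩
  · have : comp G ∅ r = {r} := by
      ext y
      rw [root_comp]
      simp only [mem_singleton_iff, or_iff_left_iff_imp]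
      rintro ⟨a, ha, -⟩
      have := (hn.2 a).1 ha
      simp at this
    rw [this]; exact RootC.d0 hn
  · have : comp G ∅ r = insert r (comp G {r} a) := by
      ext y
      rw [root_comp, mem_insert_iff]
      simp [hn.2]
    rw [this]
    exact RootC.d1 hn (E (rootEx hn [] (by simp) (by simp) (inv3_short (by simp))))
  · have ha : G.Adj r a := (hn.2 a).2 (by simp)
    have hb : G.Adj r b := (hn.2 b).2 (by simp)
    by_cases hba : b ∈ comp G {r} a
    · have : comp G ∅ r = insert r (comp G {r} a) := by
        ext y
        rw [root_comp, mem_insert_iff]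
        simp [hn.2, comp_eq_of_mem hba]
      rw [this]
      have := E (rootEx hn [b] (by simp) (by simp) (inv3_short (by simp)))
      refine RootC.d2 hn ?_
      simpa [fl, hba] using this
    · have : comp G ∅ r = insert r (comp G {r} a ∪ comp G {r} b) := by
        ext y
        rw [root_comp, mem_insert_iff]
        simp [hn.2]
      rw [this]
      have hba' : a ∉ comp G {r} b := fun h => hba (by rw [comp_eq_of_mem h]; exact selfc hb)
      have hn' := hn.perm (List.Perm.swap b a [])
      refine RootC.d2s hn (E (rootEx hn [] (by simp) (by simpa using hba) (inv3_short (by simp))))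
        (E (rootEx hn' [] (by simp) (by simpa using hba') (inv3_short (by simp)))) ?_
      rw [Set.disjoint_left]
      intro y hy hy'
      apply hba
      rw [← comp_eq_of_mem hy, comp_eq_of_mem hy']
      exact selfc hb

theorem root_cubic (hdeg : ∀ v : V, Nat.card {u // G.Adj v u} ≤ 3) (R : Rot G) {r z : V} (hz : G.Adj r z)
    (h3 : ∃ a b, Nb G r [a, b, z]) (hnb : ∃ a, G.Adj r a ∧ a ≠ z ∧ z ∈ comp G {r} a) : RootC G r (comp G ∅ r) := by
  have E : ∀ {a rest}, Ex R {r} r a rest → Dfs G {r} r a (comp G {r} a) (fl (comp G {r} a) rest) :=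
    fun h => explore hdeg R _ _ _ _ _ rfl h
  have selfc : ∀ {a}, G.Adj r a → a ∈ comp G {r} a := fun ha => self_mem_comp (fun h => ha.ne h.symm)
  obtain ⟨a, b, hn, hza⟩ : ∃ a b, Nb G r [a, b, z] ∧ z ∈ comp G {r} a := by
    obtain ⟨a, b, hn⟩ := h3
    obtain ⟨x, hx, hxz, hzx⟩ := hnb
    have := (hn.2 x).1 hx
    simp at this
    rcases this with rfl | rfl | rfl
    · exact ⟨_, _, hn, hzx⟩
    · exact ⟨_, _, hn.perm (List.Perm.swap _ _ _), hzx⟩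
    · exact absurd rfl hxz
  have ha : G.Adj r a := (hn.2 a).2 (by simp)
  have hb : G.Adj r b := (hn.2 b).2 (by simp)
  have hnd := hn.1
  simp only [List.nodup_cons, List.mem_cons, List.not_mem_nil, or_false, not_or, not_false_eq_true, List.nodup_nil, and_true] at hnd
  by_cases hba : b ∈ comp G {r} a
  · have main : ∀ a b, Nb G r [a, b, z] → b ∈ comp G {r} a → z ∈ comp G {r} a → R.o r a z b → RootC G r (comp G ∅ r) := by
      intro a b hn hba hza ho
      have : comp G ∅ r = insert r (comp G {r} a) := by
        ext y
        rw [root_comp, mem_insert_iff]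
        simp [hn.2, comp_eq_of_mem hba, comp_eq_of_mem hza]
      rw [this]
      have := E (rootEx hn [b, z] (by simp) (by simp) (inv3_root hn ho))
      refine RootC.d3 hn ?_
      simpa [fl, hba, hza] using this
    rcases R.total ha hz hb hnd.1.2 hnd.1.1 (fun h => hnd.2 h.symm) with ho | ho
    · exact main a b hn hba hza ho
    · have e := comp_eq_of_mem hba
      refine main b a (hn.perm (List.Perm.swap _ _ _)) ?_ ?_ (R.rot ho |> R.rot |> fun h => R.rot (R.rot h))
      · rw [e]; exact selfc ha
      · rw [e]; exact hza
  · have : comp G ∅ r = insert r (comp G {r} a ∪ comp G {r} b) := by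
      ext y
      rw [root_comp, mem_insert_iff]
      simp only [hn.2, List.mem_cons, List.not_mem_nil, or_false, exists_eq_or_imp, exists_eq_left, comp_eq_of_mem hza, mem_union]
      tauto
    rw [this]
    have hd : Disjoint (comp G {r} a) (comp G {r} b) := by
      rw [Set.disjoint_left]
      intro y hy hy'
      apply hba
      rw [← comp_eq_of_mem hy, comp_eq_of_mem hy']
      exact selfc hb
    refine RootC.d3s (z := z) hn ?_ ?_ hd
    · have := E (rootEx hn [z] (by simp) (by simp [hba]) (inv3_short (by simp)))
      simpa [fl, hza] using this
    · have hn' : Nb G r [b, a, z] := hn.perm (List.Perm.swap _ _ _)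
      refine E (rootEx hn' [] (by simp) ?_ (inv3_short (by simp)))
      intro y hy hyb
      exfalso
      simp at hy
      rcases hy with rfl | rfl
      · exact hd.notMem_of_mem_left (selfc ha) hyb
      · exact hd.notMem_of_mem_left hza hyb

theorem exists_nonbridge (C : Set V) (hC : ∀ x ∈ C, ∀ y, G.Adj x y → y ∈ C) (hne : C.Nonempty)
    (h2 : ∀ x ∈ C, ∀ y, ∃ a, G.Adj x a ∧ a ≠ y) :
    ∃ r ∈ C, ∃ z, G.Adj r z ∧ ∃ a, G.Adj r a ∧ a ≠ z ∧ z ∈ comp G {r} a := by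
  by_contra hcon
  push Not at hcon
  have key : ∀ n, ∀ r ∈ C, ∀ z, G.Adj r z → (comp G {r} z).ncard ≤ n → False := by
    intro n
    induction n with
    | zero =>
      intro r hr z hz hn
      have : (comp G {r} z) = ∅ := (Set.ncard_eq_zero (Set.toFinite _)).1 (by omega)
      exact Set.notMem_empty z (this ▸ self_mem_comp (fun h => hz.ne h.symm))
    | succ n ih =>
      intro r hr z hz hn
      have hzC := hC r hr z hz
      obtain ⟨z1, hz1, hz1r⟩ := h2 z hzC r
      refine ih z hzC z1 hz1 ?_
      have hrn : r ∉ comp G {z} z1 := hcon z hzC r hz.symm z1 hz1 hz1r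
      have hsub : comp G {z} z1 ⊆ comp G {r} z := by
        intro y hy
        obtain ⟨p, hp⟩ := comp_wconn {z} z1 z1 (self_mem_comp (G := G) (fun h => hz1.ne h.symm)) y hy
        refine RIn.trans (RIn.step hz1 (fun h => hz.ne h.symm) hz1r) ⟨p, fun w hw h => ?_⟩
        exact hrn (h ▸ hp w hw)
      have hlt := Set.ncard_lt_ncard ⟨hsub, fun h => comp_notMem (h (self_mem_comp (G := G) (fun h => hz.ne h.symm))) rfl⟩ (Set.toFinite _)
      omega
  obtain ⟨x, hx⟩ := hne
  obtain ⟨a, ha, -⟩ := h2 x hx x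
  exact key _ x hx a ha le_rfl

theorem root_exists (hdeg : ∀ v : V, Nat.card {u // G.Adj v u} ≤ 3) (R : Rot G) (x : V) :
    ∃ r, RootC G r (comp G ∅ x) ∧ ((∃ l, Nb G r l ∧ l.length ≤ 2) ∨
      ∀ y ∈ comp G ∅ x, ∀ a b, ¬ Nb G y [a, b]) := by
  by_cases h : ∃ r ∈ comp G ∅ x, Nb G r [] ∨ (∃ a, Nb G r [a]) ∨ (∃ a b, Nb G r [a, b])
  · obtain ⟨r, hr, h⟩ := h
    refine ⟨r, comp_eq_of_mem hr ▸ root_low hdeg R h, Or.inl ?_⟩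
    rcases h with h | ⟨a, h⟩ | ⟨a, b, h⟩
    · exact ⟨_, h, by simp⟩
    · exact ⟨_, h, by simp⟩
    · exact ⟨_, h, by simp⟩
  · push Not at h
    obtain ⟨r, hr, z, hz, hnb⟩ := exists_nonbridge (G := G) (comp G ∅ x) (fun y hy w hyw => comp_closed hy hyw (by simp))
      ⟨x, self_mem_comp (by simp)⟩ (by
        intro y hy w
        rcases exists_nb (hdeg y) with k | ⟨a, k⟩ | ⟨a, b, k⟩ | ⟨a, b, c, k⟩
        · exact absurd k (h y hy).1
        · exact absurd k ((h y hy).2.1 a)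
        · exact absurd k ((h y hy).2.2 a b)
        · by_cases haw : a = w
          · refine ⟨b, (k.2 b).2 (by simp), ?_⟩
            rintro rfl
            have := k.1
            simp [haw] at this
          · exact ⟨a, (k.2 a).2 (by simp), haw⟩)
    refine ⟨r, comp_eq_of_mem hr ▸ root_cubic hdeg R hz ?_ hnb, Or.inr fun y hy => (h y hy).2.2⟩
    rcases exists_nb_of_adj (hdeg r) hz with k | ⟨a, k⟩ | ⟨a, b, k⟩
    · exact absurd k ((h r hr).2.1 z)
    · exact absurd k ((h r hr).2.2 z a)
    · exact ⟨a, b, k.perm (List.perm_append_comm (l₁ := [z]) (l₂ := [a, b]))⟩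

end RootCert

section DfsFacts
variable {V : Type*} {G : SimpleGraph V}

structure DfsFacts (G : SimpleGraph V) (X : Set V) (u v : V) (S : Set V) (L : List (V × V)) : Prop where
  hu : u ∈ X
  hv : v ∉ X
  adj : G.Adj v u
  hvS : v ∈ S
  disj : Disjoint S X
  dart : ∀ d ∈ L, d.1 ∈ S ∧ d.2 ∈ X ∧ G.Adj d.1 d.2
  root : (v, u) ∉ L
  nodup : L.Nodup

theorem DfsFacts.vS {X : Set V} {v a : V} {S : Set V} {L : List (V × V)} (h : DfsFacts G (insert v X) v a S L) : v ∉ S :=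
  fun hv => h.disj.notMem_of_mem_left hv (mem_insert _ _)

theorem DfsFacts.XS {X : Set V} {v a x : V} {S : Set V} {L : List (V × V)} (h : DfsFacts G (insert v X) v a S L) (hx : x ∈ X) : x ∉ S :=
  fun hv => h.disj.notMem_of_mem_left hv (mem_insert_of_mem _ hx)

theorem DfsFacts.disj' {X : Set V} {v a : V} {S : Set V} {L : List (V × V)} (h : DfsFacts G (insert v X) v a S L) (hv : v ∉ X) :
    Disjoint (insert v S) X := by
  rw [disjoint_insert_left]; exact ⟨hv, h.disj.mono_right (subset_insert _ _)⟩

/-- a strand of a child ends at `v` only if it starts in a second child -/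
theorem DfsFacts.ne {X : Set V} {v a : V} {S : Set V} {L : List (V × V)} (h : DfsFacts G (insert v X) v a S L) 
    {d : V × V} (hd : d ∈ L) (hda : d.2 = v → d.1 = a) : d.2 ∈ X := by
  refine (h.dart d hd).2.1.resolve_left fun hdv => h.root ?_
  rw [← hdv, ← hda hdv]
  exact hd

theorem Dfs.facts {X : Set V} {u v : V} {S : Set V} {L : List (V × V)} (h : Dfs G X u v S L) : DfsFacts G X u v S L := by
  induction h with
  | leaf0 hu hv hn =>
    exact ⟨hu, hv, (hn.2 _).2 (by simp), rfl, by simpa using hv, by simp, by simp, by simp⟩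
  | leaf1 hu hv hy hn =>
    have hnd := hn.1
    refine ⟨hu, hv, (hn.2 _).2 (by simp), rfl, by simpa using hv, ?_, by simp at hnd ⊢; exact hnd, by simp⟩
    simp only [List.mem_singleton, forall_eq]
    exact ⟨rfl, hy, (hn.2 _).2 (by simp)⟩
  | leaf2 hu hv hy hy' hn =>
    have hnd := hn.1
    refine ⟨hu, hv, (hn.2 _).2 (by simp), rfl, by simpa using hv, ?_, by simp at hnd ⊢; tauto, by simp at hnd ⊢; exact fun h => hnd.2 h.symm⟩
    simp only [List.mem_cons, List.not_mem_nil, or_false, forall_eq_or_imp, forall_eq]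
    exact ⟨⟨rfl, hy', (hn.2 _).2 (by simp)⟩, rfl, hy, (hn.2 _).2 (by simp)⟩
  | @pass X u v a S L hu hv hn hd ih =>
    refine ⟨hu, hv, (hn.2 _).2 (by simp), mem_insert _ _, ih.disj' hv, ?_, fun h => ih.vS (ih.dart _ h).1, ih.nodup⟩
    intro d hd
    refine ⟨mem_insert_of_mem _ (ih.dart d hd).1, ih.ne hd fun h => ?_, (ih.dart d hd).2.2⟩
    have := (hn.2 d.1).1 (h ▸ (ih.dart d hd).2.2.symm)
    simp at this
    exact this.resolve_left fun h' => ih.XS hu (h' ▸ (ih.dart d hd).1)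
  | @s1 X u v y a S L hu hv hy hn hd ih =>
    have hnd := hn.1
    have hD : ∀ d ∈ L, d.1 ∈ insert v S ∧ d.2 ∈ X ∧ G.Adj d.1 d.2 := by
      intro d hd
      refine ⟨mem_insert_of_mem _ (ih.dart d hd).1, ih.ne hd fun h => ?_, (ih.dart d hd).2.2⟩
      have := (hn.2 d.1).1 (h ▸ (ih.dart d hd).2.2.symm)
      simp at this
      exact (this.resolve_left fun h' => ih.XS hu (h' ▸ (ih.dart d hd).1)).resolve_left fun h' => ih.XS hy (h' ▸ (ih.dart d hd).1)
    refine ⟨hu, hv, (hn.2 _).2 (by simp), mem_insert _ _, ih.disj' hv, ?_, ?_, ?_⟩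
    · intro d hd
      rcases List.mem_append.1 hd with hd | hd
      · exact hD d hd
      · simp at hd; subst hd
        exact ⟨mem_insert _ _, hy, (hn.2 _).2 (by simp)⟩
    · intro h
      rcases List.mem_append.1 h with hd | hd
      · exact ih.vS (ih.dart _ hd).1
      · simp at hd hnd; tauto
    · rw [List.nodup_append]
      refine ⟨ih.nodup, by simp, ?_⟩
      rintro d hd d' hd' rfl
      simp at hd'
      exact ih.vS (by simpa [hd'] using (ih.dart _ hd).1)
  | @s2 X u v y a S L hu hv hy hn hd ih =>
    have hnd := hn.1
    have hD : ∀ d ∈ L, d.1 ∈ insert v S ∧ d.2 ∈ X ∧ G.Adj d.1 d.2 := by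
      intro d hd
      refine ⟨mem_insert_of_mem _ (ih.dart d hd).1, ih.ne hd fun h => ?_, (ih.dart d hd).2.2⟩
      have := (hn.2 d.1).1 (h ▸ (ih.dart d hd).2.2.symm)
      simp at this
      exact (this.resolve_left fun h' => ih.XS hu (h' ▸ (ih.dart d hd).1)).resolve_right fun h' => ih.XS hy (h' ▸ (ih.dart d hd).1)
    refine ⟨hu, hv, (hn.2 _).2 (by simp), mem_insert _ _, ih.disj' hv, ?_, ?_, ?_⟩
    · intro d hd
      rcases List.mem_cons.1 hd with hd | hd
      · subst hd
        exact ⟨mem_insert _ _, hy, (hn.2 _).2 (by simp)⟩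
      · exact hD d hd
    · intro h
      rcases List.mem_cons.1 h with hd | hd
      · simp at hd hnd; tauto
      · exact ih.vS (ih.dart _ hd).1
    · rw [List.nodup_cons]
      exact ⟨fun h => ih.vS (ih.dart _ h).1, ih.nodup⟩
  | @pop X u v a b S L hu hv hn hd ih =>
    have hnd := List.nodup_cons.1 ih.nodup
    refine ⟨hu, hv, (hn.2 _).2 (by simp), mem_insert _ _, ih.disj' hv, ?_, fun h => ih.vS (ih.dart _ (List.mem_cons_of_mem _ h)).1, hnd.2⟩
    intro d hd
    have hd' := List.mem_cons_of_mem (b, v) hd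
    refine ⟨mem_insert_of_mem _ (ih.dart d hd').1, ih.ne hd' fun h => ?_, (ih.dart d hd').2.2⟩
    have := (hn.2 d.1).1 (h ▸ (ih.dart d hd').2.2.symm)
    simp at this
    refine (this.resolve_left fun h' => ih.XS hu (h' ▸ (ih.dart d hd').1)).resolve_right fun h' => hnd.1 ?_
    rw [← h, ← h']; exact hd
  | @branch X u v a b S₁ L₁ S₂ L₂ hu hv hn hd1 hd2 hdis ih1 ih2 =>
    refine ⟨hu, hv, (hn.2 _).2 (by simp), mem_insert _ _, ?_, ?_, ?_, ?_⟩
    · rw [disjoint_insert_left, disjoint_union_left]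
      exact ⟨hv, ih1.disj.mono_right (subset_insert _ _), ih2.disj.mono_right (subset_insert _ _)⟩
    · intro d hd
      rcases List.mem_append.1 hd with hd | hd
      · refine ⟨mem_insert_of_mem _ (Or.inr (ih2.dart d hd).1), ih2.ne hd fun h => ?_, (ih2.dart d hd).2.2⟩
        have := (hn.2 d.1).1 (h ▸ (ih2.dart d hd).2.2.symm)
        simp at this
        exact (this.resolve_left fun h' => ih2.XS hu (h' ▸ (ih2.dart d hd).1)).resolve_left fun h' =>
          hdis.notMem_of_mem_left (h' ▸ ih1.hvS) (ih2.dart d hd).1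
      · refine ⟨mem_insert_of_mem _ (Or.inl (ih1.dart d hd).1), ih1.ne hd fun h => ?_, (ih1.dart d hd).2.2⟩
        have := (hn.2 d.1).1 (h ▸ (ih1.dart d hd).2.2.symm)
        simp at this
        exact (this.resolve_left fun h' => ih1.XS hu (h' ▸ (ih1.dart d hd).1)).resolve_right fun h' =>
          hdis.notMem_of_mem_left (ih1.dart d hd).1 (h' ▸ ih2.hvS)
    · intro h
      rcases List.mem_append.1 h with hd | hd
      · exact ih2.vS (ih2.dart _ hd).1
      · exact ih1.vS (ih1.dart _ hd).1
    · rw [List.nodup_append]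
      refine ⟨ih2.nodup, ih1.nodup, ?_⟩
      rintro d hd d' hd' rfl
      exact hdis.notMem_of_mem_left (ih1.dart d hd').1 (ih2.dart d hd).1

end DfsFacts

/-! ## Edge curves -/

/-- An edge curve from `a` to `b` with image `S`, leaving `a` in direction `α` and leaving `b`
(backwards) in direction `β`. -/
def EC (a b : ℂ) (α β : ℝ) (S : Set ℂ) : Prop :=
  ∃ γ γ' : ℝ → ℂ, (∃ s : ℝ, 0 < s ∧ s < 1 ∧ IsArcOn γ 0 s ∧ IsArcOn γ s 1) ∧
    (∀ t, HasDerivAt γ (γ' t) t) ∧ Continuous γ' ∧ (∀ t, γ' t ≠ 0) ∧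
    InjOn γ (Icc 0 1) ∧ γ '' Icc 0 1 = S ∧ γ 0 = a ∧ γ 1 = b ∧
    (∃ r : ℝ, 0 < r ∧ γ' 0 = r * Complex.exp (Complex.I * α)) ∧
    (∃ r : ℝ, 0 < r ∧ γ' 1 = -(r * Complex.exp (Complex.I * β)))

lemma IsArcOn.rev {γ : ℝ → ℂ} {s t : ℝ} (h : IsArcOn γ s t) :
    IsArcOn (fun x => γ (1 - x)) (1 - t) (1 - s) := by
  obtain ⟨P, hP, h⟩ := h
  cases P with
  | arc c r θ₀ θ₁ =>
    refine ⟨Piece.arc c r θ₁ θ₀, ⟨hP.1, hP.2.symm⟩, fun u hu => ?_⟩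
    have := h (1 - u) ⟨by linarith [hu.2], by linarith [hu.1]⟩
    have e : (1 - (1 - t + u * (1 - s - (1 - t)))) = s + (1 - u) * (t - s) := by ring
    simp only [e, this, Piece.toFun]
    congr 4
    push_cast; ring
  | seg p q =>
    refine ⟨Piece.seg q p, Ne.symm hP, fun u hu => ?_⟩
    have := h (1 - u) ⟨by linarith [hu.2], by linarith [hu.1]⟩
    have e : (1 - (1 - t + u * (1 - s - (1 - t)))) = s + (1 - u) * (t - s) := by ring
    simp only [e, this, Piece.toFun]
    push_cast; ring

lemma IsArcOn.aff {γ : ℝ → ℂ} {s t : ℝ} (h : IsArcOn γ s t) {l : ℝ} (hl : 0 < l) (w : ℂ) :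
    IsArcOn (fun x => l * γ x + w) s t := by
  obtain ⟨P, hP, h⟩ := h
  cases P with
  | arc c r θ₀ θ₁ =>
    refine ⟨Piece.arc (l * c + w) (l * r) θ₀ θ₁, ⟨mul_ne_zero hl.ne' hP.1, hP.2⟩, fun u hu => ?_⟩
    simp only [h u hu, Piece.toFun]
    push_cast; ring
  | seg p q =>
    have hl' : (l : ℂ) ≠ 0 := by exact_mod_cast hl.ne'
    refine ⟨Piece.seg (l * p + w) (l * q + w), ?_, fun u hu => ?_⟩
    · intro h
      apply hP
      have : (l : ℂ) * p = l * q := by linear_combination h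
      exact mul_left_cancel₀ hl' this
    · simp only [h u hu, Piece.toFun]
      ring

lemma EC.symm {a b : ℂ} {α β : ℝ} {S : Set ℂ} (h : EC a b α β S) : EC b a β α S := by
  obtain ⟨γ, γ', ⟨s, hs0, hs1, h1, h2⟩, hd, hc, hn, hi, him, h0, h1', ⟨r, hr, hr'⟩, ⟨q, hq, hq'⟩⟩ := h
  refine ⟨fun t => γ (1 - t), fun t => - γ' (1 - t), ⟨1 - s, by linarith, by linarith, ?_, ?_⟩,
    ?_, ?_, ?_, ?_, ?_, ?_, ?_, ⟨q, hq, ?_⟩, ⟨r, hr, ?_⟩⟩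
  · simpa using h2.rev
  · simpa using h1.rev
  · intro t
    have := (hd (1 - t)).scomp t ((hasDerivAt_id t).const_sub 1)
    simpa [Function.comp_def] using this
  · fun_prop
  · intro t; simpa using hn (1 - t)
  · intro x hx y hy hxy
    have := hi (x₁ := 1 - x) (x₂ := 1 - y) ⟨by linarith [hx.2], by linarith [hx.1]⟩
      ⟨by linarith [hy.2], by linarith [hy.1]⟩ hxy
    linarith
  · rw [← him]
    ext z
    constructor
    · rintro ⟨t, ht, rfl⟩
      exact ⟨1 - t, ⟨by linarith [ht.2], by linarith [ht.1]⟩, rfl⟩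
    · rintro ⟨t, ht, rfl⟩
      exact ⟨1 - t, ⟨by linarith [ht.2], by linarith [ht.1]⟩, by simp⟩
  · simpa using h1'
  · simpa using h0
  · simp [hq']
  · simp [hr']

lemma EC.aff {a b : ℂ} {α β : ℝ} {S : Set ℂ} (h : EC a b α β S) {l : ℝ} (hl : 0 < l) (w : ℂ) :
    EC (l * a + w) (l * b + w) α β ((fun z => (l : ℂ) * z + w) '' S) := by
  obtain ⟨γ, γ', ⟨s, hs0, hs1, h1, h2⟩, hd, hc, hn, hi, him, h0, h1', ⟨r, hr, hr'⟩, ⟨q, hq, hq'⟩⟩ := h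
  have hl' : (l : ℂ) ≠ 0 := by exact_mod_cast hl.ne'
  refine ⟨fun t => l * γ t + w, fun t => l * γ' t, ⟨s, hs0, hs1, h1.aff hl w, h2.aff hl w⟩,
    ?_, ?_, ?_, ?_, ?_, ?_, ?_, ⟨l * r, by positivity, ?_⟩, ⟨l * q, by positivity, ?_⟩⟩
  · intro t
    exact ((hd t).const_mul _).add_const _
  · fun_prop
  · intro t; exact mul_ne_zero hl' (hn t)
  · intro x hx y hy hxy
    apply hi hx hy
    have : (l : ℂ) * γ x = l * γ y := by
      have : (l : ℂ) * γ x + w = l * γ y + w := hxy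
      linear_combination this
    exact mul_left_cancel₀ hl' this
  · rw [← him, image_image]
  · simp [h0]
  · simp [h1']
  · simp [hr']; ring
  · simp [hq']; ring

lemma exp_add_two_pi (α : ℝ) : Complex.exp (Complex.I * ((α + 2 * Real.pi : ℝ) : ℂ)) =
    Complex.exp (Complex.I * α) := by
  have : Complex.I * ((α + 2 * Real.pi : ℝ) : ℂ) = Complex.I * α + 2 * Real.pi * Complex.I := by
    push_cast; ring
  rw [this, Complex.exp_add, Complex.exp_two_pi_mul_I, mul_one]

lemma EC.turnR {a b : ℂ} {α β β' : ℝ} {S : Set ℂ} (h : EC a b α β S) (hb : β = β' + 2 * Real.pi) :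
    EC a b α β' S := by
  obtain ⟨γ, γ', h1, hd, hc, hn, hi, him, h0, h1', hr, ⟨q, hq, hq'⟩⟩ := h
  refine ⟨γ, γ', h1, hd, hc, hn, hi, him, h0, h1', hr, ⟨q, hq, ?_⟩⟩
  rw [hq', hb, exp_add_two_pi]

lemma EC.turnL {a b : ℂ} {α α' β : ℝ} {S : Set ℂ} (h : EC a b α β S) (hb : α = α' + 2 * Real.pi) :
    EC a b α' β S := (h.symm.turnR hb).symm

lemma EC.left_mem {a b : ℂ} {α β : ℝ} {S : Set ℂ} (h : EC a b α β S) : a ∈ S := by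
  obtain ⟨γ, γ', h1, hd, hc, hn, hi, him, h0, h1', hr, hq⟩ := h
  rw [← him, ← h0]; exact ⟨0, by simp, rfl⟩

lemma EC.right_mem {a b : ℂ} {α β : ℝ} {S : Set ℂ} (h : EC a b α β S) : b ∈ S := h.symm.left_mem

/-- Bounded sets. -/
def Bdd (S : Set ℂ) : Prop := ∃ M : ℝ, ∀ z ∈ S, |z.re| ≤ M ∧ |z.im| ≤ M

lemma Bdd.union {S T : Set ℂ} (h : Bdd S) (h' : Bdd T) : Bdd (S ∪ T) := by
  obtain ⟨M, hM⟩ := h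
  obtain ⟨N, hN⟩ := h'
  refine ⟨max M N, ?_⟩
  rintro z (hz | hz)
  · exact ⟨(hM z hz).1.trans (le_max_left _ _), (hM z hz).2.trans (le_max_left _ _)⟩
  · exact ⟨(hN z hz).1.trans (le_max_right _ _), (hN z hz).2.trans (le_max_right _ _)⟩

lemma Bdd.mono {S T : Set ℂ} (h : Bdd S) (h' : T ⊆ S) : Bdd T := by
  obtain ⟨M, hM⟩ := h
  exact ⟨M, fun z hz => hM z (h' hz)⟩

lemma Bdd.single (a : ℂ) : Bdd {a} :=
  ⟨max |a.re| |a.im|, by rintro z rfl; exact ⟨le_max_left _ _, le_max_right _ _⟩⟩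

lemma EC.bdd {a b : ℂ} {α β : ℝ} {S : Set ℂ} (h : EC a b α β S) : Bdd S := by
  obtain ⟨γ, γ', h1, hd, hc, hn, hi, him, h0, h1', hr, hq⟩ := h
  have hcont : Continuous γ := continuous_iff_continuousAt.2 fun t => (hd t).continuousAt
  have : IsCompact S := by rw [← him]; exact isCompact_Icc.image hcont
  obtain ⟨M, hM⟩ := this.isBounded.exists_norm_le
  exact ⟨M, fun z hz => ⟨(Complex.abs_re_le_norm z).trans (hM z hz),
    (Complex.abs_im_le_norm z).trans (hM z hz)⟩⟩

/-! ### The basic curve: straight, then clockwise arc -/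

/-- unit-speed model curve: straight for `x ≤ 0`, clockwise arc of radius `R` afterwards. -/
noncomputable def bas (R x : ℝ) : ℂ :=
  if x ≤ 0 then (x : ℂ) else ⟨R * Real.sin (x / R), R * (Real.cos (x / R) - 1)⟩

noncomputable def bas' (R x : ℝ) : ℂ := ⟨Real.cos (max x 0 / R), - Real.sin (max x 0 / R)⟩

lemma hasDerivAt_mk {f g : ℝ → ℝ} {f' g' x : ℝ} (hf : HasDerivAt f f' x) (hg : HasDerivAt g g' x) :
    HasDerivAt (fun x => (⟨f x, g x⟩ : ℂ)) ⟨f', g'⟩ x := by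
  have h := (hf.ofReal_comp).add ((hg.ofReal_comp).mul_const Complex.I)
  have e : (fun x => (⟨f x, g x⟩ : ℂ)) = fun x => (f x : ℂ) + (g x : ℂ) * Complex.I := by
    funext x; exact Complex.mk_eq_add_mul_I _ _
  rw [e, Complex.mk_eq_add_mul_I]
  exact h

lemma bas_hasDerivAt {R : ℝ} (hR : 0 < R) (x : ℝ) : HasDerivAt (bas R) (bas' R x) x := by
  have h1 : ∀ x : ℝ, HasDerivAt (fun x : ℝ => (x : ℂ)) 1 x := fun x => by
    simpa using (hasDerivAt_id x).ofReal_comp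
  have h2 : ∀ x : ℝ, HasDerivAt (fun x : ℝ => (⟨R * Real.sin (x / R), R * (Real.cos (x / R) - 1)⟩ : ℂ))
      ⟨Real.cos (x / R), - Real.sin (x / R)⟩ x := fun x => by
    have hd : HasDerivAt (fun x : ℝ => x / R) (1 / R) x := (hasDerivAt_id x).div_const R
    refine hasDerivAt_mk ?_ ?_
    · have h := (hd.sin).const_mul R
      have e : R * (Real.cos (x / R) * (1 / R)) = Real.cos (x / R) := by field_simp
      rwa [e] at h
    · have h := ((hd.cos).sub_const 1).const_mul R
      have e : R * (-Real.sin (x / R) * (1 / R)) = -Real.sin (x / R) := by field_simp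
      rwa [e] at h
  rcases lt_trichotomy x 0 with hx | hx | hx
  · have e : bas' R x = 1 := by
      simp [bas', max_eq_right hx.le, Complex.ext_iff]
    rw [e]
    refine (h1 x).congr_of_eventuallyEq ?_
    filter_upwards [Iio_mem_nhds hx] with y hy
    simp [bas, le_of_lt (show y < 0 from hy)]
  · subst hx
    have e : bas' R 0 = 1 := by simp [bas', Complex.ext_iff]
    have e2 : (⟨Real.cos (0 / R), - Real.sin (0 / R)⟩ : ℂ) = 1 := by simp [Complex.ext_iff]
    rw [e]
    have hl : HasDerivWithinAt (bas R) 1 (Iic 0) 0 :=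
      ((h1 0).hasDerivWithinAt).congr (fun y hy => by simp [bas, show y ≤ 0 from hy]) (by simp [bas])
    have hr : HasDerivWithinAt (bas R) 1 (Ici 0) 0 := by
      refine ((e2 ▸ h2 0).hasDerivWithinAt).congr (fun y hy => ?_) (by simp [bas, Complex.ext_iff])
      rcases (show (0 : ℝ) ≤ y from hy).eq_or_lt with rfl | h
      · simp [bas, Complex.ext_iff]
      · simp [bas, not_le.2 h]
    have := hl.union hr
    rwa [Iic_union_Ici, hasDerivWithinAt_univ] at this
  · have e : bas' R x = ⟨Real.cos (x / R), - Real.sin (x / R)⟩ := by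
      simp [bas', max_eq_left hx.le]
    rw [e]
    refine (h2 x).congr_of_eventuallyEq ?_
    filter_upwards [Ioi_mem_nhds hx] with y hy
    simp [bas, not_le.2 (show 0 < y from hy)]

lemma bas'_cont (R : ℝ) : Continuous (bas' R) := by
  have e : bas' R = fun x => ((Real.cos (max x 0 / R) : ℝ) : ℂ) +
      ((- Real.sin (max x 0 / R) : ℝ) : ℂ) * Complex.I := by
    funext x; exact Complex.mk_eq_add_mul_I _ _
  rw [e]
  fun_prop

lemma bas'_ne (R x : ℝ) : bas' R x ≠ 0 := by
  intro h
  have h1 := congrArg Complex.re h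
  have h2 := congrArg Complex.im h
  simp only [bas', Complex.zero_re, Complex.zero_im] at h1 h2
  have := Real.sin_sq_add_cos_sq (max x 0 / R)
  nlinarith

lemma bas_injOn {R τ : ℝ} (hR : 0 < R) (hτ : τ < 2 * Real.pi) :
    InjOn (bas R) (Iic (R * τ)) := by
  have key : ∀ x, 0 < x → x ≤ R * τ → Real.cos (x / R) < 1 := by
    intro x hx hx'
    have h0 : 0 < x / R := by positivity
    have h1 : x / R < 2 * Real.pi := by
      rw [div_lt_iff₀ hR]; nlinarith
    refine lt_of_le_of_ne (Real.cos_le_one _) fun h => ?_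
    have := (Real.cos_eq_one_iff_of_lt_of_lt (by linarith [Real.pi_pos]) h1).1 h
    linarith
  intro x hx y hy hxy
  simp only [mem_Iic] at hx hy
  by_cases h1 : x ≤ 0 <;> by_cases h2 : y ≤ 0
  · simpa [bas, h1, h2] using hxy
  · exfalso
    simp only [bas, h1, h2, if_true, if_false] at hxy
    have := congrArg Complex.im hxy
    simp only [Complex.ofReal_im] at this
    have := key y (not_le.1 h2) hy
    nlinarith
  · exfalso
    simp only [bas, h1, h2, if_true, if_false] at hxy
    have := congrArg Complex.im hxy
    simp only [Complex.ofReal_im] at this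
    have := key x (not_le.1 h1) hx
    nlinarith
  · simp only [bas, h1, h2, if_false] at hxy
    have e1 := congrArg Complex.re hxy
    have e2 := congrArg Complex.im hxy
    simp only at e1 e2
    have s : Real.sin (x / R) = Real.sin (y / R) := mul_left_cancel₀ hR.ne' e1
    have c : Real.cos (x / R) = Real.cos (y / R) := by
      have := mul_left_cancel₀ hR.ne' e2; linarith
    push Not at h1 h2
    have hx0 : 0 < x / R := by positivity
    have hy0 : 0 < y / R := by positivity
    have hx1 : x / R < 2 * Real.pi := by rw [div_lt_iff₀ hR]; nlinarith
    have hy1 : y / R < 2 * Real.pi := by rw [div_lt_iff₀ hR]; nlinarith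
    have hc : Real.cos (x / R - y / R) = 1 := by
      rw [Real.cos_sub, s, c]; nlinarith [Real.sin_sq_add_cos_sq (y / R)]
    have := (Real.cos_eq_one_iff_of_lt_of_lt (by linarith) (by linarith)).1 hc
    have h3 : x / R = y / R := by linarith
    field_simp at h3
    exact h3

/-- Segment of length `ℓ` followed by a clockwise arc of radius `R`, turning by `τ`. -/
def segArcSet (a : ℂ) (θ ℓ R τ : ℝ) : Set ℂ :=
  {z | (∃ s, 0 ≤ s ∧ s ≤ ℓ ∧ z.re = a.re + s * Real.cos θ ∧ z.im = a.im + s * Real.sin θ) ∨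
    ∃ φ, θ + Real.pi / 2 - τ ≤ φ ∧ φ ≤ θ + Real.pi / 2 ∧
      z.re = a.re + ℓ * Real.cos θ + R * Real.sin θ + R * Real.cos φ ∧
      z.im = a.im + ℓ * Real.sin θ - R * Real.cos θ + R * Real.sin φ}

lemma exp_mk (θ : ℝ) : Complex.exp (Complex.I * θ) = ⟨Real.cos θ, Real.sin θ⟩ := by
  rw [mul_comm, Complex.exp_mul_I, Complex.mk_eq_add_mul_I]
  simp

lemma segArc_EC (a : ℂ) (θ : ℝ) {ℓ R τ : ℝ} (hl : 0 < ℓ) (hR : 0 < R) (h0 : 0 < τ)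
    (h1 : τ < 2 * Real.pi) :
    EC a ⟨a.re + ℓ * Real.cos θ + R * Real.sin θ + R * Real.cos (θ + Real.pi / 2 - τ),
      a.im + ℓ * Real.sin θ - R * Real.cos θ + R * Real.sin (θ + Real.pi / 2 - τ)⟩
      θ (θ - τ + Real.pi) (segArcSet a θ ℓ R τ) := by
  set T := ℓ + R * τ with hT
  have hTp : 0 < T := by positivity
  have hs0 : 0 < ℓ / T := by positivity
  have hs1 : ℓ / T < 1 := by rw [div_lt_one hTp]; nlinarith [mul_pos hR h0]
  have hcs := Real.sin_sq_add_cos_sq θ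
  set w : ℂ := ⟨Real.cos θ, Real.sin θ⟩ with hw
  have hw0 : w ≠ 0 := by
    intro h
    have h1 := congrArg Complex.re h
    have h2 := congrArg Complex.im h
    simp only [hw, Complex.zero_re, Complex.zero_im] at h1 h2
    nlinarith
  -- explicit values
  have vseg : ∀ x, x ≤ 0 → a + w * (ℓ + bas R x) =
      ⟨a.re + (ℓ + x) * Real.cos θ, a.im + (ℓ + x) * Real.sin θ⟩ := by
    intro x hx
    simp only [bas, hx, if_true, hw, Complex.ext_iff]
    constructor <;> simp <;> ring
  have varc : ∀ x, 0 ≤ x → a + w * (ℓ + bas R x) =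
      ⟨a.re + ℓ * Real.cos θ + R * Real.sin θ + R * Real.cos (θ + Real.pi / 2 - x / R),
      a.im + ℓ * Real.sin θ - R * Real.cos θ + R * Real.sin (θ + Real.pi / 2 - x / R)⟩ := by
    intro x hx
    have c1 : Real.cos (θ + Real.pi / 2 - x / R) = - Real.sin (θ - x / R) := by
      rw [show θ + Real.pi / 2 - x / R = (θ - x / R) + Real.pi / 2 by ring, Real.cos_add_pi_div_two]
    have s1 : Real.sin (θ + Real.pi / 2 - x / R) = Real.cos (θ - x / R) := by
      rw [show θ + Real.pi / 2 - x / R = (θ - x / R) + Real.pi / 2 by ring, Real.sin_add_pi_div_two]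
    rw [c1, s1, Real.sin_sub, Real.cos_sub]
    rcases hx.eq_or_lt with rfl | hx
    · simp only [bas, le_refl, if_true, hw, Complex.ext_iff]
      constructor <;> simp <;> ring
    · simp only [bas, not_le.2 hx, if_false, hw, Complex.ext_iff]
      constructor <;> simp <;> ring
  refine ⟨fun t => a + w * (ℓ + bas R (T * t - ℓ)), fun t => w * (T * bas' R (T * t - ℓ)),
    ⟨ℓ / T, hs0, hs1, ⟨Piece.seg a (a + w * ℓ), ?_, ?_⟩,
      ⟨Piece.arc ⟨a.re + ℓ * Real.cos θ + R * Real.sin θ, a.im + ℓ * Real.sin θ - R * Real.cos θ⟩ R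
        (θ + Real.pi / 2) (θ + Real.pi / 2 - τ), ⟨hR.ne', by linarith⟩, ?_⟩⟩, ?_, ?_, ?_, ?_, ?_,
      ?_, ?_, ⟨T, hTp, ?_⟩, ⟨T, hTp, ?_⟩⟩
  · have : (ℓ : ℂ) ≠ 0 := by exact_mod_cast hl.ne'
    simp [Piece.Nondeg, this, hw0]
  · intro u hu
    have e : T * (0 + u * (ℓ / T - 0)) - ℓ = u * ℓ - ℓ := by field_simp; ring
    have hle : u * ℓ - ℓ ≤ 0 := by nlinarith [hu.2]
    simp only [e, Piece.toFun, bas, hle, if_true]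
    push_cast; ring
  · intro u hu
    have e : T * (ℓ / T + u * (1 - ℓ / T)) - ℓ = u * (R * τ) := by
      field_simp; rw [hT]; ring
    have hle : 0 ≤ u * (R * τ) := by have := hu.1; positivity
    simp only [e]
    rw [varc _ hle]
    simp only [Piece.toFun, exp_mk]
    have e2 : u * (R * τ) / R = u * τ := by field_simp
    have e3 : θ + Real.pi / 2 + u * (θ + Real.pi / 2 - τ - (θ + Real.pi / 2)) =
      θ + Real.pi / 2 - u * τ := by ring
    rw [e2, e3]
    simp [Complex.ext_iff]
  · intro t
    have hd : HasDerivAt (fun t : ℝ => T * t - ℓ) T t := by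
      simpa using ((hasDerivAt_id t).const_mul T).sub_const ℓ
    have := ((((bas_hasDerivAt hR (T * t - ℓ)).scomp t hd).const_add (ℓ : ℂ)).const_mul w).const_add a
    simpa [Function.comp_def] using this
  · have := bas'_cont R
    fun_prop
  · intro t
    exact mul_ne_zero hw0 (mul_ne_zero (by exact_mod_cast hTp.ne') (bas'_ne _ _))
  · intro x hx y hy hxy
    have h2 : bas R (T * x - ℓ) = bas R (T * y - ℓ) := by
      have h3 : w * (ℓ + bas R (T * x - ℓ)) = w * (ℓ + bas R (T * y - ℓ)) := add_left_cancel hxy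
      exact add_left_cancel (mul_left_cancel₀ hw0 h3)
    have := bas_injOn hR h1 (x₁ := T * x - ℓ) (x₂ := T * y - ℓ)
      (by simp only [mem_Iic]; nlinarith [hx.2]) (by simp only [mem_Iic]; nlinarith [hy.2]) h2
    have : T * x = T * y := by linarith
    exact mul_left_cancel₀ hTp.ne' this
  · ext z
    constructor
    · rintro ⟨t, ht, rfl⟩
      rcases le_total (T * t - ℓ) 0 with h | h
      · left
        refine ⟨T * t, by have := ht.1; positivity, by linarith, ?_⟩
        simp only [vseg _ h]
        constructor <;> ring
      · right
        refine ⟨θ + Real.pi / 2 - (T * t - ℓ) / R, ?_, ?_, ?_⟩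
        · have : (T * t - ℓ) / R ≤ τ := by
            rw [div_le_iff₀ hR]; nlinarith [ht.2]
          linarith
        · have : 0 ≤ (T * t - ℓ) / R := by positivity
          linarith
        · simp only [varc _ h]
          exact ⟨trivial, trivial⟩
    · rintro (⟨s, hs, hs', e1, e2⟩ | ⟨φ, hφ, hφ', e1, e2⟩)
      · refine ⟨s / T, ⟨by positivity, ?_⟩, ?_⟩
        · rw [div_le_one hTp]; nlinarith [mul_pos hR h0]
        · have e : T * (s / T) - ℓ = s - ℓ := by field_simp
          simp only [e]
          rw [vseg _ (by linarith)]
          apply Complex.ext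
          · rw [e1]; ring
          · rw [e2]; ring
      · refine ⟨(ℓ + R * (θ + Real.pi / 2 - φ)) / T, ⟨?_, ?_⟩, ?_⟩
        · have : 0 ≤ R * (θ + Real.pi / 2 - φ) := mul_nonneg hR.le (by linarith)
          positivity
        · rw [div_le_one hTp]
          have : R * (θ + Real.pi / 2 - φ) ≤ R * τ := mul_le_mul_of_nonneg_left (by linarith) hR.le
          linarith
        · have e : T * ((ℓ + R * (θ + Real.pi / 2 - φ)) / T) - ℓ = R * (θ + Real.pi / 2 - φ) := by
            field_simp; ring
          simp only [e]
          rw [varc _ (mul_nonneg hR.le (by linarith))]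
          have e3 : θ + Real.pi / 2 - R * (θ + Real.pi / 2 - φ) / R = φ := by field_simp; ring
          apply Complex.ext
          · rw [e1, e3]
          · rw [e2, e3]
  · simp only [mul_zero, zero_sub]
    rw [vseg _ (by linarith)]
    simp
  · have e : T * 1 - ℓ = R * τ := by rw [hT]; ring
    simp only [e]
    rw [varc _ (by positivity)]
    have e3 : R * τ / R = τ := by field_simp
    rw [e3]
  · rw [exp_mk]
    have : bas' R (T * 0 - ℓ) = 1 := by
      simp [bas', Complex.ext_iff, hl.le]
    simp only [this, hw]; ring
  · have e : T * 1 - ℓ = R * τ := by rw [hT]; ring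
    have e3 : max (R * τ) 0 / R = τ := by rw [max_eq_left (by positivity)]; field_simp
    simp only [e, bas', e3, exp_mk, hw, Complex.ext_iff]
    rw [Real.cos_add_pi, Real.sin_add_pi, Real.cos_sub, Real.sin_sub]
    constructor <;> simp <;> ring

/-- Straight segment. -/
lemma seg_EC (a : ℂ) (θ : ℝ) {ℓ : ℝ} (hl : 0 < ℓ) :
    EC a ⟨a.re + ℓ * Real.cos θ, a.im + ℓ * Real.sin θ⟩ θ (θ + Real.pi)
      {z | ∃ s, 0 ≤ s ∧ s ≤ ℓ ∧ z.re = a.re + s * Real.cos θ ∧ z.im = a.im + s * Real.sin θ} := by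
  have hcs := Real.sin_sq_add_cos_sq θ
  set w : ℂ := ⟨Real.cos θ, Real.sin θ⟩ with hw
  have hw0 : w ≠ 0 := by
    intro h
    have h1 := congrArg Complex.re h
    have h2 := congrArg Complex.im h
    simp only [hw, Complex.zero_re, Complex.zero_im] at h1 h2
    nlinarith
  have hl' : (ℓ : ℂ) ≠ 0 := by exact_mod_cast hl.ne'
  refine ⟨fun t => a + t * (ℓ * w), fun t => ℓ * w, ⟨1 / 2, by norm_num, by norm_num,
    ⟨Piece.seg a (a + (1 / 2) * (ℓ * w)), ?_, ?_⟩, ⟨Piece.seg (a + (1 / 2) * (ℓ * w)) (a + ℓ * w), ?_, ?_⟩⟩,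
    ?_, ?_, ?_, ?_, ?_, ?_, ?_, ⟨ℓ, hl, ?_⟩, ⟨ℓ, hl, ?_⟩⟩
  · simp [Piece.Nondeg, hl', hw0]
  · intro u hu
    simp only [Piece.toFun]; push_cast; ring
  · simp only [Piece.Nondeg]
    intro h
    have : (1 / 2 : ℂ) * (ℓ * w) = 0 := by linear_combination -h
    simp [hl', hw0] at this
  · intro u hu
    simp only [Piece.toFun]; push_cast; ring
  · intro t
    have := ((hasDerivAt_id t).ofReal_comp.mul_const ((ℓ : ℂ) * w)).const_add a
    simpa using this
  · fun_prop
  · intro t; exact mul_ne_zero hl' hw0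
  · intro x hx y hy hxy
    have h3 : (x : ℂ) * (ℓ * w) = y * (ℓ * w) := add_left_cancel hxy
    exact_mod_cast mul_right_cancel₀ (mul_ne_zero hl' hw0) h3
  · ext z
    constructor
    · rintro ⟨t, ht, rfl⟩
      refine ⟨t * ℓ, mul_nonneg ht.1 hl.le, by nlinarith [ht.2], ?_, ?_⟩ <;> simp [hw] <;> ring
    · rintro ⟨s, h0, h1, e1, e2⟩
      refine ⟨s / ℓ, ⟨by positivity, by rw [div_le_one hl]; exact h1⟩, ?_⟩
      have e : ((s / ℓ : ℝ) : ℂ) * (ℓ * w) = s * w := by push_cast; field_simp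
      simp only [e]
      apply Complex.ext
      · simp [hw, e1]
      · simp [hw, e2]
  · simp
  · simp [hw, Complex.ext_iff]
  · rw [exp_mk]
  · rw [exp_mk, Real.cos_add_pi, Real.sin_add_pi]
    simp [hw, Complex.ext_iff]

/-! ## Partial drawings -/

/-- vertical segment above `E` -/
def vert (E : ℂ) (h : ℝ) : Set ℂ := {z | z.re = E.re ∧ E.im ≤ z.im ∧ z.im ≤ E.im + h}

/-- Data of a partial drawing: vertices `S`, edges `Ed`, open strands `L` (in left-to-right order)
with tips `E`. -/
structure Dr (V : Type*) where
  pos : V → ℂ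
  dir : V → V → ℝ
  img : Sym2 V → Set ℂ
  E : V × V → ℂ
  S : Set V
  Ed : Set (Sym2 V)
  L : List (V × V)

/-- the set of drawn points -/
def Dr.B {V : Type*} (D : Dr V) : Set ℂ :=
  {z | (∃ x ∈ D.S, z = D.pos x) ∨ ∃ e ∈ D.Ed, z ∈ D.img e}

/-- equally spaced directions at `x` -/
def Res {V : Type*} (G : SimpleGraph V) (dir : V → ℝ) (x : V) : Prop :=
  Nb G x [] ∨ (∃ y, Nb G x [y]) ∨ (∃ y w, Nb G x [y, w] ∧ dir w = dir y + Real.pi) ∨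
    ∃ y w z, Nb G x [y, w, z] ∧ dir w = dir y + 2 * Real.pi / 3 ∧ dir z = dir y + 4 * Real.pi / 3

/-- an open strand from `a` with tip `E` that can be prolonged vertically upwards. -/
def Strand (a E : ℂ) (α : ℝ) (C : Set ℂ) : Prop :=
  E ∈ C ∧ ∀ h, 0 < h → EC a ⟨E.re, E.im + h⟩ α (3 * Real.pi / 2) (C ∪ vert E h)

structure Good {V : Type*} (G : SimpleGraph V) (D : Dr V) : Prop where
  inj : InjOn D.pos D.S
  res : ∀ x ∈ D.S, Res G (D.dir x) x
  ed : ∀ e ∈ D.Ed, (∃ x y, e = s(x, y) ∧ x ∈ D.S ∧ y ∈ D.S ∧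
    EC (D.pos x) (D.pos y) (D.dir x y) (D.dir y x) (D.img e)) ∨ ∃ d ∈ D.L, e = s(d.1, d.2)
  str : ∀ d ∈ D.L, d.1 ∈ D.S ∧ d.2 ∉ D.S ∧ s(d.1, d.2) ∈ D.Ed ∧
    Strand (D.pos d.1) (D.E d) (D.dir d.1 d.2) (D.img s(d.1, d.2))
  nc : ∀ e ∈ D.Ed, ∀ f ∈ D.Ed, e ≠ f → ∀ z ∈ D.img e, z ∈ D.img f →
    ∃ w ∈ D.S, w ∈ e ∧ w ∈ f ∧ z = D.pos w
  vf : ∀ e ∈ D.Ed, ∀ w ∈ D.S, D.pos w ∈ D.img e → w ∈ e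
  srt : D.L.Pairwise (fun d d' => (D.E d).re < (D.E d').re)
  ray : ∀ d ∈ D.L, ∀ z ∈ D.B, z.re = (D.E d).re → z.im ≤ (D.E d).im
  bdd : Bdd D.B

section prim
variable {V : Type*} {G : SimpleGraph V} {D : Dr V}
open Classical

lemma Dr.pos_mem {x : V} (h : x ∈ D.S) : D.pos x ∈ D.B := Or.inl ⟨x, h, rfl⟩
lemma Dr.img_mem {e : Sym2 V} (h : e ∈ D.Ed) {z : ℂ} (hz : z ∈ D.img e) : z ∈ D.B :=
  Or.inr ⟨e, h, hz⟩
lemma Good.E_mem (g : Good G D) {d : V × V} (h : d ∈ D.L) : D.E d ∈ D.B :=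
  Dr.img_mem (g.str d h).2.2.1 (g.str d h).2.2.2.1
lemma Good.inc (g : Good G D) {e : Sym2 V} (h : e ∈ D.Ed) : ∃ x ∈ D.S, x ∈ e := by
  rcases g.ed e h with ⟨x, y, rfl, hx, -, -⟩ | ⟨d, hd, rfl⟩
  · exact ⟨x, hx, by simp⟩
  · exact ⟨d.1, (g.str d hd).1, by simp⟩

/-- add an isolated vertex -/
noncomputable def Dr.addV (D : Dr V) (p : V) (P : ℂ) (f : V → ℝ) : Dr V :=
  { D with pos := Function.update D.pos p P, dir := Function.update D.dir p f, S := insert p D.S }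

lemma upd_S {α : Type*} {S : Set V} {p : V} (hp : p ∉ S) (g : V → α) (P : α) {x : V} (hx : x ∈ S) :
    Function.update g p P x = g x :=
  Function.update_of_ne (by rintro rfl; exact hp hx) _ _

lemma Dr.addV_B {p : V} (hp : p ∉ D.S) (P : ℂ) (f : V → ℝ) :
    (D.addV p P f).B = insert P D.B := by
  ext z
  simp only [Dr.B, Dr.addV, mem_insert_iff, Set.mem_ofPred_eq]
  constructor
  · rintro (⟨x, rfl | hx, rfl⟩ | h)
    · left; simp
    · right; left; exact ⟨x, hx, upd_S hp _ _ hx⟩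
    · right; right; exact h
  · rintro (rfl | ⟨x, hx, rfl⟩ | h)
    · left; exact ⟨p, Or.inl rfl, by simp⟩
    · left; exact ⟨x, Or.inr hx, (upd_S hp _ _ hx).symm⟩
    · right; exact h

lemma Good.addV (g : Good G D) {p : V} (hp : p ∉ D.S) {P : ℂ} (hP : P ∉ D.B) {f : V → ℝ}
    (hf : Res G f p) (hd : ∀ d ∈ D.L, d.2 ≠ p ∧ (P.re = (D.E d).re → P.im ≤ (D.E d).im)) :
    Good G (D.addV p P f) := by
  have hpos : ∀ x ∈ D.S, (D.addV p P f).pos x = D.pos x := fun x hx => upd_S hp _ _ hx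
  have hdir : ∀ x ∈ D.S, (D.addV p P f).dir x = D.dir x := fun x hx => upd_S hp _ _ hx
  have hpp : (D.addV p P f).pos p = P := by simp [Dr.addV]
  have hdp : (D.addV p P f).dir p = f := by simp [Dr.addV]
  refine ⟨?_, ?_, ?_, ?_, ?_, ?_, g.srt, ?_, ?_⟩
  · rintro x (rfl | hx) y (rfl | hy) hxy
    · rfl
    · rw [hpp, hpos y hy] at hxy
      exact absurd (hxy ▸ Dr.pos_mem hy) hP
    · rw [hpp, hpos x hx] at hxy
      exact absurd (hxy ▸ Dr.pos_mem hx) hP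
    · rw [hpos x hx, hpos y hy] at hxy
      exact g.inj hx hy hxy
  · rintro x (rfl | hx)
    · rw [hdp]; exact hf
    · rw [hdir x hx]; exact g.res x hx
  · intro e he
    rcases g.ed e he with ⟨x, y, rfl, hx, hy, h⟩ | h
    · left
      refine ⟨x, y, rfl, Or.inr hx, Or.inr hy, ?_⟩
      rw [hpos x hx, hpos y hy, hdir x hx, hdir y hy]; exact h
    · exact Or.inr h
  · intro d h
    obtain ⟨h1, h2, h3, h4⟩ := g.str d h
    refine ⟨Or.inr h1, ?_, h3, ?_⟩
    · rintro (h | h)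
      · exact (hd d ‹_›).1 h
      · exact h2 h
    · rw [hpos _ h1, hdir _ h1]; exact h4
  · intro e he f hf hef z hz hz'
    obtain ⟨w, hw, h1, h2, h3⟩ := g.nc e he f hf hef z hz hz'
    exact ⟨w, Or.inr hw, h1, h2, by rw [hpos w hw]; exact h3⟩
  · rintro e he w (rfl | hw) h
    · rw [hpp] at h
      exact absurd (Dr.img_mem (D := D) he h) hP
    · rw [hpos w hw] at h
      exact g.vf e he w hw h
  · intro d h z hz
    rw [Dr.addV_B hp] at hz
    rcases hz with rfl | hz
    · exact (hd d h).2
    · exact g.ray d h z hz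
  · rw [Dr.addV_B hp]
    exact (Bdd.single P).union g.bdd

/-- place the vertex `p` on the first strand -/
noncomputable def Dr.popV (D : Dr V) (p : V) (d : V × V) (rest : List (V × V)) (h : ℝ) (f : V → ℝ) :
    Dr V :=
  { D with
    pos := Function.update D.pos p ⟨(D.E d).re, (D.E d).im + h⟩
    dir := Function.update D.dir p f
    img := Function.update D.img s(d.1, d.2) (D.img s(d.1, d.2) ∪ vert (D.E d) h)
    S := insert p D.S
    L := rest }

lemma Good.popV_B (g : Good G D) {p : V} (hp : p ∉ D.S) {d : V × V} {rest : List (V × V)}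
    (hL : D.L = d :: rest) {h : ℝ} (hh : 0 < h) (f : V → ℝ) :
    (D.popV p d rest h f).B = D.B ∪ vert (D.E d) h := by
  have hed := (g.str d (by simp [hL])).2.2.1
  ext z
  simp only [Dr.B, Dr.popV, mem_insert_iff, Set.mem_ofPred_eq, mem_union]
  constructor
  · rintro (⟨x, rfl | hx, rfl⟩ | ⟨e, he, hz⟩)
    · right; simp [vert, hh.le]
    · left; left; exact ⟨x, hx, upd_S hp _ _ hx⟩
    · by_cases h1 : e = s(d.1, d.2)
      · subst h1
        simp only [Function.update_self] at hz
        rcases hz with hz | hz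
        · left; right; exact ⟨_, he, hz⟩
        · right; exact hz
      · rw [Function.update_of_ne h1] at hz
        left; right; exact ⟨e, he, hz⟩
  · rintro ((⟨x, hx, rfl⟩ | ⟨e, he, hz⟩) | h)
    · left; exact ⟨x, Or.inr hx, (upd_S hp _ _ hx).symm⟩
    · right
      refine ⟨e, he, ?_⟩
      by_cases h1 : e = s(d.1, d.2)
      · subst h1
        simp only [Function.update_self]
        exact Or.inl hz
      · rw [Function.update_of_ne h1]; exact hz
    · right
      refine ⟨_, hed, ?_⟩
      simp only [Function.update_self]
      exact Or.inr h

lemma Good.popV (g : Good G D) {p : V} (hp : p ∉ D.S) {d : V × V} {rest : List (V × V)}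
    (hL : D.L = d :: rest) (hdp : d.2 = p) (hrest : ∀ d' ∈ rest, d'.2 ≠ p) {h : ℝ} (hh : 0 < h)
    {f : V → ℝ} (hf : Res G f p) (hfd : f d.1 = 3 * Real.pi / 2) :
    Good G (D.popV p d rest h f) := by
  have hdL : d ∈ D.L := by simp [hL]
  have hrL : ∀ d' ∈ rest, d' ∈ D.L := fun d' h => by simp [hL, h]
  obtain ⟨hd1, hd2, hded, hstr⟩ := g.str d hdL
  have hBe := g.popV_B hp hL hh f
  have hsrt : (∀ d' ∈ rest, (D.E d).re < (D.E d').re) ∧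
      rest.Pairwise (fun d d' => (D.E d).re < (D.E d').re) := by
    have := g.srt; rw [hL, List.pairwise_cons] at this; exact this
  have hvB : ∀ z ∈ vert (D.E d) h, z ∈ D.B → z = D.E d := by
    intro z hz hzB
    have := g.ray d hdL z hzB hz.1
    exact Complex.ext hz.1 (le_antisymm this hz.2.1)
  have hPv : (⟨(D.E d).re, (D.E d).im + h⟩ : ℂ) ∈ vert (D.E d) h := by simp [vert, hh.le]
  have hPB : (⟨(D.E d).re, (D.E d).im + h⟩ : ℂ) ∉ D.B := by
    intro hB
    have := congrArg Complex.im (hvB _ hPv hB)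
    simp only at this
    linarith
  set P : ℂ := ⟨(D.E d).re, (D.E d).im + h⟩ with hPdef
  have hpos : ∀ x ∈ D.S, (D.popV p d rest h f).pos x = D.pos x := fun x hx => upd_S hp _ _ hx
  have hdir : ∀ x ∈ D.S, (D.popV p d rest h f).dir x = D.dir x := fun x hx => upd_S hp _ _ hx
  have hpp : (D.popV p d rest h f).pos p = P := by simp [Dr.popV, hPdef]
  have hdirp : (D.popV p d rest h f).dir p = f := by simp [Dr.popV]
  have himd : (D.popV p d rest h f).img s(d.1, d.2) = D.img s(d.1, d.2) ∪ vert (D.E d) h := by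
    simp [Dr.popV]
  have himo : ∀ e, e ≠ s(d.1, d.2) → (D.popV p d rest h f).img e = D.img e := fun e he =>
    Function.update_of_ne he _ _
  have hne : ∀ d' ∈ rest, s(d'.1, d'.2) ≠ s(d.1, d.2) := by
    intro d' hd' he
    rcases Sym2.eq_iff.1 he with ⟨h1, h2⟩ | ⟨h1, h2⟩
    · exact hrest d' hd' (h2.trans hdp)
    · apply hp; rw [← hdp, ← h1]; exact (g.str d' (hrL d' hd')).1
  -- key: the prolonged strand against others
  have hkey : ∀ e ∈ D.Ed, e ≠ s(d.1, d.2) → ∀ z ∈ D.img e, z ∈ D.img s(d.1, d.2) ∪ vert (D.E d) h →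
      ∃ w ∈ D.S, w ∈ e ∧ w ∈ s(d.1, d.2) ∧ z = D.pos w := by
    intro e he hne z hz hz'
    rcases hz' with hz' | hz'
    · exact g.nc e he _ hded hne z hz hz'
    · have := hvB z hz' (Dr.img_mem he hz)
      subst this
      exact g.nc e he _ hded hne _ hz hstr.1
  refine ⟨?_, ?_, ?_, ?_, ?_, ?_, hsrt.2, ?_, ?_⟩
  · rintro x (rfl | hx) y (rfl | hy) hxy
    · rfl
    · rw [hpp, hpos y hy] at hxy
      exact absurd (hxy ▸ Dr.pos_mem hy) hPB
    · rw [hpp, hpos x hx] at hxy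
      exact absurd (hxy ▸ Dr.pos_mem hx) hPB
    · rw [hpos x hx, hpos y hy] at hxy
      exact g.inj hx hy hxy
  · rintro x (rfl | hx)
    · rw [hdirp]; exact hf
    · rw [hdir x hx]; exact g.res x hx
  · intro e he
    by_cases hed : e = s(d.1, d.2)
    · left
      refine ⟨d.1, p, by rw [hed, hdp], Or.inr hd1, Or.inl rfl, ?_⟩
      rw [hed, himd, hpos _ hd1, hpp, hdir _ hd1, hdirp, hfd, ← hdp]
      exact hstr.2 h hh
    · rw [himo e hed]
      rcases g.ed e he with ⟨x, y, rfl, hx, hy, h⟩ | ⟨d', hd', rfl⟩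
      · left
        refine ⟨x, y, rfl, Or.inr hx, Or.inr hy, ?_⟩
        rw [hpos x hx, hpos y hy, hdir x hx, hdir y hy]; exact h
      · right
        rw [hL, List.mem_cons] at hd'
        rcases hd' with rfl | hd'
        · exact absurd rfl hed
        · exact ⟨d', hd', rfl⟩
  · intro d' hd'
    obtain ⟨h1, h2, h3, h4⟩ := g.str d' (hrL d' hd')
    refine ⟨Or.inr h1, ?_, h3, ?_⟩
    · rintro (h | h)
      · exact hrest d' hd' h
      · exact h2 h
    · rw [hpos _ h1, hdir _ h1, himo _ (hne d' hd')]; exact h4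
  · intro e he f' hf' hef z hz hz'
    suffices ∃ w ∈ D.S, w ∈ e ∧ w ∈ f' ∧ z = D.pos w by
      obtain ⟨w, hw, h1, h2, h3⟩ := this
      exact ⟨w, Or.inr hw, h1, h2, by rw [hpos w hw]; exact h3⟩
    by_cases h1 : e = s(d.1, d.2)
    · have h2 : f' ≠ s(d.1, d.2) := fun h => hef (h1.trans h.symm)
      rw [himo _ h2] at hz'
      rw [h1, himd] at hz
      obtain ⟨w, hw, a, b, c⟩ := hkey f' hf' h2 z hz' hz
      exact ⟨w, hw, h1 ▸ b, a, c⟩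
    · rw [himo _ h1] at hz
      by_cases h2 : f' = s(d.1, d.2)
      · rw [h2, himd] at hz'
        rw [h2]
        exact hkey e he h1 z hz hz'
      · rw [himo _ h2] at hz'
        exact g.nc e he f' hf' hef z hz hz'
  · rintro e he w (rfl | hw) hz
    · rw [hpp] at hz
      by_cases h1 : e = s(d.1, d.2)
      · rw [h1]; simp [hdp]
      · rw [himo _ h1] at hz
        exact absurd (Dr.img_mem (D := D) he hz) hPB
    · rw [hpos w hw] at hz
      by_cases h1 : e = s(d.1, d.2)
      · rw [h1, himd] at hz
        rw [h1]
        rcases hz with hz | hz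
        · exact g.vf _ hded w hw hz
        · have := hvB _ hz (Dr.pos_mem hw)
          exact g.vf _ hded w hw (this ▸ hstr.1)
      · rw [himo _ h1] at hz
        exact g.vf e he w hw hz
  · intro d' hd' z hz hzr
    rw [hBe] at hz
    rcases hz with hz | hz
    · exact g.ray d' (hrL d' hd') z hz hzr
    · have := hsrt.1 d' hd'
      have e : z.re = (D.E d).re := hz.1
      have hzr' : z.re = (D.E d').re := hzr
      linarith
  · rw [hBe]
    refine g.bdd.union ⟨|(D.E d).re| + |(D.E d).im| + h, fun z hz => ?_⟩
    have := abs_nonneg (D.E d).re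
    have := abs_nonneg (D.E d).im
    rw [hz.1]
    refine ⟨by linarith, ?_⟩
    rw [abs_le]
    constructor
    · linarith [hz.2.1, neg_abs_le (D.E d).im]
    · linarith [hz.2.2, le_abs_self (D.E d).im]

/-- add an edge between drawn vertices -/
noncomputable def Dr.addE (D : Dr V) (x y : V) (C : Set ℂ) : Dr V :=
  { D with img := Function.update D.img s(x, y) C, Ed := insert s(x, y) D.Ed }

lemma Dr.updI_B {e : Sym2 V} (he : e ∉ D.Ed) (C : Set ℂ) (z : ℂ) :
    ((∃ x ∈ D.S, z = D.pos x) ∨ ∃ f ∈ insert e D.Ed, z ∈ Function.update D.img e C f) ↔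
      z ∈ D.B ∨ z ∈ C := by
  constructor
  · rintro (h | ⟨f, rfl | hf, hz⟩)
    · left; left; exact h
    · right; simpa using hz
    · left; right
      rw [Function.update_of_ne (by rintro rfl; exact he hf)] at hz
      exact ⟨f, hf, hz⟩
  · rintro ((h | ⟨f, hf, hz⟩) | h)
    · left; exact h
    · right
      refine ⟨f, Or.inr hf, ?_⟩
      rw [Function.update_of_ne (by rintro rfl; exact he hf)]
      exact hz
    · right; exact ⟨e, Or.inl rfl, by simpa using h⟩

lemma Dr.addE_B {x y : V} (he : s(x, y) ∉ D.Ed) (C : Set ℂ) : (D.addE x y C).B = D.B ∪ C := by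
  ext z; exact Dr.updI_B he C z

lemma nc_upd (g : Good G D) {e₀ : Sym2 V} (he : e₀ ∉ D.Ed) {C : Set ℂ}
    (hC : ∀ z ∈ C, z ∈ D.B → ∃ w ∈ D.S, w ∈ e₀ ∧ z = D.pos w) :
    (∀ e ∈ insert e₀ D.Ed, ∀ f ∈ insert e₀ D.Ed, e ≠ f → ∀ z ∈ Function.update D.img e₀ C e,
      z ∈ Function.update D.img e₀ C f → ∃ w ∈ D.S, w ∈ e ∧ w ∈ f ∧ z = D.pos w) ∧
    (∀ e ∈ insert e₀ D.Ed, ∀ w ∈ D.S, D.pos w ∈ Function.update D.img e₀ C e → w ∈ e) := by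
  have hu : ∀ e ∈ D.Ed, Function.update D.img e₀ C e = D.img e := fun e h =>
    Function.update_of_ne (by rintro rfl; exact he h) _ _
  have key : ∀ f ∈ D.Ed, ∀ z ∈ C, z ∈ D.img f → ∃ w ∈ D.S, w ∈ e₀ ∧ w ∈ f ∧ z = D.pos w := by
    intro f hf z hz hz'
    obtain ⟨w, hw, h1, h2⟩ := hC z hz (Dr.img_mem hf hz')
    exact ⟨w, hw, h1, g.vf f hf w hw (h2 ▸ hz'), h2⟩
  constructor
  · rintro e (rfl | h1) f (rfl | h2) hef z hz hz'
    · exact absurd rfl hef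
    · rw [Function.update_self] at hz
      rw [hu f h2] at hz'
      exact key f h2 z hz hz'
    · rw [Function.update_self] at hz'
      rw [hu e h1] at hz
      obtain ⟨w, hw, a, b, c⟩ := key e h1 z hz' hz
      exact ⟨w, hw, b, a, c⟩
    · rw [hu e h1] at hz
      rw [hu f h2] at hz'
      exact g.nc e h1 f h2 hef z hz hz'
  · rintro e (rfl | h1) w hw hz
    · rw [Function.update_self] at hz
      obtain ⟨w', hw', h1, h2⟩ := hC _ hz (Dr.pos_mem hw)
      rw [g.inj hw hw' h2]; exact h1
    · rw [hu e h1] at hz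
      exact g.vf e h1 w hw hz

lemma Good.addE (g : Good G D) {x y : V} (hx : x ∈ D.S) (hy : y ∈ D.S) (he : s(x, y) ∉ D.Ed)
    {C : Set ℂ} (hEC : EC (D.pos x) (D.pos y) (D.dir x y) (D.dir y x) C)
    (hC : ∀ z ∈ C, z ∈ D.B → z = D.pos x ∨ z = D.pos y)
    (hray : ∀ d ∈ D.L, ∀ z ∈ C, z.re = (D.E d).re → z.im ≤ (D.E d).im) :
    Good G (D.addE x y C) := by
  have hu : ∀ e ∈ D.Ed, (D.addE x y C).img e = D.img e := fun e h =>
    Function.update_of_ne (by rintro rfl; exact he h) _ _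
  obtain ⟨n1, n2⟩ := nc_upd g he (C := C) (by
    intro z hz hzB
    rcases hC z hz hzB with h | h
    · exact ⟨x, hx, by simp, h⟩
    · exact ⟨y, hy, by simp, h⟩)
  refine ⟨g.inj, g.res, ?_, ?_, n1, n2, g.srt, ?_, ?_⟩
  · rintro e (rfl | h)
    · left
      refine ⟨x, y, rfl, hx, hy, ?_⟩
      simpa [Dr.addE] using hEC
    · rw [hu e h]; exact g.ed e h
  · intro d hd
    obtain ⟨h1, h2, h3, h4⟩ := g.str d hd
    refine ⟨h1, h2, Or.inr h3, ?_⟩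
    rw [hu _ h3]; exact h4
  · intro d hd z hz
    rw [Dr.addE_B he] at hz
    rcases hz with hz | hz
    · exact g.ray d hd z hz
    · exact hray d hd z hz
  · rw [Dr.addE_B he]
    exact g.bdd.union hEC.bdd

/-- add a strand -/
noncomputable def Dr.addS (D : Dr V) (d : V × V) (E : ℂ) (C : Set ℂ) (L : List (V × V)) : Dr V :=
  { D with
    img := Function.update D.img s(d.1, d.2) C
    E := Function.update D.E d E
    Ed := insert s(d.1, d.2) D.Ed
    L := L }

lemma Dr.addS_B {d : V × V} (he : s(d.1, d.2) ∉ D.Ed) (E : ℂ) (C : Set ℂ) (L : List (V × V)) :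
    (D.addS d E C L).B = D.B ∪ C := by
  ext z; exact Dr.updI_B he C z

lemma Good.addS (g : Good G D) {d : V × V} (hx : d.1 ∈ D.S) (hy : d.2 ∉ D.S)
    (he : s(d.1, d.2) ∉ D.Ed) {E : ℂ} {C : Set ℂ} {L : List (V × V)}
    (hL : L = d :: D.L ∧ (∀ d' ∈ D.L, E.re < (D.E d').re) ∨
      L = D.L ++ [d] ∧ (∀ d' ∈ D.L, (D.E d').re < E.re))
    (hEC : Strand (D.pos d.1) E (D.dir d.1 d.2) C)
    (hC : ∀ z ∈ C, z ∈ D.B → z = D.pos d.1)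
    (hray : ∀ d' ∈ D.L, ∀ z ∈ C, z.re = (D.E d').re → z.im ≤ (D.E d').im)
    (hrayB : ∀ z ∈ D.B, z.re = E.re → z.im ≤ E.im)
    (hrayC : ∀ z ∈ C, z.re = E.re → z.im ≤ E.im) :
    Good G (D.addS d E C L) := by
  have hu : ∀ e ∈ D.Ed, (D.addS d E C L).img e = D.img e := fun e h =>
    Function.update_of_ne (by rintro rfl; exact he h) _ _
  have hdL : d ∉ D.L := fun h => he (g.str d h).2.2.1
  have hE : ∀ d' ∈ D.L, (D.addS d E C L).E d' = D.E d' := fun d' h =>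
    Function.update_of_ne (by rintro rfl; exact hdL h) _ _
  have hEd : (D.addS d E C L).E d = E := by simp [Dr.addS]
  have hmem : ∀ d', d' ∈ L ↔ d' = d ∨ d' ∈ D.L := by
    intro d'
    rcases hL with ⟨rfl, -⟩ | ⟨rfl, -⟩
    · simp
    · simp [or_comm]
  obtain ⟨n1, n2⟩ := nc_upd g he (C := C) (by
    intro z hz hzB
    exact ⟨d.1, hx, by simp, hC z hz hzB⟩)
  have hbase : D.L.Pairwise (fun a b => ((D.addS d E C L).E a).re < ((D.addS d E C L).E b).re) := by
    refine g.srt.imp_of_mem ?_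
    intro a b ha hb h
    rw [hE a ha, hE b hb]; exact h
  refine ⟨g.inj, g.res, ?_, ?_, n1, n2, ?_, ?_, ?_⟩
  · rintro e (rfl | h)
    · right; exact ⟨d, (hmem d).2 (Or.inl rfl), rfl⟩
    · rw [hu e h]
      rcases g.ed e h with h | ⟨d', hd', rfl⟩
      · exact Or.inl h
      · right; exact ⟨d', (hmem d').2 (Or.inr hd'), rfl⟩
  · intro d' hd'
    rcases (hmem d').1 hd' with rfl | hd'
    · refine ⟨hx, hy, Or.inl rfl, ?_⟩
      rw [hEd]
      simpa [Dr.addS] using hEC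
    · obtain ⟨h1, h2, h3, h4⟩ := g.str d' hd'
      refine ⟨h1, h2, Or.inr h3, ?_⟩
      rw [hu _ h3, hE _ hd']; exact h4
  · show L.Pairwise _
    rcases hL with ⟨h, h'⟩ | ⟨h, h'⟩
    · nth_rewrite 3 [h]
      refine List.pairwise_cons.2 ⟨?_, hbase⟩
      intro a ha
      rw [hEd, hE a ha]; exact h' a ha
    · nth_rewrite 3 [h]
      refine List.pairwise_append.2 ⟨hbase, by simp, ?_⟩
      intro a ha b hb
      rw [List.mem_singleton] at hb
      subst hb
      rw [hEd, hE a ha]; exact h' a ha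
  · intro d' hd' z hz
    rw [Dr.addS_B he] at hz
    rcases (hmem d').1 hd' with rfl | hd'
    · rw [hEd]
      rcases hz with hz | hz
      · exact hrayB z hz
      · exact hrayC z hz
    · rw [hE _ hd']
      rcases hz with hz | hz
      · exact g.ray d' hd' z hz
      · exact hray d' hd' z hz
  · rw [Dr.addS_B he]
    exact g.bdd.union ((hEC.2 1 one_pos).bdd.mono subset_union_left)

/-- a single vertex -/
noncomputable def Dr.one (p : V) (P : ℂ) (f : V → ℝ) : Dr V :=
  { pos := fun _ => P, dir := fun _ => f, img := fun _ => ∅, E := fun _ => 0, S := {p}, Ed := ∅, L := [] }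

lemma Dr.one_B (p : V) (P : ℂ) (f : V → ℝ) : (Dr.one p P f).B = {P} := by
  ext z; simp [Dr.B, Dr.one]

lemma Good.one (p : V) (P : ℂ) {f : V → ℝ} (hf : Res G f p) : Good G (Dr.one p P f) := by
  refine ⟨?_, ?_, ?_, ?_, ?_, ?_, ?_, ?_, ?_⟩
  · simp [Dr.one]
  · rintro x rfl; exact hf
  · rintro e he; exact he.elim
  · rintro d hd; simp [Dr.one] at hd
  · rintro e he; exact he.elim
  · rintro e he; exact he.elim
  · simp [Dr.one]
  · rintro d hd; simp [Dr.one] at hd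
  · rw [Dr.one_B]; exact Bdd.single P

/-- affine image -/
noncomputable def Dr.aff (D : Dr V) (l : ℝ) (w : ℂ) : Dr V :=
  { D with
    pos := fun x => l * D.pos x + w
    img := fun e => (fun z => (l : ℂ) * z + w) '' D.img e
    E := fun d => l * D.E d + w }

lemma aff_re (l : ℝ) (z w : ℂ) : ((l : ℂ) * z + w).re = l * z.re + w.re := by simp
lemma aff_im (l : ℝ) (z w : ℂ) : ((l : ℂ) * z + w).im = l * z.im + w.im := by simp

lemma Dr.aff_B (l : ℝ) (w : ℂ) : (D.aff l w).B = (fun z => (l : ℂ) * z + w) '' D.B := by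
  ext z
  constructor
  · rintro (⟨x, hx, rfl⟩ | ⟨e, he, y, hy, rfl⟩)
    · exact ⟨_, Dr.pos_mem hx, rfl⟩
    · exact ⟨_, Dr.img_mem (D := D) he hy, rfl⟩
  · rintro ⟨y, ⟨x, hx, rfl⟩ | ⟨e, he, hy⟩, rfl⟩
    · exact Or.inl ⟨x, hx, rfl⟩
    · exact Or.inr ⟨e, he, y, hy, rfl⟩

lemma Strand.aff {a E : ℂ} {α : ℝ} {C : Set ℂ} (hs : Strand a E α C) {l : ℝ} (hl : 0 < l) (w : ℂ) :
    Strand (l * a + w) (l * E + w) α ((fun z => (l : ℂ) * z + w) '' C) := by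
  refine ⟨⟨E, hs.1, rfl⟩, fun h hh => ?_⟩
  have := (hs.2 (h / l) (by positivity)).aff hl w
  have e : (l : ℂ) * (⟨E.re, E.im + h / l⟩ : ℂ) + w =
      ⟨((l : ℂ) * E + w).re, ((l : ℂ) * E + w).im + h⟩ := by
    apply Complex.ext
    · simp
    · simp only [aff_im]; field_simp; ring
  have e2 : (fun z => (l : ℂ) * z + w) '' vert E (h / l) = vert (l * E + w) h := by
    ext z
    constructor
    · rintro ⟨y, ⟨h1, h2, h3⟩, rfl⟩
      refine ⟨?_, ?_, ?_⟩
      · simp [h1]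
      · simp only [aff_im]; nlinarith
      · simp only [aff_im]
        have : l * (E.im + h / l) = l * E.im + h := by field_simp
        nlinarith
    · rintro ⟨h1, h2, h3⟩
      simp only [aff_re, aff_im] at h1 h2 h3
      refine ⟨⟨(z.re - w.re) / l, (z.im - w.im) / l⟩, ⟨?_, ?_, ?_⟩, ?_⟩
      · simp only; field_simp; linarith
      · simp only; rw [le_div_iff₀ hl]; linarith
      · simp only
        rw [div_le_iff₀ hl]
        have : (E.im + h / l) * l = l * E.im + h := by field_simp
        linarith
      · apply Complex.ext
        · simp only [aff_re]; field_simp; ring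
        · simp only [aff_im]; field_simp; ring
  rw [e, image_union, e2] at this
  exact this

lemma aff_inj {l : ℝ} (hl : 0 < l) (w : ℂ) : Function.Injective (fun z => (l : ℂ) * z + w) := by
  intro x y h
  have hl' : (l : ℂ) ≠ 0 := by exact_mod_cast hl.ne'
  exact mul_left_cancel₀ hl' (add_right_cancel h)

lemma Good.aff (g : Good G D) {l : ℝ} (hl : 0 < l) (w : ℂ) : Good G (D.aff l w) := by
  have hi := aff_inj hl w
  refine ⟨?_, g.res, ?_, ?_, ?_, ?_, ?_, ?_, ?_⟩
  · intro x hx y hy h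
    exact g.inj hx hy (hi h)
  · intro e he
    rcases g.ed e he with ⟨x, y, rfl, hx, hy, h⟩ | h
    · left; exact ⟨x, y, rfl, hx, hy, h.aff hl w⟩
    · right; exact h
  · intro d hd
    obtain ⟨h1, h2, h3, h4⟩ := g.str d hd
    exact ⟨h1, h2, h3, h4.aff hl w⟩
  · rintro e he f hf hef z ⟨y, hy, rfl⟩ ⟨y', hy', h⟩
    have := hi h
    subst this
    obtain ⟨v, h1, h2, h3, rfl⟩ := g.nc e he f hf hef _ hy hy'
    exact ⟨v, h1, h2, h3, rfl⟩
  · rintro e he v hv ⟨y, hy, h⟩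
    have := hi h
    subst this
    exact g.vf e he v hv hy
  · refine g.srt.imp ?_
    intro a b h
    simp only [Dr.aff, aff_re]
    nlinarith
  · intro d hd z hz hzr
    rw [Dr.aff_B] at hz
    obtain ⟨y, hy, rfl⟩ := hz
    simp only [Dr.aff, aff_re, aff_im] at hzr ⊢
    have : y.re = (D.E d).re := by
      have : l * y.re = l * (D.E d).re := by linarith
      exact mul_left_cancel₀ hl.ne' this
    have := g.ray d hd y hy this
    nlinarith
  · rw [Dr.aff_B]
    obtain ⟨M, hM⟩ := g.bdd
    refine ⟨l * M + |w.re| + |w.im|, ?_⟩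
    rintro z ⟨y, hy, rfl⟩
    have := hM y hy
    have h1 := abs_nonneg w.re
    have h2 := abs_nonneg w.im
    simp only [aff_re, aff_im]
    constructor
    · refine (abs_add_le _ _).trans ?_
      rw [abs_mul, abs_of_pos hl]
      nlinarith [this.1]
    · refine (abs_add_le _ _).trans ?_
      rw [abs_mul, abs_of_pos hl]
      nlinarith [this.2]

/-- union of two partial drawings -/
noncomputable def Dr.un (D D' : Dr V) (L : List (V × V)) : Dr V :=
  { pos := fun x => if x ∈ D.S then D.pos x else D'.pos x
    dir := fun x => if x ∈ D.S then D.dir x else D'.dir x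
    img := fun e => if e ∈ D.Ed then D.img e else D'.img e
    E := fun d => if d.1 ∈ D.S then D.E d else D'.E d
    S := D.S ∪ D'.S
    Ed := D.Ed ∪ D'.Ed
    L := L }

lemma Good.un {D' : Dr V} (g : Good G D) (g' : Good G D') (hS : Disjoint D.S D'.S)
    (hd : ∀ d ∈ D.L, d.2 ∉ D'.S) (hd' : ∀ d ∈ D'.L, d.2 ∉ D.S) (hB : Disjoint D.B D'.B)
    (hray : ∀ d ∈ D.L, ∀ z ∈ D'.B, z.re = (D.E d).re → z.im ≤ (D.E d).im)
    (hray' : ∀ d ∈ D'.L, ∀ z ∈ D.B, z.re = (D'.E d).re → z.im ≤ (D'.E d).im)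
    (hs : ∀ d ∈ D.L, ∀ d' ∈ D'.L, (D.E d).re < (D'.E d').re) :
    Good G (D.un D' (D.L ++ D'.L)) ∧ (D.un D' (D.L ++ D'.L)).B = D.B ∪ D'.B ∧
      (∀ x ∈ D.S, (D.un D' (D.L ++ D'.L)).pos x = D.pos x ∧ (D.un D' (D.L ++ D'.L)).dir x = D.dir x) ∧
      (∀ x ∈ D'.S, (D.un D' (D.L ++ D'.L)).pos x = D'.pos x ∧
        (D.un D' (D.L ++ D'.L)).dir x = D'.dir x) ∧
      (∀ d ∈ D.L, (D.un D' (D.L ++ D'.L)).E d = D.E d) ∧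
      (∀ d ∈ D'.L, (D.un D' (D.L ++ D'.L)).E d = D'.E d) := by
  have hS' : ∀ x ∈ D'.S, x ∉ D.S := fun x h h' => disjoint_left.1 hS h' h
  have hEd : ∀ e ∈ D.Ed, e ∉ D'.Ed := by
    intro e h h'
    obtain ⟨x, hx, hxe⟩ := g'.inc h'
    rcases g.ed e h with ⟨a, b, rfl, ha, hb, -⟩ | ⟨d, hdL, rfl⟩
    · rcases Sym2.mem_iff.1 hxe with rfl | rfl
      · exact hS' _ hx ha
      · exact hS' _ hx hb
    · rcases Sym2.mem_iff.1 hxe with rfl | rfl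
      · exact hS' _ hx (g.str d hdL).1
      · exact hd d hdL hx
  set U := D.un D' (D.L ++ D'.L) with hU
  have p1 : ∀ x ∈ D.S, U.pos x = D.pos x := fun x h => if_pos h
  have p2 : ∀ x ∈ D'.S, U.pos x = D'.pos x := fun x h => if_neg (hS' x h)
  have q1 : ∀ x ∈ D.S, U.dir x = D.dir x := fun x h => if_pos h
  have q2 : ∀ x ∈ D'.S, U.dir x = D'.dir x := fun x h => if_neg (hS' x h)
  have i1 : ∀ x ∈ D.Ed, U.img x = D.img x := fun x h => if_pos h
  have i2 : ∀ x ∈ D'.Ed, U.img x = D'.img x := fun x h => if_neg (fun h' => hEd x h' h)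
  have e1 : ∀ d ∈ D.L, U.E d = D.E d := fun x h => if_pos (g.str x h).1
  have e2 : ∀ d ∈ D'.L, U.E d = D'.E d := fun x h => if_neg (hS' _ (g'.str x h).1)
  have hUB : U.B = D.B ∪ D'.B := by
    ext z
    constructor
    · rintro (⟨x, hx | hx, rfl⟩ | ⟨e, he | he, hz⟩)
      · rw [p1 x hx]; exact Or.inl (Dr.pos_mem hx)
      · rw [p2 x hx]; exact Or.inr (Dr.pos_mem hx)
      · rw [i1 e he] at hz; exact Or.inl (Dr.img_mem he hz)
      · rw [i2 e he] at hz; exact Or.inr (Dr.img_mem he hz)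
    · rintro ((⟨x, hx, rfl⟩ | ⟨e, he, hz⟩) | (⟨x, hx, rfl⟩ | ⟨e, he, hz⟩))
      · exact Or.inl ⟨x, Or.inl hx, (p1 x hx).symm⟩
      · exact Or.inr ⟨e, Or.inl he, by rwa [i1 e he]⟩
      · exact Or.inl ⟨x, Or.inr hx, (p2 x hx).symm⟩
      · exact Or.inr ⟨e, Or.inr he, by rwa [i2 e he]⟩
  refine ⟨⟨?_, ?_, ?_, ?_, ?_, ?_, ?_, ?_, ?_⟩, hUB, fun x h => ⟨p1 x h, q1 x h⟩,
    fun x h => ⟨p2 x h, q2 x h⟩, e1, e2⟩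
  · rintro x (hx | hx) y (hy | hy) h
    · rw [p1 x hx, p1 y hy] at h; exact g.inj hx hy h
    · rw [p1 x hx, p2 y hy] at h
      exact absurd (h ▸ Dr.pos_mem hy) (disjoint_left.1 hB (Dr.pos_mem hx))
    · rw [p2 x hx, p1 y hy] at h
      exact absurd (h ▸ Dr.pos_mem hx) (disjoint_left.1 hB (Dr.pos_mem hy))
    · rw [p2 x hx, p2 y hy] at h; exact g'.inj hx hy h
  · rintro x (hx | hx)
    · rw [q1 x hx]; exact g.res x hx
    · rw [q2 x hx]; exact g'.res x hx
  · rintro e (he | he)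
    · rw [i1 e he]
      rcases g.ed e he with ⟨x, y, rfl, hx, hy, h⟩ | ⟨d, hd, h⟩
      · left
        refine ⟨x, y, rfl, Or.inl hx, Or.inl hy, ?_⟩
        rwa [p1 x hx, p1 y hy, q1 x hx, q1 y hy]
      · right; exact ⟨d, List.mem_append_left _ hd, h⟩
    · rw [i2 e he]
      rcases g'.ed e he with ⟨x, y, rfl, hx, hy, h⟩ | ⟨d, hd, h⟩
      · left
        refine ⟨x, y, rfl, Or.inr hx, Or.inr hy, ?_⟩
        rwa [p2 x hx, p2 y hy, q2 x hx, q2 y hy]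
      · right; exact ⟨d, List.mem_append_right _ hd, h⟩
  · intro d h
    rcases List.mem_append.1 h with h | h
    · obtain ⟨h1, h2, h3, h4⟩ := g.str d h
      refine ⟨Or.inl h1, ?_, Or.inl h3, ?_⟩
      · rintro (h' | h')
        · exact h2 h'
        · exact hd d h h'
      · rwa [p1 _ h1, q1 _ h1, e1 d h, i1 _ h3]
    · obtain ⟨h1, h2, h3, h4⟩ := g'.str d h
      refine ⟨Or.inr h1, ?_, Or.inr h3, ?_⟩
      · rintro (h' | h')
        · exact hd' d h h'
        · exact h2 h'
      · rwa [p2 _ h1, q2 _ h1, e2 d h, i2 _ h3]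
  · rintro e (he | he) f (hf | hf) hef z hz hz'
    · rw [i1 e he] at hz; rw [i1 f hf] at hz'
      obtain ⟨w, h1, h2, h3, h4⟩ := g.nc e he f hf hef z hz hz'
      exact ⟨w, Or.inl h1, h2, h3, by rwa [p1 w h1]⟩
    · rw [i1 e he] at hz; rw [i2 f hf] at hz'
      exact absurd (Dr.img_mem hf hz') (disjoint_left.1 hB (Dr.img_mem he hz))
    · rw [i2 e he] at hz; rw [i1 f hf] at hz'
      exact absurd (Dr.img_mem he hz) (disjoint_left.1 hB (Dr.img_mem hf hz'))
    · rw [i2 e he] at hz; rw [i2 f hf] at hz'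
      obtain ⟨w, h1, h2, h3, h4⟩ := g'.nc e he f hf hef z hz hz'
      exact ⟨w, Or.inr h1, h2, h3, by rwa [p2 w h1]⟩
  · rintro e (he | he) w (hw | hw) h
    · rw [i1 e he, p1 w hw] at h; exact g.vf e he w hw h
    · rw [i1 e he, p2 w hw] at h
      exact absurd (Dr.pos_mem hw) (disjoint_left.1 hB (Dr.img_mem he h))
    · rw [i2 e he, p1 w hw] at h
      exact absurd (Dr.img_mem he h) (disjoint_left.1 hB (Dr.pos_mem hw))
    · rw [i2 e he, p2 w hw] at h; exact g'.vf e he w hw h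
  · show (D.L ++ D'.L).Pairwise _
    refine List.pairwise_append.2 ⟨g.srt.imp_of_mem ?_, g'.srt.imp_of_mem ?_, ?_⟩
    · intro a b ha hb h; rwa [e1 a ha, e1 b hb]
    · intro a b ha hb h; rwa [e2 a ha, e2 b hb]
    · intro a ha b hb; rw [e1 a ha, e2 b hb]; exact hs a ha b hb
  · intro d h z hz
    rw [hUB] at hz
    rcases List.mem_append.1 h with h | h
    · rw [e1 d h]
      rcases hz with hz | hz
      · exact g.ray d h z hz
      · exact hray d h z hz
    · rw [e2 d h]
      rcases hz with hz | hz
      · exact hray' d h z hz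
      · exact g'.ray d h z hz
  · rw [hUB]; exact g.bdd.union g'.bdd

end prim

/-! ## Concrete curves -/

lemma q3_sq : √3 * √3 = (3 : ℝ) := Real.mul_self_sqrt (by norm_num)
lemma q3_pos : 0 < √(3 : ℝ) := by positivity
lemma q3_lo : 1.7 < √(3 : ℝ) := by
  rw [Real.lt_sqrt (by norm_num)]; norm_num
lemma q3_hi : √(3 : ℝ) < 1.8 := by
  rw [Real.sqrt_lt' (by norm_num)]; norm_num

lemma cos_two_third : Real.cos (2 * Real.pi / 3) = -(1 / 2) := by
  rw [show 2 * Real.pi / 3 = Real.pi - Real.pi / 3 by ring, Real.cos_pi_sub, Real.cos_pi_div_three]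
lemma sin_two_third : Real.sin (2 * Real.pi / 3) = √3 / 2 := by
  rw [show 2 * Real.pi / 3 = Real.pi - Real.pi / 3 by ring, Real.sin_pi_sub, Real.sin_pi_div_three]
lemma cos_three_half : Real.cos (3 * Real.pi / 2) = 0 := by
  rw [show 3 * Real.pi / 2 = Real.pi / 2 + Real.pi by ring, Real.cos_add_pi]; simp
lemma sin_three_half : Real.sin (3 * Real.pi / 2) = -1 := by
  rw [show 3 * Real.pi / 2 = Real.pi / 2 + Real.pi by ring, Real.sin_add_pi]; simp
lemma cos_five_third : Real.cos (5 * Real.pi / 3) = 1 / 2 := by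
  rw [show 5 * Real.pi / 3 = 2 * Real.pi - Real.pi / 3 by ring, Real.cos_two_pi_sub, Real.cos_pi_div_three]
lemma sin_five_third : Real.sin (5 * Real.pi / 3) = -(√3 / 2) := by
  rw [show 5 * Real.pi / 3 = 2 * Real.pi - Real.pi / 3 by ring, Real.sin_two_pi_sub, Real.sin_pi_div_three]
lemma cos_five_sixth : Real.cos (5 * Real.pi / 6) = -(√3 / 2) := by
  rw [show 5 * Real.pi / 6 = Real.pi - Real.pi / 6 by ring, Real.cos_pi_sub, Real.cos_pi_div_six]
lemma sin_five_sixth : Real.sin (5 * Real.pi / 6) = 1 / 2 := by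
  rw [show 5 * Real.pi / 6 = Real.pi - Real.pi / 6 by ring, Real.sin_pi_sub, Real.sin_pi_div_six]

lemma trig_le_two_third {φ : ℝ} (h0 : 0 ≤ φ) (h1 : φ ≤ 2 * Real.pi / 3) :
    -(1 / 2) ≤ Real.cos φ ∧ 0 ≤ Real.sin φ := by
  have hpi := Real.pi_pos
  constructor
  · rw [← cos_two_third]
    exact Real.cos_le_cos_of_nonneg_of_le_pi h0 (by linarith) h1
  · exact Real.sin_nonneg_of_nonneg_of_le_pi h0 (by linarith)

lemma trig_mid {φ : ℝ} (h0 : Real.pi / 3 ≤ φ) (h1 : φ ≤ 2 * Real.pi / 3) :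
    -(1 / 2) ≤ Real.cos φ ∧ Real.cos φ ≤ 1 / 2 ∧ √3 / 2 ≤ Real.sin φ := by
  have hpi := Real.pi_pos
  have ha := trig_le_two_third (by linarith) h1
  have hb : Real.cos φ ≤ 1 / 2 := by
    rw [← Real.cos_pi_div_three]
    exact Real.cos_le_cos_of_nonneg_of_le_pi (by linarith) (by linarith) h0
  refine ⟨ha.1, hb, ?_⟩
  have h := Real.sin_sq_add_cos_sq φ
  have := q3_sq
  have := q3_pos
  by_contra hc
  push Not at hc
  nlinarith [ha.1, ha.2]

lemma trig_last {φ : ℝ} (h0 : 5 * Real.pi / 3 ≤ φ) (h1 : φ ≤ 2 * Real.pi) :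
    1 / 2 ≤ Real.cos φ ∧ -(√3 / 2) ≤ Real.sin φ ∧ Real.sin φ ≤ 0 := by
  have hpi := Real.pi_pos
  have e : Real.cos φ = Real.cos (2 * Real.pi - φ) := (Real.cos_two_pi_sub φ).symm
  have e' : Real.sin (2 * Real.pi - φ) = - Real.sin φ := Real.sin_two_pi_sub φ
  have h2 : 0 ≤ Real.sin (2 * Real.pi - φ) :=
    Real.sin_nonneg_of_nonneg_of_le_pi (by linarith) (by linarith)
  have h3 : 1 / 2 ≤ Real.cos φ := by
    rw [← Real.cos_pi_div_three, e]
    exact Real.cos_le_cos_of_nonneg_of_le_pi (by linarith) (by linarith) (by linarith)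
  refine ⟨h3, ?_, by linarith⟩
  have h := Real.sin_sq_add_cos_sq φ
  have := q3_sq
  have := q3_pos
  by_contra hc
  push Not at hc
  nlinarith

/-- main curve: 30° out of `v`, arriving at `p` with leg 150°. -/
lemma over_EC (v : ℂ) {G : ℝ} (hG : 0 < G) : ∃ C : Set ℂ,
    EC v ⟨v.re + G, v.im + G * √3 / 6⟩ (Real.pi / 6) (5 * Real.pi / 6) C ∧
    ∀ z ∈ C, z = v ∨ (v.re < z.re ∧ z.re ≤ v.re + G ∧ v.im < z.im ∧
      (z.re = v.re + G → z = ⟨v.re + G, v.im + G * √3 / 6⟩) ∧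
      (z.im - v.im) + (z.re - v.re) ≤ G + G * √3 / 6 ∧
      (v.re + G / 2 < z.re → v.im + G * √3 / 6 ≤ z.im)) := by
  have hpi := Real.pi_pos
  have h3 := q3_pos
  have hsq := q3_sq
  have hlo := q3_lo
  have hhi := q3_hi
  refine ⟨segArcSet v (Real.pi / 6) (G * √3 / 3) (G / 2) (Real.pi / 3), ?_, ?_⟩
  · have h := segArc_EC v (Real.pi / 6) (ℓ := G * √3 / 3) (R := G / 2) (τ := Real.pi / 3)
      (by positivity) (by positivity) (by positivity) (by linarith)
    rw [show Real.pi / 6 + Real.pi / 2 - Real.pi / 3 = Real.pi / 3 by ring,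
      show Real.pi / 6 - Real.pi / 3 + Real.pi = 5 * Real.pi / 6 by ring, Real.cos_pi_div_six,
      Real.sin_pi_div_six, Real.cos_pi_div_three, Real.sin_pi_div_three] at h
    convert h using 2
    · linear_combination (-G / 6) * hsq
    · ring
  · rintro z (⟨s, hs0, hs1, e1, e2⟩ | ⟨φ, hφ0, hφ1, e1, e2⟩)
    · rw [Real.cos_pi_div_six] at e1
      rw [Real.sin_pi_div_six] at e2
      rcases hs0.eq_or_lt with rfl | hs0
      · left; apply Complex.ext <;> simp [e1, e2]
      · right
        have hx : s * (√3 / 2) ≤ G / 2 := by nlinarith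
        have hx0 : 0 < s * (√3 / 2) := by positivity
        refine ⟨by linarith, by linarith, by linarith, fun h => by linarith, ?_, fun h => ?_⟩
        · have : 0 ≤ G * √3 := by positivity
          nlinarith
        · linarith
    · right
      rw [show Real.pi / 6 + Real.pi / 2 - Real.pi / 3 = Real.pi / 3 by ring] at hφ0
      rw [show Real.pi / 6 + Real.pi / 2 = 2 * Real.pi / 3 by ring] at hφ1
      obtain ⟨c1, c2, c3⟩ := trig_mid hφ0 hφ1
      have hcs := Real.sin_sq_add_cos_sq φ
      rw [Real.cos_pi_div_six, Real.sin_pi_div_six] at e1 e2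
      have e1' : z.re = v.re + G * (3 / 4 + Real.cos φ / 2) := by
        rw [e1]; linear_combination (G / 6) * hsq
      have e2' : z.im = v.im + G * (- √3 / 12 + Real.sin φ / 2) := by rw [e2]; ring
      refine ⟨by rw [e1']; nlinarith, by rw [e1']; nlinarith, by rw [e2']; nlinarith, fun h => ?_, ?_,
        fun h => ?_⟩
      · have hc : Real.cos φ = 1 / 2 := by
          have : G * (3 / 4 + Real.cos φ / 2) = G * 1 := by linarith
          have := mul_left_cancel₀ hG.ne' this
          linarith
        have hs : Real.sin φ = √3 / 2 := by
          have : (Real.sin φ - √3 / 2) * (Real.sin φ + √3 / 2) = 0 := by nlinarith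
          rcases mul_eq_zero.1 this with h | h <;> nlinarith
        apply Complex.ext
        · exact h
        · simp only [e2', hs]; ring
      · have key : Real.sin φ - √3 / 2 ≤ 1 / 2 - Real.cos φ := by
          have : (Real.sin φ - √3 / 2) * (Real.sin φ + √3 / 2) = (1 / 2 - Real.cos φ) * (1 / 2 + Real.cos φ) := by
            nlinarith
          by_contra hc
          push Not at hc
          nlinarith
        have : G * (Real.sin φ - √3 / 2) ≤ G * (1 / 2 - Real.cos φ) := mul_le_mul_of_nonneg_left key hG.le
        linarith
      · rw [e2']; nlinarith

/-- 30° out of `v`, arriving from above at `p` (leg 90°). -/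
lemma down_EC (v : ℂ) {G : ℝ} (hG : 0 < G) : ∃ C : Set ℂ,
    EC v ⟨v.re + G, v.im + G * √3 / 6⟩ (Real.pi / 6) (Real.pi / 2) C ∧
    ∀ z ∈ C, z = v ∨ (v.re < z.re ∧ z.re ≤ v.re + G ∧ v.im < z.im ∧
      (z.re = v.re + G → z = ⟨v.re + G, v.im + G * √3 / 6⟩) ∧
      (v.re + G / 2 < z.re → v.im + G * √3 / 6 ≤ z.im)) := by
  have hpi := Real.pi_pos
  have h3 := q3_pos
  have hsq := q3_sq
  have hlo := q3_lo
  have hhi := q3_hi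
  refine ⟨segArcSet v (Real.pi / 6) (G * √3 / 2) (G / 6) (2 * Real.pi / 3), ?_, ?_⟩
  · have h := segArc_EC v (Real.pi / 6) (ℓ := G * √3 / 2) (R := G / 6) (τ := 2 * Real.pi / 3)
      (by positivity) (by positivity) (by positivity) (by linarith)
    rw [show Real.pi / 6 + Real.pi / 2 - 2 * Real.pi / 3 = 0 by ring,
      show Real.pi / 6 - 2 * Real.pi / 3 + Real.pi = Real.pi / 2 by ring, Real.cos_pi_div_six,
      Real.sin_pi_div_six, Real.cos_zero, Real.sin_zero] at h
    convert h using 2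
    · linear_combination (-G / 4) * hsq
    · ring
  · rintro z (⟨s, hs0, hs1, e1, e2⟩ | ⟨φ, hφ0, hφ1, e1, e2⟩)
    · rw [Real.cos_pi_div_six] at e1
      rw [Real.sin_pi_div_six] at e2
      rcases hs0.eq_or_lt with rfl | hs0
      · left; apply Complex.ext <;> simp [e1, e2]
      · right
        have hx : s * (√3 / 2) ≤ 3 * G / 4 := by nlinarith
        have hx0 : 0 < s * (√3 / 2) := by positivity
        refine ⟨by linarith, by linarith, by linarith, fun h => by linarith, fun h => ?_⟩
        have h' : G / 2 < s * (√3 / 2) := by linarith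
        nlinarith
    · right
      rw [show Real.pi / 6 + Real.pi / 2 - 2 * Real.pi / 3 = 0 by ring] at hφ0
      rw [show Real.pi / 6 + Real.pi / 2 = 2 * Real.pi / 3 by ring] at hφ1
      obtain ⟨c1, c2⟩ := trig_le_two_third hφ0 hφ1
      have c3 := Real.cos_le_one φ
      have hcs := Real.sin_sq_add_cos_sq φ
      rw [Real.cos_pi_div_six, Real.sin_pi_div_six] at e1 e2
      have e1' : z.re = v.re + G * (5 / 6 + Real.cos φ / 6) := by
        rw [e1]; linear_combination (G / 4) * hsq
      have e2' : z.im = v.im + G * (√3 / 6 + Real.sin φ / 6) := by rw [e2]; ring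
      refine ⟨by rw [e1']; nlinarith, by rw [e1']; nlinarith, by rw [e2']; nlinarith, fun h => ?_,
        fun h => ?_⟩
      · have hc : Real.cos φ = 1 := by
          have : G * (5 / 6 + Real.cos φ / 6) = G * 1 := by linarith
          have := mul_left_cancel₀ hG.ne' this
          linarith
        have hs : Real.sin φ = 0 := by nlinarith
        apply Complex.ext
        · exact h
        · simp only [e2', hs]; ring
      · rw [e2']; nlinarith

/-- 30° out of `v`, then straight up to `p` (leg 270°). -/
lemma high_EC (v : ℂ) {ρ ℓ : ℝ} (hρ : 0 < ρ) (hl : 0 < ℓ) : ∃ C : Set ℂ,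
    EC v ⟨v.re + ρ / 2, v.im + ρ * √3 / 2 + ℓ⟩ (Real.pi / 6) (3 * Real.pi / 2) C ∧
    ∀ z ∈ C, z = v ∨ (v.re < z.re ∧ z.re ≤ v.re + ρ / 2 ∧ v.im < z.im ∧
      z.im ≤ v.im + ρ * √3 / 2 + ℓ ∧
      (z.re < v.re + ρ / 2 → z.im ≤ v.im + ρ * √3 / 2)) := by
  have hpi := Real.pi_pos
  have h3 := q3_pos
  have hsq := q3_sq
  set p : ℂ := ⟨v.re + ρ / 2, v.im + ρ * √3 / 2 + ℓ⟩ with hp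
  refine ⟨segArcSet p (3 * Real.pi / 2) ℓ ρ (Real.pi / 3), ?_, ?_⟩
  · have h := segArc_EC p (3 * Real.pi / 2) (ℓ := ℓ) (R := ρ) (τ := Real.pi / 3)
      hl hρ (by positivity) (by linarith)
    rw [show 3 * Real.pi / 2 + Real.pi / 2 - Real.pi / 3 = 5 * Real.pi / 3 by ring,
      show 3 * Real.pi / 2 - Real.pi / 3 + Real.pi = Real.pi / 6 + 2 * Real.pi by ring, cos_three_half,
      sin_three_half, cos_five_third, sin_five_third] at h
    have h2 := (h.turnR rfl).symm
    convert h2 using 1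
    apply Complex.ext <;> simp [hp] <;> ring
  · rintro z (⟨s, hs0, hs1, e1, e2⟩ | ⟨φ, hφ0, hφ1, e1, e2⟩)
    · rw [cos_three_half] at e1
      rw [sin_three_half] at e2
      right
      simp only [hp] at e1 e2
      have : 0 < ρ * √3 / 2 := by positivity
      exact ⟨by linarith, by linarith, by linarith, by linarith, fun h => by linarith⟩
    · rw [show 3 * Real.pi / 2 + Real.pi / 2 - Real.pi / 3 = 5 * Real.pi / 3 by ring] at hφ0
      rw [show 3 * Real.pi / 2 + Real.pi / 2 = 2 * Real.pi by ring] at hφ1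
      obtain ⟨c1, c2, c3⟩ := trig_last hφ0 hφ1
      have c4 := Real.cos_le_one φ
      have hcs := Real.sin_sq_add_cos_sq φ
      rw [cos_three_half, sin_three_half] at e1 e2
      simp only [hp] at e1 e2
      have e1' : z.re = v.re + ρ * (Real.cos φ - 1 / 2) := by rw [e1]; ring
      have e2' : z.im = v.im + ρ * (√3 / 2 + Real.sin φ) := by rw [e2]; ring
      rcases c1.eq_or_lt with hc | hc
      · left
        have hs : Real.sin φ = -(√3 / 2) := by
          have : (Real.sin φ - √3 / 2) * (Real.sin φ + √3 / 2) = 0 := by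
            rw [← hc] at hcs; nlinarith
          rcases mul_eq_zero.1 this with h | h <;> nlinarith
        apply Complex.ext
        · rw [e1', ← hc]; ring
        · rw [e2', hs]; ring
      · right
        have hs : -(√3 / 2) < Real.sin φ := by nlinarith
        refine ⟨by rw [e1']; nlinarith, by rw [e1']; nlinarith, by rw [e2']; nlinarith,
          by rw [e2']; nlinarith, fun _ => by rw [e2']; nlinarith⟩

/-- straight edge -/
lemma pass_EC (v : ℂ) {ℓ : ℝ} (hl : 0 < ℓ) : ∃ C : Set ℂ,
    EC v ⟨v.re + ℓ * √3, v.im + ℓ⟩ (Real.pi / 6) (7 * Real.pi / 6) C ∧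
    ∀ z ∈ C, z = v ∨ (v.re < z.re ∧ z.re ≤ v.re + ℓ * √3 ∧ v.im < z.im ∧ z.im ≤ v.im + ℓ) := by
  have h := seg_EC v (Real.pi / 6) (ℓ := 2 * ℓ) (by positivity)
  have h3 := q3_pos
  rw [Real.cos_pi_div_six, Real.sin_pi_div_six,
      show Real.pi / 6 + Real.pi = 7 * Real.pi / 6 by ring] at h
  refine ⟨{z | ∃ s, 0 ≤ s ∧ s ≤ 2 * ℓ ∧ z.re = v.re + s * (√3 / 2) ∧ z.im = v.im + s * (1 / 2)}, ?_, ?_⟩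
  · convert h using 2 <;> ring
  · rintro z ⟨s, hs0, hs1, e1, e2⟩
    rcases hs0.eq_or_lt with rfl | hs0
    · left; apply Complex.ext <;> simp [e1, e2]
    · right
      have : 0 < s * (√3 / 2) := by positivity
      refine ⟨by linarith, by nlinarith, by linarith, by nlinarith⟩

/-- arc of a strand -/
def sArc (p : ℂ) (ψ R : ℝ) : Set ℂ :=
  {z | ∃ φ, ψ ≤ φ ∧ φ ≤ 2 * Real.pi ∧ z.re = p.re - R * Real.cos ψ + R * Real.cos φ ∧
    z.im = p.im - R * Real.sin ψ + R * Real.sin φ}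

lemma sArc_strand (p : ℂ) {ψ R : ℝ} (h0 : 0 < ψ) (h1 : ψ < 2 * Real.pi) (hR : 0 < R) :
    Strand p ⟨p.re - R * Real.cos ψ + R, p.im - R * Real.sin ψ⟩ (ψ + Real.pi / 2) (sArc p ψ R) := by
  refine ⟨⟨2 * Real.pi, h1.le, le_rfl, by simp, by simp⟩, fun h hh => ?_⟩
  have hE := segArc_EC ⟨p.re - R * Real.cos ψ + R, p.im - R * Real.sin ψ + h⟩ (3 * Real.pi / 2)
    (ℓ := h) (R := R) (τ := 2 * Real.pi - ψ) hh hR (by linarith) (by linarith)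
  rw [show 3 * Real.pi / 2 + Real.pi / 2 - (2 * Real.pi - ψ) = ψ by ring,
    show 3 * Real.pi / 2 - (2 * Real.pi - ψ) + Real.pi = ψ + Real.pi / 2 by ring] at hE
  convert hE.symm using 1
  · apply Complex.ext <;> simp [cos_three_half, sin_three_half]
  · ext z
    simp only [sArc, vert, segArcSet, mem_union, Set.mem_ofPred_eq, cos_three_half, sin_three_half,
      show 3 * Real.pi / 2 + Real.pi / 2 = 2 * Real.pi by ring]
    constructor
    · rintro (⟨φ, a, b, c, d⟩ | ⟨a, b, c⟩)
      · right; exact ⟨φ, by linarith, b, by rw [c]; ring, by rw [d]; ring⟩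
      · left; exact ⟨p.im - R * Real.sin ψ + h - z.im, by linarith, by linarith, by rw [a]; ring, by ring⟩
    · rintro (⟨s, a, b, c, d⟩ | ⟨φ, a, b, c, d⟩)
      · right; exact ⟨by rw [c]; ring, by rw [d]; linarith, by rw [d]; linarith⟩
      · left; exact ⟨φ, by linarith, b, by rw [c]; ring, by rw [d]; ring⟩

lemma sArc_right {p : ℂ} {ψ R : ℝ} (hR : 0 < R) {z : ℂ} (hz : z ∈ sArc p ψ R) :
    z.re ≤ p.re - R * Real.cos ψ + R ∧
    (z.re = p.re - R * Real.cos ψ + R → z.im ≤ p.im - R * Real.sin ψ) := by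
  obtain ⟨φ, a, b, c, d⟩ := hz
  refine ⟨by nlinarith [Real.cos_le_one φ], fun h => ?_⟩
  have hc : Real.cos φ = 1 := by
    have : R * Real.cos φ = R * 1 := by linarith
    exact mul_left_cancel₀ hR.ne' this
  have hs : Real.sin φ = 0 := by
    have := Real.sin_sq_add_cos_sq φ
    rw [hc] at this; nlinarith
  rw [d, hs]; linarith

lemma Strand.turn {a E : ℂ} {α α' : ℝ} {C : Set ℂ} (h : Strand a E α C) (hb : α = α' + 2 * Real.pi) :
    Strand a E α' C := ⟨h.1, fun t ht => (h.2 t ht).turnL hb⟩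

/-- inner strand, leaving downwards -/
lemma inner_S (p : ℂ) {R : ℝ} (hR : 0 < R) : ∃ C : Set ℂ,
    Strand p ⟨p.re + 2 * R, p.im⟩ (3 * Real.pi / 2) C ∧
    ∀ z ∈ C, z = p ∨ (p.re < z.re ∧ z.re ≤ p.re + 2 * R ∧ p.im - R ≤ z.im ∧ z.im ≤ p.im) := by
  have hpi := Real.pi_pos
  refine ⟨sArc p Real.pi R, ?_, ?_⟩
  · have := sArc_strand p (ψ := Real.pi) (R := R) hpi (by linarith) hR
    rw [Real.cos_pi, Real.sin_pi, show Real.pi + Real.pi / 2 = 3 * Real.pi / 2 by ring] at this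
    convert this using 2 <;> ring
  · rintro z ⟨φ, a, b, c, d⟩
    rw [Real.cos_pi] at c
    rw [Real.sin_pi] at d
    have hcs := Real.sin_sq_add_cos_sq φ
    have hs : Real.sin φ ≤ 0 := by
      have := Real.sin_nonneg_of_nonneg_of_le_pi (x := 2 * Real.pi - φ) (by linarith) (by linarith)
      rw [Real.sin_two_pi_sub] at this; linarith
    have := Real.neg_one_le_sin φ
    have := Real.cos_le_one φ
    rcases (Real.neg_one_le_cos φ).eq_or_lt with h | h
    · left
      have hs : Real.sin φ = 0 := by rw [← h] at hcs; nlinarith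
      apply Complex.ext
      · rw [c, ← h]; ring
      · rw [d, hs]; ring
    · right
      exact ⟨by rw [c]; nlinarith, by rw [c]; nlinarith, by rw [d]; nlinarith, by rw [d]; nlinarith⟩

/-- strand leaving in direction 210° -/
lemma leafone_S (p : ℂ) : ∃ (C : Set ℂ) (E : ℂ),
    Strand p E (7 * Real.pi / 6) C ∧ p.re < E.re ∧ E.im ≤ p.im ∧
    ∀ z ∈ C, z.im ≤ p.im ∧ (z.re = E.re → z.im ≤ E.im) := by
  have hpi := Real.pi_pos
  have h3 := q3_pos
  refine ⟨sArc p (2 * Real.pi / 3) 1, ⟨p.re - 1 * Real.cos (2 * Real.pi / 3) + 1,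
    p.im - 1 * Real.sin (2 * Real.pi / 3)⟩, ?_, ?_, ?_, ?_⟩
  · have := sArc_strand p (ψ := 2 * Real.pi / 3) (R := 1) (by positivity) (by linarith) one_pos
    rw [show 2 * Real.pi / 3 + Real.pi / 2 = 7 * Real.pi / 6 by ring] at this
    exact this
  · simp only [cos_two_third]; linarith
  · simp only [sin_two_third]; linarith
  · intro z hz
    refine ⟨?_, (sArc_right one_pos hz).2⟩
    obtain ⟨φ, a, b, c, d⟩ := hz
    rw [d, sin_two_third]
    have hsq := q3_sq
    rcases le_total φ Real.pi with h | h
    · have h1 : Real.cos φ ≤ -(1 / 2) := by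
        rw [← cos_two_third]
        exact Real.cos_le_cos_of_nonneg_of_le_pi (by linarith) h a
      have hcs := Real.sin_sq_add_cos_sq φ
      have : Real.sin φ ≤ √3 / 2 := by
        by_contra hc
        push Not at hc
        nlinarith
      linarith
    · have := Real.sin_nonneg_of_nonneg_of_le_pi (x := 2 * Real.pi - φ) (by linarith) (by linarith)
      rw [Real.sin_two_pi_sub] at this
      linarith

/-- outer strand, leaving in direction 150° -/
lemma outer_S (p : ℂ) {R : ℝ} (hR : 0 < R) : ∃ (C : Set ℂ),
    Strand p ⟨p.re + R / 2, p.im - R * √3 / 2⟩ (5 * Real.pi / 6) C ∧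
    ∀ z ∈ C, z = p ∨ ((p.re ≤ z.re → z.im ≤ p.im - R * √3 / 2) ∧
      (p.re - z.re) ^ 2 + (z.im - p.im) ^ 2 = R * ((p.re - z.re) - √3 * (z.im - p.im)) ∧
      (z.re = p.re + R / 2 → z.im ≤ p.im - R * √3 / 2)) := by
  have hpi := Real.pi_pos
  have h3 := q3_pos
  have hsq := q3_sq
  refine ⟨sArc p (Real.pi / 3) R, ?_, ?_⟩
  · have := sArc_strand p (ψ := Real.pi / 3) (R := R) (by positivity) (by linarith) hR
    rw [Real.cos_pi_div_three, Real.sin_pi_div_three,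
      show Real.pi / 3 + Real.pi / 2 = 5 * Real.pi / 6 by ring] at this
    convert this using 2 <;> ring
  · intro z hz
    have hr := (sArc_right hR hz).2
    rw [Real.cos_pi_div_three, Real.sin_pi_div_three] at hr
    obtain ⟨φ, a, b, c, d⟩ := hz
    rw [Real.cos_pi_div_three] at c
    rw [Real.sin_pi_div_three] at d
    have hcs := Real.sin_sq_add_cos_sq φ
    by_cases hz : z = p
    · exact Or.inl hz
    · right
      refine ⟨fun h => ?_, ?_, fun h => ?_⟩
      · have hc : 1 / 2 ≤ Real.cos φ := by
          by_contra hc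
          push Not at hc
          nlinarith
        rcases le_total φ Real.pi with hφ | hφ
        · exfalso
          have h1 : Real.cos φ ≤ 1 / 2 := by
            rw [← Real.cos_pi_div_three]
            exact Real.cos_le_cos_of_nonneg_of_le_pi (by linarith) hφ a
          have h2 := Real.sin_nonneg_of_nonneg_of_le_pi (x := φ) (by linarith) (by linarith)
          have hc' : Real.cos φ = 1 / 2 := le_antisymm h1 hc
          have hs : Real.sin φ = √3 / 2 := by
            have : (Real.sin φ - √3 / 2) * (Real.sin φ + √3 / 2) = 0 := by
              rw [hc'] at hcs; nlinarith
            rcases mul_eq_zero.1 this with h | h <;> nlinarith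
          apply hz
          apply Complex.ext
          · rw [c, hc']; ring
          · rw [d, hs]; ring
        · have := Real.sin_nonneg_of_nonneg_of_le_pi (x := 2 * Real.pi - φ) (by linarith) (by linarith)
          rw [Real.sin_two_pi_sub] at this
          rw [d]; nlinarith
      · rw [c, d]
        linear_combination R ^ 2 * hcs + (-R ^ 2 / 4) * hsq
      · have := hr (by rw [h]; ring)
        linarith

/-- small strand leaving in direction 30° -/
lemma light_S (p : ℂ) {R : ℝ} (hR : 0 < R) : ∃ C : Set ℂ,
    Strand p ⟨p.re + R / 2, p.im + R * √3 / 2⟩ (Real.pi / 6) C ∧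
    ∀ z ∈ C, z = p ∨ (p.re < z.re ∧ z.re ≤ p.re + R / 2 ∧ p.im < z.im ∧ z.im ≤ p.im + R * √3 / 2) := by
  have hpi := Real.pi_pos
  have h3 := q3_pos
  have hsq := q3_sq
  refine ⟨sArc p (5 * Real.pi / 3) R, ?_, ?_⟩
  · have := (sArc_strand p (ψ := 5 * Real.pi / 3) (R := R) (by positivity) (by linarith) hR).turn
      (α' := Real.pi / 6) (by ring)
    rw [cos_five_third, sin_five_third] at this
    convert this using 2 <;> ring
  · rintro z ⟨φ, a, b, c, d⟩
    obtain ⟨c1, c2, c3⟩ := trig_last a b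
    have hcs := Real.sin_sq_add_cos_sq φ
    have c4 := Real.cos_le_one φ
    rw [cos_five_third] at c
    rw [sin_five_third] at d
    rcases c1.eq_or_lt with hc | hc
    · left
      have hs : Real.sin φ = -(√3 / 2) := by
        have : (Real.sin φ - √3 / 2) * (Real.sin φ + √3 / 2) = 0 := by
          rw [← hc] at hcs; nlinarith
        rcases mul_eq_zero.1 this with h | h <;> nlinarith
      apply Complex.ext
      · rw [c, ← hc]; ring
      · rw [d, hs]; ring
    · right
      have hs : -(√3 / 2) < Real.sin φ := by nlinarith
      exact ⟨by rw [c]; nlinarith, by rw [c]; nlinarith, by rw [d]; nlinarith, by rw [d]; nlinarith⟩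

/-- closing edge: 150° out of `a`, then around to `⟨a.re - ℓ√3 + R, a.im + ℓ⟩`, leg 30°. -/
lemma close_EC (a : ℂ) {ℓ R : ℝ} (hl : 0 < ℓ) (hR : 0 < R) : ∃ C : Set ℂ,
    EC a ⟨a.re - ℓ * √3 + R, a.im + ℓ⟩ (5 * Real.pi / 6) (Real.pi / 6) C ∧
    ∀ z ∈ C, z = a ∨ (a.im < z.im ∧ z.im ≤ a.im + ℓ ∧ z.re < a.re ∧ z.re - a.re = - √3 * (z.im - a.im)) ∨
      (a.im + ℓ ≤ z.im ∧ (z.re - (a.re - ℓ * √3 + R / 2)) ^ 2 + (z.im - (a.im + ℓ + R * √3 / 2)) ^ 2 = R ^ 2) := by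
  have hpi := Real.pi_pos
  have h3 := q3_pos
  have hsq := q3_sq
  refine ⟨segArcSet a (5 * Real.pi / 6) (2 * ℓ) R (5 * Real.pi / 3), ?_, ?_⟩
  · have h := segArc_EC a (5 * Real.pi / 6) (ℓ := 2 * ℓ) (R := R) (τ := 5 * Real.pi / 3)
      (by positivity) (by positivity) (by positivity) (by linarith)
    rw [show 5 * Real.pi / 6 + Real.pi / 2 - 5 * Real.pi / 3 = -(Real.pi / 3) by ring,
      show 5 * Real.pi / 6 - 5 * Real.pi / 3 + Real.pi = Real.pi / 6 by ring, cos_five_sixth,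
      sin_five_sixth, Real.cos_neg, Real.sin_neg, Real.cos_pi_div_three, Real.sin_pi_div_three] at h
    convert h using 2 <;> ring
  · rintro z (⟨s, hs0, hs1, e1, e2⟩ | ⟨φ, hφ0, hφ1, e1, e2⟩)
    · rw [cos_five_sixth] at e1
      rw [sin_five_sixth] at e2
      rcases hs0.eq_or_lt with rfl | hs0
      · left; apply Complex.ext <;> simp [e1, e2]
      · right; left
        have : 0 < s * (√3 / 2) := by positivity
        exact ⟨by linarith, by linarith, by linarith, by rw [e1, e2]; ring⟩
    · right; right
      rw [cos_five_sixth, sin_five_sixth] at e1 e2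
      have hcs := Real.sin_sq_add_cos_sq φ
      rw [show 5 * Real.pi / 6 + Real.pi / 2 - 5 * Real.pi / 3 = -(Real.pi / 3) by ring] at hφ0
      rw [show 5 * Real.pi / 6 + Real.pi / 2 = 4 * Real.pi / 3 by ring] at hφ1
      constructor
      · have hs : -(√3 / 2) ≤ Real.sin φ := by
          rcases le_total φ (Real.pi / 2) with h | h
          · rw [← Real.sin_pi_div_three, ← Real.sin_neg]
            exact Real.sin_le_sin_of_le_of_le_pi_div_two (by linarith) h hφ0
          · have h1 : Real.sin φ = Real.sin (Real.pi - φ) := (Real.sin_pi_sub φ).symm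
            rw [h1, ← Real.sin_pi_div_three, ← Real.sin_neg]
            exact Real.sin_le_sin_of_le_of_le_pi_div_two (by linarith) (by linarith) (by linarith)
        rw [e2]; nlinarith
      · rw [e1, e2]
        linear_combination R ^ 2 * hcs

section states
variable {V : Type*} {G : SimpleGraph V} {D D' : Dr V} {R : Set (V × V)}

/-- reserved darts: the leg `5π/6` at `d.1` is still free and visible from the left -/
def RS (D : Dr V) (v : V) (R : Set (V × V)) : Prop := ∀ d ∈ R,
  d.1 ∈ D.S ∧ D.dir d.1 d.2 = 5 * Real.pi / 6 ∧ s(d.1, d.2) ∉ D.Ed ∧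
  (∀ z ∈ D.B, z.im < (D.pos d.1).im ∨ (D.pos d.1).re ≤ z.re) ∧
  (D.pos d.1).re ≤ (D.pos v).re ∧ (D.pos d.1).im ≤ (D.pos v).im ∧
  (d.1 ≠ v → (D.pos d.1).im < (D.pos v).im)

/-- all edges but `s(v, u)` and the reserved ones are drawn -/
def CP (G : SimpleGraph V) (D : Dr V) (v u : V) (R : Set (V × V)) : Prop :=
  ∀ x ∈ D.S, ∀ y, G.Adj x y → s(x, y) ∈ D.Ed ∨ s(x, y) = s(v, u) ∨ ∃ d ∈ R, s(x, y) = s(d.1, d.2)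

/-- the cone above `a` -/
def InK (a z : ℂ) : Prop := a.im < z.im ∧ a.re + a.im < z.re + z.im

structure State (G : SimpleGraph V) (D : Dr V) (v u : V) (R : Set (V × V)) : Prop where
  good : Good G D
  hv : v ∈ D.S
  dir : D.dir v u = Real.pi / 6
  ne : s(v, u) ∉ D.Ed
  K : ∀ z ∈ D.B, ¬ InK (D.pos v) z
  str : ∀ d ∈ D.L, (D.pos v).re < (D.E d).re ∧ (D.E d).im ≤ (D.pos v).im
  comp : CP G D v u R
  rs : RS D v R

/-- `D'` extends `D` by the vertex `v` at `P`, the new edges `M` and new points in `N` -/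
structure DExt (D D' : Dr V) (v : V) (P : ℂ) (f : V → ℝ) (L : List (V × V)) (M : Set (Sym2 V))
    (N : Set ℂ) : Prop where
  S : D'.S = insert v D.S
  L : D'.L = L
  Ed : ∀ e, e ∈ D'.Ed ↔ e ∈ D.Ed ∨ e ∈ M
  E : ∀ d ∈ D.L, D'.E d = D.E d
  B : D'.B ⊆ D.B ∪ N
  pv : D'.pos v = P
  dv : D'.dir v = f
  po : ∀ x ∈ D.S, D'.pos x = D.pos x
  di : ∀ x ∈ D.S, D'.dir x = D.dir x

lemma RS.ext {a v : V} {P : ℂ} {f : V → ℝ} {L : List (V × V)} {M : Set (Sym2 V)} {N : Set ℂ}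
    (h : RS D a R) (hx : DExt D D' v P f L M N)
    (hM : ∀ d ∈ R, s(d.1, d.2) ∉ M)
    (hN : ∀ z ∈ N, (D.pos a).re ≤ z.re) (hP : (D.pos a).re ≤ P.re) (hP' : (D.pos a).im < P.im) :
    RS D' v R := by
  intro d hd
  obtain ⟨h1, h2, h3, h4, h5, h6, h7⟩ := h d hd
  rw [hx.S, hx.di _ h1, hx.po _ h1, hx.pv, hx.Ed]
  refine ⟨Or.inr h1, h2, by rintro (h | h); exact h3 h; exact hM d hd h, ?_, h5.trans hP, by linarith, fun _ => by linarith⟩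
  intro z hz
  rcases hx.B hz with hz | hz
  · exact h4 z hz
  · exact Or.inr (h5.trans (hN z hz))

lemma CP.ext {a v u : V} {P : ℂ} {f : V → ℝ} {L : List (V × V)} {M : Set (Sym2 V)} {N : Set ℂ}
    {R' : Set (V × V)} (h : CP G D a v R) (hx : DExt D D' v P f L M N) (ha : s(a, v) ∈ M)
    (hRR : R ⊆ R')
    (hadj : ∀ y, G.Adj v y → y = u ∨ s(v, y) ∈ D'.Ed ∨ ∃ d ∈ R', s(v, y) = s(d.1, d.2)) :
    CP G D' v u R' := by
  intro x hxS y hxy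
  rw [hx.S] at hxS
  rcases hxS with rfl | hxS
  · rcases hadj y hxy with rfl | h | h
    · exact Or.inr (Or.inl rfl)
    · exact Or.inl h
    · exact Or.inr (Or.inr h)
  · rcases h x hxS y hxy with h | h | ⟨d, hd, h⟩
    · exact Or.inl ((hx.Ed _).2 (Or.inl h))
    · exact Or.inl ((hx.Ed _).2 (Or.inr (h ▸ ha)))
    · exact Or.inr (Or.inr ⟨d, hRR hd, h⟩)

lemma exists_gap {α : Type*} (L : List α) (c : ℝ) (E : α → ℝ) (h : ∀ d ∈ L, c < E d) :
    ∃ g, 0 < g ∧ ∀ d ∈ L, c + g ≤ E d := by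
  induction L with
  | nil => exact ⟨1, one_pos, by simp⟩
  | cons x L ih =>
    obtain ⟨g, hg, h'⟩ := ih (fun d hd => h d (by simp [hd]))
    have hx := h x (by simp)
    refine ⟨min g (E x - c), lt_min hg (by linarith), ?_⟩
    intro d hd
    rcases List.mem_cons.1 hd with rfl | hd
    · linarith [min_le_right g (E d - c)]
    · linarith [min_le_left g (E x - c), h' d hd]

lemma Good.not_ed (g : Good G D) {v u : V} (hv : v ∉ D.S) (h : (u, v) ∉ D.L) : s(v, u) ∉ D.Ed := by
  intro he
  rcases g.ed _ he with ⟨x, y, e, hx, hy, -⟩ | ⟨d, hd, e⟩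
  · rcases Sym2.eq_iff.1 e with ⟨rfl, rfl⟩ | ⟨rfl, rfl⟩
    · exact hv hx
    · exact hv hy
  · rcases Sym2.eq_iff.1 e with ⟨rfl, rfl⟩ | ⟨rfl, rfl⟩
    · exact hv (g.str d hd).1
    · exact h hd

open Classical in
lemma res3 {v u a b : V} (hn : Nb G v [u, a, b]) : ∃ f : V → ℝ, Res G f v ∧ f u = Real.pi / 6 ∧
    f a = 5 * Real.pi / 6 ∧ f b = 3 * Real.pi / 2 := by
  have h := hn.1
  simp only [List.nodup_cons, List.mem_cons, List.not_mem_nil, or_false, not_or] at h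
  refine ⟨fun x => if x = u then Real.pi / 6 else if x = a then 5 * Real.pi / 6 else 3 * Real.pi / 2,
    Or.inr (Or.inr (Or.inr ⟨u, a, b, hn, ?_, ?_⟩)), ?_, ?_, ?_⟩
  · simp [Ne.symm h.1.1]; ring
  · simp [Ne.symm h.1.2, Ne.symm h.2.1]; ring
  · simp
  · simp [Ne.symm h.1.1]
  · simp [Ne.symm h.1.2, Ne.symm h.2.1]

open Classical in
lemma res2 {v u a : V} (hn : Nb G v [u, a]) (α : ℝ) : ∃ f : V → ℝ, Res G f v ∧ f u = α ∧
    f a = α + Real.pi := by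
  have h := hn.1
  simp only [List.nodup_cons, List.mem_cons, List.not_mem_nil, or_false] at h
  refine ⟨fun x => if x = u then α else α + Real.pi,
    Or.inr (Or.inr (Or.inl ⟨u, a, hn, ?_⟩)), ?_, ?_⟩
  · simp [Ne.symm h.1]
  · simp
  · simp [Ne.symm h.1]

/-- place `v` at `P` and join it to `a` -/
lemma core_add {a v : V} (g : Good G D) (ha : a ∈ D.S) (hdir : D.dir a v = Real.pi / 6)
    (hne : s(a, v) ∉ D.Ed) (hK : ∀ z ∈ D.B, ¬ InK (D.pos a) z) (hv : v ∉ D.S)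
    (hL : ∀ d ∈ D.L, d.2 ≠ v) {P : ℂ} {f : V → ℝ} {C : Set ℂ} (hf : Res G f v)
    (hEC : EC (D.pos a) P (Real.pi / 6) (f a) C)
    (hP : (D.pos a).re < P.re ∧ (D.pos a).im < P.im)
    (hC : ∀ z ∈ C, z = D.pos a ∨ ((D.pos a).re < z.re ∧ (D.pos a).im < z.im))
    (hstr : ∀ d ∈ D.L, (D.pos a).re < (D.E d).re)
    (hray : ∀ d ∈ D.L, ∀ z ∈ C, z = D.pos a ∨ z.re < (D.E d).re) :
    ∃ D', Good G D' ∧ DExt D D' v P f D.L {s(a, v)} C := by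
  have hPB : P ∉ D.B := fun h => hK P h ⟨hP.2, by linarith [hP.1, hP.2]⟩
  have hPC := hEC.right_mem
  have hr : ∀ d ∈ D.L, ∀ z ∈ C, z.re ≠ (D.E d).re := by
    intro d hd z hz
    rcases hray d hd z hz with rfl | h
    · exact (hstr d hd).ne
    · exact h.ne
  have g1 := g.addV hv hPB hf (fun d hd => ⟨hL d hd, fun h => absurd h (hr d hd P hPC)⟩)
  have e1 : (D.addV v P f).pos a = D.pos a := upd_S hv _ _ ha
  have e2 : (D.addV v P f).dir a = D.dir a := upd_S hv _ _ ha
  have e3 : (D.addV v P f).pos v = P := by simp [Dr.addV]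
  have e4 : (D.addV v P f).dir v = f := by simp [Dr.addV]
  have g2 := g1.addE (x := a) (y := v) (C := C) (Or.inr ha) (Or.inl rfl) hne
    (by rw [e1, e2, e3, e4, hdir]; exact hEC)
    (by
      intro z hz hzB
      rw [Dr.addV_B hv] at hzB
      rw [e1, e3]
      rcases hzB with h | h
      · exact Or.inr h
      · rcases hC z hz with h' | h'
        · exact Or.inl h'
        · exact absurd ⟨h'.2, by linarith [h'.1, h'.2]⟩ (hK z h))
    (fun d hd z hz h => absurd h (hr d hd z hz))
  refine ⟨_, g2, rfl, rfl, ?_, fun _ _ => rfl, ?_, e3, e4, fun x hx => upd_S hv _ _ hx,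
    fun x hx => upd_S hv _ _ hx⟩
  · intro e
    show e ∈ insert s(a, v) D.Ed ↔ _
    rw [mem_insert_iff, mem_singleton_iff, or_comm]
  · rw [Dr.addE_B (D := D.addV v P f) hne, Dr.addV_B hv]
    rintro z ((rfl | h) | h)
    · exact Or.inr hPC
    · exact Or.inl h
    · exact Or.inr h

end states

section ops
variable {V : Type*} {G : SimpleGraph V} {D D' : Dr V} {R : Set (V × V)}

lemma sav_ne {S : Set V} {a v u : V} (ha : a ∈ S) (hv : v ∉ S) (hua : u ≠ a) : s(v, u) ≠ s(a, v) := by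
  intro h
  rcases Sym2.eq_iff.1 h with ⟨h1, h2⟩ | ⟨h1, h2⟩
  · exact hv (h1 ▸ ha)
  · exact hua h2

lemma Dr.addS_E_self {d : V × V} {E : ℂ} {C : Set ℂ} {L : List (V × V)} : (D.addS d E C L).E d = E := by
  simp [Dr.addS]
lemma Dr.addS_E_ne {d d' : V × V} {E : ℂ} {C : Set ℂ} {L : List (V × V)} (h : d' ≠ d) :
    (D.addS d E C L).E d' = D.E d' := by simp [Dr.addS, h]

lemma opPass {a v u : V} (st : State G D a v R) (hv : v ∉ D.S) (hL : ∀ d ∈ D.L, d.2 ≠ v)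
    {f : V → ℝ} (hf : Res G f v) (hfu : f u = Real.pi / 6) (hfa : f a = 7 * Real.pi / 6)
    (hadj : ∀ y, G.Adj v y → y = u ∨ y = a) (hua : u ≠ a) (hu : s(v, u) ∉ D.Ed)
    (hR : ∀ d ∈ R, s(d.1, d.2) ≠ s(a, v)) :
    ∃ D', D'.S = insert v D.S ∧ D'.L = D.L ∧ State G D' v u R := by
  have h3 := q3_pos
  have h3l := q3_hi
  obtain ⟨g, hg, hgap⟩ := exists_gap D.L (D.pos a).re (fun d => (D.E d).re) (fun d hd => (st.str d hd).1)
  obtain ⟨C, hEC, hC⟩ := pass_EC (D.pos a) (ℓ := g / 2) (by linarith)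
  set A := D.pos a with hA
  have hlt : g / 2 * √3 < g := by nlinarith
  have hpos : 0 < g / 2 * √3 := by positivity
  have hr : ∀ d ∈ D.L, A.re + g / 2 * √3 < (D.E d).re := fun d hd => by linarith [hgap d hd]
  obtain ⟨D', g', hx⟩ := core_add st.good st.hv st.dir st.ne st.K hv hL hf (by rw [hfa]; exact hEC)
    ⟨by simp only; linarith, by simp only; linarith⟩
    (fun z hz => (hC z hz).imp id (fun h => ⟨h.1, h.2.2.1⟩)) (fun d hd => (st.str d hd).1)
    (fun d hd z hz => (hC z hz).imp id (fun h => by linarith [h.2.1, hr d hd]))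
  refine ⟨D', hx.S, hx.L, g', by rw [hx.S]; exact Or.inl rfl, by rw [hx.dv, hfu], ?_, ?_, ?_, ?_, ?_⟩
  · rw [hx.Ed]
    rintro (h | h)
    · exact hu h
    · exact sav_ne st.hv hv hua h
  · intro z hz ⟨k1, k2⟩
    rw [hx.pv] at k1 k2
    simp only at k1 k2
    rcases hx.B hz with hz | hz
    · exact st.K z hz ⟨by linarith, by linarith⟩
    · rcases hC z hz with rfl | h
      · linarith
      · linarith [h.2.2.2]
  · intro d hd
    rw [hx.L] at hd
    rw [hx.pv, hx.E d hd]
    have := st.str d hd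
    exact ⟨hr d hd, by simp only; linarith [this.2]⟩
  · refine st.comp.ext hx rfl subset_rfl fun y hy => ?_
    rcases hadj y hy with h | rfl
    · exact Or.inl h
    · exact Or.inr (Or.inl ((hx.Ed _).2 (Or.inr Sym2.eq_swap)))
  · refine st.rs.ext hx (fun d hd h => hR d hd h) (fun z hz => ?_) (by simp only; linarith) (by simp only; linarith)
    rcases hC z hz with rfl | h
    · exact le_rfl
    · exact h.1.le

lemma opHigh {a v u y : V} (st : State G D a v ∅) (hv : v ∉ D.S) (hL : ∀ d ∈ D.L, d.2 ≠ v)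
    (hn : Nb G v [u, y, a]) (hu : s(v, u) ∉ D.Ed) (hy : s(v, y) ∉ D.Ed) :
    ∃ D', D'.S = insert v D.S ∧ D'.L = D.L ∧ State G D' v u {(v, y)} ∧
      ∀ z ∈ D'.B, z = D'.pos v ∨ z.im < (D'.pos v).im := by
  have h3 := q3_pos
  obtain ⟨f, hf, hfu, hfy, hfa⟩ := res3 hn
  have hnd := hn.1
  simp only [List.nodup_cons, List.mem_cons, List.not_mem_nil, or_false, not_or] at hnd
  obtain ⟨g, hg, hgap⟩ := exists_gap D.L (D.pos a).re (fun d => (D.E d).re) (fun d hd => (st.str d hd).1)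
  obtain ⟨M, hM⟩ := st.good.bdd
  have hMa := hM _ (Dr.pos_mem st.hv)
  have hM0 : 0 ≤ M := (abs_nonneg _).trans hMa.1
  obtain ⟨C, hEC, hC⟩ := high_EC (D.pos a) (ρ := g) (ℓ := 2 * M + 1) hg (by linarith)
  set A := D.pos a with hA
  have hg3 : 0 < g * √3 := by positivity
  have hAim := abs_le.1 hMa.2
  obtain ⟨D', g', hx⟩ := core_add st.good st.hv st.dir st.ne st.K hv hL hf (by rw [hfa]; exact hEC)
    ⟨by simp only; linarith, by simp only; linarith⟩
    (fun z hz => (hC z hz).imp id (fun h => ⟨h.1, h.2.2.1⟩)) (fun d hd => (st.str d hd).1)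
    (fun d hd z hz => (hC z hz).imp id (fun h => by linarith [h.2.1, hgap d hd]))
  have hlow : ∀ z ∈ D'.B, z = D'.pos v ∨ z.im < (D'.pos v).im := by
    intro z hz
    rw [hx.pv]
    rcases hx.B hz with hz | hz
    · right; simp only
      linarith [(abs_le.1 (hM z hz).2).2]
    · rcases hC z hz with rfl | ⟨h1, h2, h4, h5, h6⟩
      · right; simp only; linarith
      · rcases h5.lt_or_eq with h | h
        · exact Or.inr h
        · left
          apply Complex.ext
          · refine le_antisymm h2 (le_of_not_gt fun h' => ?_)
            have := h6 h'; linarith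
          · exact h
  refine ⟨D', hx.S, hx.L, ⟨g', by rw [hx.S]; exact Or.inl rfl, by rw [hx.dv, hfu], ?_, ?_, ?_, ?_, ?_⟩, hlow⟩
  · rw [hx.Ed]
    rintro (h | h)
    · exact hu h
    · exact sav_ne st.hv hv hnd.1.2 h
  · rintro z hz ⟨k1, k2⟩
    rcases hlow z hz with rfl | h
    · linarith
    · linarith
  · intro d hd
    rw [hx.L] at hd
    rw [hx.pv, hx.E d hd]
    have := st.str d hd
    refine ⟨?_, by simp only; linarith [this.2]⟩
    simp only; linarith [hgap d hd]
  · refine st.comp.ext hx rfl (empty_subset _) fun w hw => ?_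
    have := (hn.2 w).1 hw
    simp only [List.mem_cons, List.not_mem_nil, or_false] at this
    rcases this with h | rfl | rfl
    · exact Or.inl h
    · exact Or.inr (Or.inr ⟨_, rfl, rfl⟩)
    · exact Or.inr (Or.inl ((hx.Ed _).2 (Or.inr Sym2.eq_swap)))
  · rintro d rfl
    refine ⟨by rw [hx.S]; exact Or.inl rfl, by simp only [hx.dv, hfy], ?_, ?_, le_rfl, le_rfl, fun h => absurd rfl h⟩
    · rw [hx.Ed]
      rintro (h | h)
      · exact hy h
      · exact sav_ne st.hv hv hnd.2.1 h
    · intro z hz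
      rcases hlow z hz with rfl | h
      · exact Or.inr le_rfl
      · exact Or.inl h

lemma opOuter {v u y : V} (st : State G D v u {(v, y)}) (hy : y ∉ D.S) (hyu : y ≠ u)
    (hB : ∀ z ∈ D.B, z = D.pos v ∨ z.im < (D.pos v).im ∨
      ((D.pos v).re < z.re ∧ z.im ≤ (D.pos v).im)) :
    ∃ D', D'.S = D.S ∧ D'.L = D.L ++ [(v, y)] ∧ State G D' v u ∅ := by
  have h3 := q3_pos
  have h3l := q3_lo
  obtain ⟨r1, r2, r3, -⟩ := st.rs (v, y) rfl
  simp only at r1 r2 r3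
  obtain ⟨M, hM⟩ := st.good.bdd
  have hMa := hM _ (Dr.pos_mem st.hv)
  have hM0 : 0 ≤ M := (abs_nonneg _).trans hMa.1
  obtain ⟨C, hS, hC⟩ := outer_S (D.pos v) (R := 4 * M + 1) (by linarith)
  set A := D.pos v with hA
  have hAr := abs_le.1 hMa.1
  have hAi := abs_le.1 hMa.2
  set Q := 4 * M + 1 with hQ
  have hQ3 : 2 * M < Q * √3 / 2 := by nlinarith
  have hM' : ∀ z ∈ D.B, (-M ≤ z.re ∧ z.re ≤ M) ∧ (-M ≤ z.im ∧ z.im ≤ M) := fun z hz =>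
    ⟨abs_le.1 (hM z hz).1, abs_le.1 (hM z hz).2⟩
  have hcon : ∀ z ∈ C, z ∈ D.B → z = A := by
    intro z hz hzB
    rcases hC z hz with h | ⟨h1, h2, -⟩
    · exact h
    · have hb := hM' z hzB
      rcases le_or_gt A.re z.re with h | h
      · have := h1 h; linarith
      · rcases hB z hzB with h' | h' | h'
        · exact h'
        · exfalso
          have e1 : (A.re - z.re) * (Q - (A.re - z.re)) > 0 := mul_pos (by linarith) (by linarith)
          have e2 : (A.im - z.im) * (Q - (A.im - z.im)) > 0 := mul_pos (by linarith) (by linarith)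
          have e3 : Q * (√3 - 1) * (A.im - z.im) > 0 := mul_pos (mul_pos (by linarith) (by linarith)) (by linarith)
          nlinarith
        · linarith [h'.1]
  have hE := fun d hd => hM' _ (st.good.E_mem (d := d) hd)
  have g' := st.good.addS (d := (v, y)) (C := C) (E := ⟨A.re + Q / 2, A.im - Q * √3 / 2⟩)
    (L := D.L ++ [(v, y)]) st.hv hy r3
    (Or.inr ⟨rfl, fun d hd => by simp only; linarith [(hE d hd).1.2]⟩)
    (by simp only; rw [r2]; exact hS) hcon
    (by
      intro d hd z hz hzr
      have := st.str d hd
      rcases hC z hz with rfl | ⟨h1, -, -⟩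
      · linarith [this.1]
      · have := h1 (by linarith [this.1]); linarith [(hE d hd).2.1])
    (by
      intro z hz hzr
      simp only at hzr
      linarith [(hM' z hz).1.2])
    (by
      intro z hz hzr
      simp only at hzr
      rcases hC z hz with rfl | ⟨-, -, h1⟩
      · linarith
      · exact h1 hzr)
  have hBe := Dr.addS_B (D := D) (d := (v, y)) r3 ⟨A.re + Q / 2, A.im - Q * √3 / 2⟩ C (D.L ++ [(v, y)])
  have hvy : (v, y) ∉ D.L := fun h => r3 (st.good.str _ h).2.2.1
  refine ⟨D.addS (v, y) ⟨A.re + Q / 2, A.im - Q * √3 / 2⟩ C (D.L ++ [(v, y)]), rfl, rfl, g', st.hv, st.dir,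
    ?_, ?_, ?_, ?_, fun d hd => absurd hd (by simp)⟩
  · rintro (h | h)
    · rcases Sym2.eq_iff.1 h with ⟨-, h⟩ | ⟨h1, h2⟩
      · exact hyu h.symm
      · exact hy (by simp only at h1; rw [← h1]; exact st.hv)
    · exact st.ne h
  · rintro z hz ⟨k1, k2⟩
    change A.im < z.im at k1
    change A.re + A.im < z.re + z.im at k2
    rw [hBe] at hz
    rcases hz with hz | hz
    · exact st.K z hz ⟨k1, k2⟩
    · rcases hC z hz with rfl | ⟨h1, h2, -⟩
      · linarith
      · rcases le_or_gt A.re z.re with h | h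
        · have := h1 h; linarith
        · have e1 : 0 ≤ Q * ((A.re - z.re) - √3 * (z.im - A.im)) := by rw [← h2]; positivity
          have e2 : 0 ≤ (A.re - z.re) - √3 * (z.im - A.im) := nonneg_of_mul_nonneg_right e1 (by linarith)
          nlinarith
  · intro d hd
    rcases List.mem_append.1 hd with hd | hd
    · rw [Dr.addS_E_ne (by rintro rfl; exact hvy hd)]
      exact st.str d hd
    · rw [List.mem_singleton] at hd
      subst hd
      rw [Dr.addS_E_self]
      show A.re < A.re + Q / 2 ∧ A.im - Q * √3 / 2 ≤ A.im
      constructor <;> linarith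
  · intro x hx w hxw
    rcases st.comp x hx w hxw with h | h | ⟨d, rfl, h⟩
    · exact Or.inl (Or.inr h)
    · exact Or.inr (Or.inl h)
    · exact Or.inl (Or.inl h)


lemma opS2 {a v u y : V} (st : State G D a v R) (hv : v ∉ D.S) (hL : ∀ d ∈ D.L, d.2 ≠ v)
    (hn : Nb G v [u, a, y]) (hu : s(v, u) ∉ D.Ed) (hy : s(v, y) ∉ D.Ed) (hyS : y ∉ insert v D.S)
    (hR : ∀ d ∈ R, s(d.1, d.2) ≠ s(a, v) ∧ s(d.1, d.2) ≠ s(v, y)) :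
    ∃ D', D'.S = insert v D.S ∧ D'.L = (v, y) :: D.L ∧ State G D' v u R := by
  have h3 := q3_pos
  have h3l := q3_lo
  have h3h := q3_hi
  obtain ⟨f, hf, hfu, hfa, hfy⟩ := res3 hn
  have hnd := hn.1
  simp only [List.nodup_cons, List.mem_cons, List.not_mem_nil, or_false, not_or] at hnd
  obtain ⟨g₂, hg₂, hgap⟩ := exists_gap D.L (D.pos a).re (fun d => (D.E d).re) (fun d hd => (st.str d hd).1)
  obtain ⟨g, hg, rfl⟩ : ∃ g, 0 < g ∧ g₂ = 2 * g := ⟨g₂ / 2, by linarith, by ring⟩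
  clear hg₂
  obtain ⟨C, hEC, hC⟩ := over_EC (D.pos a) hg
  set A := D.pos a with hA
  set P : ℂ := ⟨A.re + g, A.im + g * √3 / 6⟩ with hP
  have hPre : P.re = A.re + g := rfl
  have hPim : P.im = A.im + g * √3 / 6 := rfl
  have hg3 : g / 4 < g * √3 / 6 := by nlinarith
  obtain ⟨D', g', hx⟩ := core_add st.good st.hv st.dir st.ne st.K hv hL hf (by rw [hfa]; exact hEC)
    ⟨by linarith, by linarith⟩
    (fun z hz => (hC z hz).imp id (fun h => ⟨h.1, h.2.2.1⟩)) (fun d hd => (st.str d hd).1)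
    (fun d hd z hz => (hC z hz).imp id (fun h => by linarith [h.2.1, hgap d hd]))
  obtain ⟨I, hI, hIz⟩ := inner_S P (R := g / 8) (by linarith)
  have hyE : s(v, y) ∉ D'.Ed := by
    rw [hx.Ed]
    rintro (h | h)
    · exact hy h
    · exact sav_ne st.hv hv (Ne.symm hnd.2.1) h
  have hLE : ∀ d ∈ D'.L, A.re + 2 * g ≤ (D'.E d).re ∧ (D'.E d).im ≤ A.im := by
    intro d hd
    rw [hx.L] at hd
    rw [hx.E d hd]
    exact ⟨hgap d hd, (st.str d hd).2⟩
  have g2 := g'.addS (d := (v, y)) (C := I) (E := ⟨P.re + 2 * (g / 8), P.im⟩)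
    (L := (v, y) :: D'.L) (by rw [hx.S]; exact Or.inl rfl) (by rw [hx.S]; exact hyS) hyE
    (Or.inl ⟨rfl, fun d hd => by simp only; linarith [(hLE d hd).1]⟩)
    (by simp only; rw [hx.pv, hx.dv, hfy]; exact hI)
    (by
      intro z hz hzB
      simp only [hx.pv]
      rcases hIz z hz with h | ⟨h1, h2, h4, h5⟩
      · exact h
      · exfalso
        rcases hx.B hzB with h | h
        · exact st.K z h ⟨by linarith, by linarith⟩
        · rcases hC z h with rfl | h
          · linarith
          · linarith [h.2.1])
    (by
      intro d hd z hz hzr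
      have := hLE d hd
      rcases hIz z hz with rfl | ⟨h1, h2, h4, h5⟩ <;> linarith)
    (by
      intro z hz hzr
      simp only at hzr ⊢
      rcases hx.B hz with h | h
      · by_contra hc
        push Not at hc
        exact st.K z h ⟨by linarith, by linarith⟩
      · rcases hC z h with rfl | h
        · linarith
        · linarith [h.2.1])
    (by
      intro z hz hzr
      simp only at hzr ⊢
      rcases hIz z hz with rfl | ⟨h1, h2, h4, h5⟩ <;> linarith)
  have hBe := Dr.addS_B (D := D') (d := (v, y)) hyE ⟨P.re + 2 * (g / 8), P.im⟩ I ((v, y) :: D'.L)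
  have hvy : (v, y) ∉ D.L := fun h => hv (st.good.str _ h).1
  set D'' := D'.addS (v, y) ⟨P.re + 2 * (g / 8), P.im⟩ I ((v, y) :: D'.L) with hD''
  have hx2 : DExt D D'' v P f ((v, y) :: D.L) {s(a, v), s(v, y)} (C ∪ I) := by
    refine ⟨hx.S, by rw [← hx.L]; rfl, ?_, ?_, ?_, hx.pv, hx.dv, hx.po, hx.di⟩
    · intro e
      show e = s(v, y) ∨ e ∈ D'.Ed ↔ _
      rw [hx.Ed]
      simp only [mem_insert_iff, mem_singleton_iff]
      tauto
    · intro d hd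
      rw [hD'', Dr.addS_E_ne (by rintro rfl; exact hvy hd), hx.E d hd]
    · rw [hBe]
      rintro z (h | h)
      · rcases hx.B h with h | h
        · exact Or.inl h
        · exact Or.inr (Or.inl h)
      · exact Or.inr (Or.inr h)
  refine ⟨D'', hx2.S, hx2.L, g2, by rw [hx2.S]; exact Or.inl rfl, by rw [hx2.dv, hfu], ?_, ?_, ?_, ?_, ?_⟩
  · rw [hx2.Ed]
    rintro (h | h | h)
    · exact hu h
    · exact sav_ne st.hv hv hnd.1.1 h
    · rcases Sym2.eq_iff.1 h with ⟨-, h⟩ | ⟨h1, h2⟩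
      · exact hnd.1.2 h
      · exact hyS (Or.inl h1.symm)
  · intro z hz ⟨k1, k2⟩
    rw [hx2.pv] at k1 k2
    rcases hx2.B hz with hz | hz | hz
    · exact st.K z hz ⟨by linarith, by linarith⟩
    · rcases hC z hz with rfl | h
      · linarith
      · linarith [h.2.2.2.2.1]
    · rcases hIz z hz with rfl | h
      · linarith
      · linarith [h.2.2.2]
  · intro d hd
    rw [hx2.L] at hd
    rw [hx2.pv]
    rcases List.mem_cons.1 hd with rfl | hd
    · rw [hD'', Dr.addS_E_self]
      simp only
      constructor <;> linarith
    · rw [hx2.E d hd]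
      have := st.str d hd
      constructor <;> linarith [hgap d hd]
  · refine st.comp.ext hx2 (by simp) subset_rfl fun w hw => ?_
    have := (hn.2 w).1 hw
    simp only [List.mem_cons, List.not_mem_nil, or_false] at this
    rcases this with h | rfl | rfl
    · exact Or.inl h
    · exact Or.inr (Or.inl ((hx2.Ed _).2 (Or.inr (Or.inl Sym2.eq_swap))))
    · exact Or.inr (Or.inl ((hx2.Ed _).2 (Or.inr (Or.inr rfl))))
  · refine st.rs.ext hx2 ?_ ?_ (by linarith) (by linarith)
    · rintro d hd (h | h)
      · exact (hR d hd).1 h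
      · exact (hR d hd).2 h
    · rintro z (hz | hz)
      · rcases hC z hz with rfl | h
        · exact le_rfl
        · exact h.1.le
      · rcases hIz z hz with rfl | h
        · linarith
        · linarith [h.1]

lemma State.one {v u : V} {f : V → ℝ} (hf : Res G f v) (hfu : f u = Real.pi / 6) {R : Set (V × V)}
    (hadj : ∀ y, G.Adj v y → y = u ∨ (v, y) ∈ R)
    (hR : ∀ d ∈ R, d.1 = v ∧ f d.2 = 5 * Real.pi / 6) : State G (Dr.one v 0 f) v u R := by
  refine ⟨Good.one v 0 hf, rfl, hfu, fun h => h, ?_, fun d hd => absurd hd (by simp [Dr.one]), ?_, ?_⟩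
  · rw [Dr.one_B]
    rintro z rfl ⟨h, -⟩
    exact lt_irrefl _ h
  · rintro x rfl y hy
    rcases hadj y hy with rfl | h
    · exact Or.inr (Or.inl rfl)
    · exact Or.inr (Or.inr ⟨_, h, rfl⟩)
  · intro d hd
    obtain ⟨h1, h2⟩ := hR d hd
    refine ⟨h1, h2, fun h => h, ?_, le_rfl, le_rfl, fun h => absurd h1 h⟩
    rw [Dr.one_B]
    rintro z rfl
    exact Or.inr le_rfl

/-- add a strand at the first vertex -/
lemma opFirst {v u y : V} {R : Set (V × V)} {f : V → ℝ} (hf : Res G f v) (hfu : f u = Real.pi / 6)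
    (hadj : ∀ w, G.Adj v w → w = u ∨ w = y ∨ (v, w) ∈ R)
    (hR : ∀ d ∈ R, d.1 = v ∧ d.2 ≠ y ∧ f d.2 = 5 * Real.pi / 6) (hyv : y ≠ v) (hyu : y ≠ u)
    {E : ℂ} {C : Set ℂ} (hS : Strand 0 E (f y) C) (hE : 0 < E.re ∧ E.im ≤ 0)
    (hC : ∀ z ∈ C, z.im ≤ 0 ∧ (z.re = E.re → z.im ≤ E.im))
    (hC' : R = ∅ ∨ ∀ z ∈ C, z = 0 ∨ 0 < z.re) :
    ∃ D', D'.S = {v} ∧ D'.L = [(v, y)] ∧ State G D' v u R ∧ D'.pos v = 0 ∧ D'.B ⊆ insert 0 C := by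
  have g := Good.one (G := G) v 0 hf
  have g2 := g.addS (d := (v, y)) (C := C) (E := E) (L := [(v, y)]) rfl (by simpa [Dr.one] using hyv)
    (fun h => h) (Or.inl ⟨rfl, by simp [Dr.one]⟩) hS
    (by intro z hz h; rw [Dr.one_B] at h; exact h) (by simp [Dr.one])
    (by
      rw [Dr.one_B]; rintro z rfl h
      exact absurd h hE.1.ne)
    (fun z hz h => (hC z hz).2 h)
  have hBe := Dr.addS_B (D := Dr.one v 0 f) (d := (v, y)) (fun h => h) E C [(v, y)]
  rw [Dr.one_B] at hBe
  refine ⟨(Dr.one v 0 f).addS (v, y) E C [(v, y)], rfl, rfl, ⟨g2, rfl, hfu, ?_, ?_, ?_, ?_, ?_⟩, rfl, hBe.le⟩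
  · rintro (h | h)
    · rcases Sym2.eq_iff.1 h with ⟨-, h⟩ | ⟨h1, h2⟩
      · exact hyu h.symm
      · exact hyv h1.symm
    · exact h
  · rw [hBe]
    rintro z (rfl | h) ⟨k, -⟩
    · exact lt_irrefl _ k
    · exact absurd k (not_lt.2 (hC z h).1)
  · intro d hd
    have : d = (v, y) := by simpa [Dr.addS] using hd
    subst this
    rw [Dr.addS_E_self]
    exact hE
  · rintro x rfl w hw
    rcases hadj w hw with rfl | rfl | h
    · exact Or.inr (Or.inl rfl)
    · exact Or.inl (Or.inl rfl)
    · exact Or.inr (Or.inr ⟨_, h, rfl⟩)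
  · intro d hd
    obtain ⟨h1, h2, h4⟩ := hR d hd
    refine ⟨h1, h4, ?_, ?_, le_rfl, le_rfl, fun h => absurd h1 h⟩
    · rintro (h | h)
      · rcases Sym2.eq_iff.1 h with ⟨-, h⟩ | ⟨h1, h'⟩
        · exact h2 h
        · exact hyv (h1.symm.trans ‹d.1 = v›)
      · exact h
    · rw [hBe]
      rintro z (rfl | h)
      · exact Or.inr le_rfl
      · rcases hC' with rfl | hC'
        · exact absurd hd (by simp)
        · rcases hC' z h with rfl | h'
          · exact Or.inr le_rfl
          · exact Or.inr h'.le

lemma opLeaf1 {v u y : V} (hn : Nb G v [u, y]) (hyv : y ≠ v) :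
    ∃ D', D'.S = {v} ∧ D'.L = [(v, y)] ∧ State G D' v u ∅ := by
  obtain ⟨f, hf, hfu, hfy⟩ := res2 hn (Real.pi / 6)
  have hnd := hn.1
  simp only [List.nodup_cons, List.mem_cons, List.not_mem_nil, or_false] at hnd
  obtain ⟨C, E, hS, h1, h2, h3⟩ := leafone_S 0
  obtain ⟨D', a, b, c, -⟩ := opFirst (u := u) (y := y) (R := ∅) hf hfu
    (fun w hw => by simpa using (hn.2 w).1 hw) (by simp) hyv (Ne.symm hnd.1) (E := E) (C := C)
    (by rw [hfy]; convert hS using 1; ring) ⟨h1, h2⟩ h3 (Or.inl rfl)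
  exact ⟨D', a, b, c⟩

lemma opLeafInner {v u y y' : V} (hn : Nb G v [u, y, y']) (hyv : y' ≠ v) :
    ∃ D', D'.S = {v} ∧ D'.L = [(v, y')] ∧ State G D' v u {(v, y)} ∧
      ∀ z ∈ D'.B, z = D'.pos v ∨ z.im < (D'.pos v).im ∨
      ((D'.pos v).re < z.re ∧ z.im ≤ (D'.pos v).im) := by
  obtain ⟨f, hf, hfu, hfy, hfy'⟩ := res3 hn
  have hnd := hn.1
  simp only [List.nodup_cons, List.mem_cons, List.not_mem_nil, or_false, not_or] at hnd
  obtain ⟨C, hS, hC⟩ := inner_S 0 one_pos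
  have hE : (⟨(0 : ℂ).re + 2 * 1, (0 : ℂ).im⟩ : ℂ).im = 0 := rfl
  obtain ⟨D', a, b, c, d, e⟩ := opFirst (u := u) (y := y') (R := {(v, y)}) hf hfu
    (fun w hw => by
      have := (hn.2 w).1 hw
      simp only [List.mem_cons, List.not_mem_nil, or_false] at this
      rcases this with h | rfl | h
      · exact Or.inl h
      · exact Or.inr (Or.inr rfl)
      · exact Or.inr (Or.inl h))
    (by rintro d rfl; exact ⟨rfl, hnd.2.1, hfy⟩) hyv (Ne.symm hnd.1.2) (C := C)
    (by rw [hfy']; exact hS) ⟨by simp, by simp⟩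
    (by
      intro z hz
      rcases hC z hz with rfl | h
      · simp
      · exact ⟨h.2.2.2, fun _ => h.2.2.2⟩)
    (Or.inr fun z hz => by
      rcases hC z hz with rfl | h
      · exact Or.inl rfl
      · exact Or.inr h.1)
  refine ⟨D', a, b, c, ?_⟩
  intro z hz
  rw [d]
  rcases e hz with h | h
  · exact Or.inl h
  · rcases hC z h with h | h
    · exact Or.inl h
    · exact Or.inr (Or.inr ⟨h.1, h.2.2.2⟩)

end ops

section pops
variable {V : Type*} {G : SimpleGraph V} {D D' : Dr V} {R : Set (V × V)}

structure PR (G : SimpleGraph V) (D : Dr V) (a v : V) (d : V × V) (rest : List (V × V)) (gap : ℝ)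
    (R : Set (V × V)) : Prop where
  good : Good G D
  ha : a ∈ D.S
  dir : D.dir a v = Real.pi / 6
  ne : s(a, v) ∉ D.Ed
  L : D.L = d :: rest
  d2 : d.2 = v
  gap_pos : 0 < gap
  gap_eq : (D.E d).re = (D.pos a).re + gap
  K : ∀ z ∈ D.B, ¬ InK (D.pos a) z ∨ ((D.pos a).re + gap / 2 < z.re ∧ z.im < (D.pos a).im + gap / 4)
  str : ∀ d' ∈ D.L, (D.E d').im < (D.pos a).im + gap / 4
  comp : CP G D a v R
  rs : RS D a R

lemma State.toPR {a v : V} {d : V × V} {rest : List (V × V)} (st : State G D a v R)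
    (hL : D.L = d :: rest) (hd : d.2 = v) :
    PR G D a v d rest ((D.E d).re - (D.pos a).re) R := by
  have h := st.str d (by simp [hL])
  refine ⟨st.good, st.hv, st.dir, st.ne, hL, hd, by linarith, by ring, fun z hz => Or.inl (st.K z hz), ?_,
    st.comp, st.rs⟩
  intro d' hd'
  have := st.str d' hd'
  linarith

lemma popCore {a v : V} {d : V × V} {rest : List (V × V)} {gap : ℝ} (pr : PR G D a v d rest gap R)
    (hv : v ∉ D.S) (hrest : ∀ d' ∈ rest, d'.2 ≠ v) {f : V → ℝ} (hf : Res G f v)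
    (hfd : f d.1 = 3 * Real.pi / 2) {C : Set ℂ}
    (hEC : EC (D.pos a) ⟨(D.pos a).re + gap, (D.pos a).im + gap * √3 / 6⟩ (Real.pi / 6) (f a) C)
    (hC : ∀ z ∈ C, z = D.pos a ∨ ((D.pos a).re < z.re ∧ z.re ≤ (D.pos a).re + gap ∧ (D.pos a).im < z.im ∧
      (z.re = (D.pos a).re + gap → z = ⟨(D.pos a).re + gap, (D.pos a).im + gap * √3 / 6⟩) ∧
      ((D.pos a).re + gap / 2 < z.re → (D.pos a).im + gap * √3 / 6 ≤ z.im))) :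
    ∃ D', Good G D' ∧ DExt D D' v ⟨(D.pos a).re + gap, (D.pos a).im + gap * √3 / 6⟩ f rest {s(a, v)}
      (C ∪ {z | z.re = (D.pos a).re + gap ∧ z.im ≤ (D.pos a).im + gap * √3 / 6}) := by
  have hg := pr.gap_pos
  have h3l := q3_lo
  have hg3 : gap / 4 < gap * √3 / 6 := by nlinarith
  set A := D.pos a with hA
  set P : ℂ := ⟨A.re + gap, A.im + gap * √3 / 6⟩ with hP
  have hdL : d ∈ D.L := by simp [pr.L]
  have hh : 0 < P.im - (D.E d).im := by
    have := pr.str d hdL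
    simp only [hP]; linarith
  have hPe : (⟨(D.E d).re, (D.E d).im + (P.im - (D.E d).im)⟩ : ℂ) = P := by
    apply Complex.ext
    · show (D.E d).re = A.re + gap; exact pr.gap_eq
    · simp
  have g1 := pr.good.popV hv pr.L pr.d2 hrest hh hf hfd
  have hB1 := pr.good.popV_B hv pr.L hh f
  set D₁ := D.popV v d rest (P.im - (D.E d).im) f with hD₁
  have e1 : D₁.pos a = A := upd_S hv _ _ pr.ha
  have e2 : D₁.dir a = D.dir a := upd_S hv _ _ pr.ha
  have e3 : D₁.pos v = P := by rw [← hPe]; simp [hD₁, Dr.popV]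
  have e4 : D₁.dir v = f := by simp [hD₁, Dr.popV]
  have hvert : ∀ z ∈ vert (D.E d) (P.im - (D.E d).im), z.re = A.re + gap ∧ z.im ≤ A.im + gap * √3 / 6 := by
    rintro z ⟨h1, h2, h4⟩
    refine ⟨h1.trans pr.gap_eq, h4.trans ?_⟩
    simp [hP]
  have hsrt : ∀ d' ∈ rest, (D.E d).re < (D.E d').re := by
    have := pr.good.srt; rw [pr.L, List.pairwise_cons] at this; exact this.1
  have g2 := g1.addE (x := a) (y := v) (C := C) (Or.inr pr.ha) (Or.inl rfl) pr.ne
    (by rw [e1, e2, e3, e4, pr.dir]; exact hEC)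
    (by
      intro z hz hzB
      rw [hB1] at hzB
      rw [e1, e3]
      rcases hC z hz with h | ⟨h1, h2, h4, h5, h6⟩
      · exact Or.inl h
      · rcases hzB with hzB | hzB
        · exfalso
          rcases pr.K z hzB with h | h
          · exact h ⟨h4, by linarith⟩
          · have := h6 h.1
            linarith [h.2]
        · exact Or.inr (h5 (hvert z hzB).1))
    (by
      intro d' hd' z hz hzr
      have hr : (D.E d).re < (D.E d').re := hsrt d' hd'
      have hzr' : z.re = (D.E d').re := hzr
      rw [pr.gap_eq] at hr
      exfalso
      rcases hC z hz with rfl | ⟨h1, h2, -⟩ <;> linarith)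
  refine ⟨_, g2, rfl, rfl, ?_, fun _ _ => rfl, ?_, e3, e4, fun x hx => upd_S hv _ _ hx,
    fun x hx => upd_S hv _ _ hx⟩
  · intro e
    show e ∈ insert s(a, v) D.Ed ↔ _
    rw [mem_insert_iff, mem_singleton_iff, or_comm]
  · rw [Dr.addE_B (D := D₁) pr.ne, hB1]
    rintro z ((h | h) | h)
    · exact Or.inl h
    · exact Or.inr (Or.inr (hvert z h))
    · exact Or.inr (Or.inl h)

lemma opPop {a v u : V} {d : V × V} {rest : List (V × V)} {gap : ℝ} (pr : PR G D a v d rest gap R)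
    (hv : v ∉ D.S) (hrest : ∀ d' ∈ rest, d'.2 ≠ v) (hn : Nb G v [u, a, d.1]) (hu : s(v, u) ∉ D.Ed)
    (hR : ∀ d ∈ R, s(d.1, d.2) ≠ s(a, v)) :
    ∃ D', D'.S = insert v D.S ∧ D'.L = rest ∧ State G D' v u R := by
  have hg := pr.gap_pos
  have h3l := q3_lo
  have hg3 : gap / 4 < gap * √3 / 6 := by nlinarith
  obtain ⟨f, hf, hfu, hfa, hfd⟩ := res3 hn
  have hnd := hn.1
  simp only [List.nodup_cons, List.mem_cons, List.not_mem_nil, or_false, not_or] at hnd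
  obtain ⟨C, hEC, hC⟩ := over_EC (D.pos a) hg
  obtain ⟨D', g', hx⟩ := popCore pr hv hrest hf hfd (by rw [hfa]; exact hEC)
    (fun z hz => (hC z hz).imp id (fun h => ⟨h.1, h.2.1, h.2.2.1, h.2.2.2.1, h.2.2.2.2.2⟩))
  set A := D.pos a with hA
  have hsrt : ∀ d' ∈ rest, (D.E d).re < (D.E d').re := by
    have := pr.good.srt; rw [pr.L, List.pairwise_cons] at this; exact this.1
  refine ⟨D', hx.S, hx.L, g', by rw [hx.S]; exact Or.inl rfl, by rw [hx.dv, hfu], ?_, ?_, ?_, ?_, ?_⟩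
  · rw [hx.Ed]
    rintro (h | h)
    · exact hu h
    · exact sav_ne pr.ha hv hnd.1.1 h
  · intro z hz ⟨k1, k2⟩
    rw [hx.pv] at k1 k2
    simp only at k1 k2
    rcases hx.B hz with hz | hz | hz
    · rcases pr.K z hz with h | h
      · exact h ⟨by linarith, by linarith⟩
      · linarith [h.2]
    · rcases hC z hz with rfl | h
      · linarith
      · linarith [h.2.2.2.2.1]
    · linarith [hz.2]
  · intro d' hd'
    rw [hx.L] at hd'
    have hdL : d' ∈ D.L := by simp [pr.L, hd']
    rw [hx.pv, hx.E d' hdL]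
    have h1 := hsrt d' hd'
    have h2 := pr.str d' hdL
    rw [pr.gap_eq] at h1
    exact ⟨h1, by simp only; linarith⟩
  · refine pr.comp.ext hx rfl subset_rfl fun y hy => ?_
    have := (hn.2 y).1 hy
    simp only [List.mem_cons, List.not_mem_nil, or_false] at this
    rcases this with h | rfl | rfl
    · exact Or.inl h
    · exact Or.inr (Or.inl ((hx.Ed _).2 (Or.inr Sym2.eq_swap)))
    · refine Or.inr (Or.inl ((hx.Ed _).2 (Or.inl ?_)))
      have := (pr.good.str d (by simp [pr.L])).2.2.1
      rw [pr.d2] at this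
      rwa [Sym2.eq_swap]
  · refine pr.rs.ext hx (fun d hd h => hR d hd h) (fun z hz => ?_) (by simp only; linarith) (by simp only; linarith)
    rcases hz with hz | hz
    · rcases hC z hz with rfl | h
      · exact le_rfl
      · exact h.1.le
    · rw [hz.1]; linarith

/-- close a degree two root -/
lemma opRoot2 {a r : V} {d : V × V} {gap : ℝ} (pr : PR G D a r d [] gap ∅)
    (hv : r ∉ D.S) (hn : Nb G r [a, d.1]) :
    ∃ D', Good G D' ∧ D'.S = insert r D.S ∧ D'.L = [] ∧ ∀ x ∈ D'.S, ∀ y, G.Adj x y → s(x, y) ∈ D'.Ed := by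
  obtain ⟨f, hf, hfa, hfd⟩ := res2 hn (Real.pi / 2)
  obtain ⟨C, hEC, hC⟩ := down_EC (D.pos a) pr.gap_pos
  obtain ⟨D', g', hx⟩ := popCore pr hv (by simp) hf (by rw [hfd]; ring) (by rw [hfa]; exact hEC) hC
  refine ⟨D', g', hx.S, hx.L, ?_⟩
  have hne : s(r, r) ∉ D.Ed := by
    refine pr.good.not_ed hv fun h => hv (pr.good.str _ h).1
  have := pr.comp.ext (u := r) (R' := ∅) hx rfl subset_rfl fun y hy => ?_
  · intro x hxS y hxy
    rcases this x hxS y hxy with h | h | ⟨d, h, -⟩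
    · exact h
    · exfalso
      rcases Sym2.eq_iff.1 h with ⟨rfl, rfl⟩ | ⟨rfl, rfl⟩ <;> exact hxy.ne rfl
    · exact absurd h (by simp)
  · have := (hn.2 y).1 hy
    simp only [List.mem_cons, List.not_mem_nil, or_false] at this
    rcases this with rfl | rfl
    · exact Or.inr (Or.inl ((hx.Ed _).2 (Or.inr Sym2.eq_swap)))
    · refine Or.inr (Or.inl ((hx.Ed _).2 (Or.inl ?_)))
      have := (pr.good.str d (by simp [pr.L])).2.2.1
      rw [pr.d2] at this
      rwa [Sym2.eq_swap]

/-- light drawing: the edge towards `v` becomes the first strand -/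
lemma opLight {b v : V} (st : State G D b v ∅) (hv : v ∉ D.S) :
    ∃ D', Good G D' ∧ D'.S = D.S ∧ D'.L = (b, v) :: D.L ∧
      ∀ x ∈ D'.S, ∀ y, G.Adj x y → s(x, y) ∈ D'.Ed := by
  have h3 := q3_pos
  obtain ⟨g, hg, hgap⟩ := exists_gap D.L (D.pos b).re (fun d => (D.E d).re) (fun d hd => (st.str d hd).1)
  obtain ⟨C, hS, hC⟩ := light_S (D.pos b) hg
  set A := D.pos b with hA
  have hg3 : 0 < g * √3 / 2 := by positivity
  have g' := st.good.addS (d := (b, v)) (C := C) (E := ⟨A.re + g / 2, A.im + g * √3 / 2⟩)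
    (L := (b, v) :: D.L) st.hv hv st.ne
    (Or.inl ⟨rfl, fun d hd => by simp only; linarith [hgap d hd]⟩)
    (by simp only; rw [st.dir]; exact hS)
    (by
      intro z hz hzB
      rcases hC z hz with h | h
      · exact h
      · exact absurd ⟨h.2.2.1, by linarith [h.1, h.2.2.1]⟩ (st.K z hzB))
    (by
      intro d hd z hz hzr
      have := hgap d hd
      rcases hC z hz with rfl | h
      · linarith
      · linarith [h.2.1])
    (by
      intro z hz hzr
      simp only at hzr ⊢
      by_contra hc
      push Not at hc
      exact st.K z hz ⟨by linarith, by linarith⟩)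
    (by
      intro z hz hzr
      simp only at hzr ⊢
      rcases hC z hz with rfl | h
      · linarith
      · exact h.2.2.2)
  refine ⟨_, g', rfl, rfl, ?_⟩
  intro x hx y hxy
  rcases st.comp x hx y hxy with h | h | ⟨d, h, -⟩
  · exact Or.inr h
  · exact Or.inl h
  · exact absurd h (by simp)

lemma opBranch {a b v : V} (st : State G D a v R) {D₂ : Dr V} (st₂ : State G D₂ b v ∅)
    (hv : v ∉ D.S) (hv₂ : v ∉ D₂.S) (hS : Disjoint D.S D₂.S) (h1 : ∀ d ∈ D.L, d.2 ∉ D₂.S)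
    (h2 : ∀ d ∈ D₂.L, d.2 ∉ D.S) (hR : ∀ d ∈ R, d.2 ∉ D₂.S) :
    ∃ D' gap, D'.S = D.S ∪ D₂.S ∧ PR G D' a v (b, v) (D₂.L ++ D.L) gap R := by
  obtain ⟨F, gF, hFS, hFL, hFc⟩ := opLight st₂ hv₂
  obtain ⟨g, hg, hgap⟩ := exists_gap D.L (D.pos a).re (fun d => (D.E d).re) (fun d hd => (st.str d hd).1)
  obtain ⟨M, hM⟩ := gF.bdd
  have hM0 : 0 ≤ M := (abs_nonneg _).trans (hM _ (Dr.pos_mem (hFS ▸ st₂.hv))).1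
  set A := D.pos a with hA
  set l : ℝ := g / 32 / (M + 1) with hl
  have hl0 : 0 < l := by positivity
  have hlM : l * M ≤ g / 32 := by
    rw [hl, div_mul_eq_mul_div, div_le_iff₀ (by linarith)]; nlinarith
  set w : ℂ := ⟨A.re + g / 2, A.im + g / 16⟩ with hw
  have gA := gF.aff hl0 w
  set F' := F.aff l w with hF'
  have hb : ∀ z ∈ F'.B, (A.re + g / 2 - g / 32 ≤ z.re ∧ z.re ≤ A.re + g / 2 + g / 32) ∧
      (A.im + g / 16 - g / 32 ≤ z.im ∧ z.im ≤ A.im + g / 16 + g / 32) := by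
    intro z hz
    rw [hF', Dr.aff_B] at hz
    obtain ⟨y, hy, rfl⟩ := hz
    have := abs_le.1 (hM y hy).1
    have := abs_le.1 (hM y hy).2
    simp only [aff_re, aff_im, hw]
    refine ⟨⟨?_, ?_⟩, ?_, ?_⟩ <;> nlinarith
  have hEb := fun d hd => hb _ (gA.E_mem (d := d) hd)
  have hF'S : F'.S = D₂.S := hFS
  have hF'L : F'.L = (b, v) :: D₂.L := hFL
  obtain ⟨gU, hUB, hU1, hU2, hUE1, hUE2⟩ := gA.un st.good (by rw [hF'S]; exact hS.symm)
    (by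
      intro d hd
      rw [hF'L] at hd
      rcases List.mem_cons.1 hd with rfl | hd
      · exact hv
      · exact h2 d hd)
    (by rw [hF'S]; exact h1)
    (by
      rw [disjoint_left]
      intro z hz hz'
      have := hb z hz
      exact st.K z hz' ⟨by linarith, by linarith⟩)
    (by
      intro d hd z hz hzr
      have := hEb d hd
      by_contra hc
      push Not at hc
      exact st.K z hz ⟨by linarith, by linarith⟩)
    (by
      intro d hd z hz hzr
      have := hgap d hd
      linarith [(hb z hz).1.2])
    (by
      intro d hd d' hd'
      have := hgap d' hd'
      linarith [(hEb d hd).1.2])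
  set U := F'.un D (F'.L ++ D.L) with hU
  have hUL : U.L = (b, v) :: (D₂.L ++ D.L) := by
    show F'.L ++ D.L = _
    rw [hF'L]; rfl
  have hUS : U.S = D.S ∪ D₂.S := by
    show F'.S ∪ D.S = _
    rw [hF'S, union_comm]
  have hbv : (b, v) ∈ F'.L := by rw [hF'L]; simp
  have hUa := hU2 a st.hv
  have hbound := hEb _ hbv
  have hUEd : ∀ e, e ∈ U.Ed ↔ e ∈ F'.Ed ∨ e ∈ D.Ed := fun e => Iff.rfl
  have hFed : ∀ x y, x ∉ D₂.S → y ∉ D₂.S → s(x, y) ∉ F'.Ed := by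
    intro x y hx hy h
    rcases gA.inc h with ⟨w, hw, hw'⟩
    rw [hF'S] at hw
    rcases Sym2.mem_iff.1 hw' with rfl | rfl
    · exact hx hw
    · exact hy hw
  have haS : ∀ x ∈ D.S, x ∉ D₂.S := fun x hx h => disjoint_left.1 hS hx h
  refine ⟨U, (F'.E (b, v)).re - A.re, hUS, gU, by rw [hUS]; exact Or.inl st.hv, by rw [hUa.2, st.dir], ?_, hUL, rfl, by linarith,
    by rw [hUE1 _ hbv, hUa.1]; ring, ?_, ?_, ?_, ?_⟩
  · rw [hUEd]
    rintro (h | h)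
    · exact hFed a v (haS a st.hv) hv₂ h
    · exact st.ne h
  · intro z hz
    rw [hUB] at hz
    rw [hUa.1]
    rcases hz with hz | hz
    · right
      have := hb z hz
      constructor <;> linarith
    · left; exact st.K z hz
  · intro d hd
    rw [hUa.1]
    rcases List.mem_append.1 (show d ∈ F'.L ++ D.L from hd) with hd | hd
    · rw [hUE1 d hd]
      linarith [(hEb d hd).2.2]
    · rw [hUE2 d hd]
      linarith [(st.str d hd).2]
  · intro x hx y hxy
    rw [hUS] at hx
    simp only [hUEd]
    rcases hx with hx | hx
    · rcases st.comp x hx y hxy with h | h | h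
      · exact Or.inl (Or.inr h)
      · exact Or.inr (Or.inl h)
      · exact Or.inr (Or.inr h)
    · exact Or.inl (Or.inl (hFc x (hFS ▸ hx) y hxy))
  · intro d hd
    obtain ⟨k1, k2, k3, k4, k5, k6, k7⟩ := st.rs d hd
    rw [(hU2 _ k1).1, (hU2 _ k1).2, hUa.1, hUS, hUEd, hUB]
    refine ⟨Or.inl k1, k2, ?_, ?_, k5, k6, k7⟩
    · rintro (h | h)
      · exact hFed _ _ (haS _ k1) (hR d hd) h
      · exact k3 h
    · rintro z (hz | hz)
      · right
        linarith [(hb z hz).1.1]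
      · exact k4 z hz

/-- close a cubic root -/
lemma opRoot3 {r z : V} (st : State G D r z {(z, r)}) (hL : D.L = []) (hzr : z ≠ r) :
    ∃ D', Good G D' ∧ D'.S = D.S ∧ D'.L = [] ∧ ∀ x ∈ D'.S, ∀ y, G.Adj x y → s(x, y) ∈ D'.Ed := by
  have h3 := q3_pos
  obtain ⟨k1, k2, k3, k4, k5, k6, k7⟩ := st.rs (z, r) rfl
  simp only at k1 k2 k3 k4 k5 k6 k7
  have hlt := k7 hzr
  set Z := D.pos z with hZ
  set Q := D.pos r with hQ
  set ℓ := Q.im - Z.im with hℓ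
  have hℓ0 : 0 < ℓ := by linarith
  have hℓ3 : 0 < ℓ * √3 := by positivity
  set W := Q.re - (Z.re - ℓ * √3) with hW
  have hW0 : 0 < W := by linarith
  obtain ⟨C, hEC, hC⟩ := close_EC Z hℓ0 hW0
  have hP : (⟨Z.re - ℓ * √3 + W, Z.im + ℓ⟩ : ℂ) = Q := by
    apply Complex.ext <;> simp [hW, hℓ]
  have g' := st.good.addE (x := z) (y := r) (C := C) k1 st.hv k3
    (by rw [k2, st.dir, ← hZ, ← hQ, ← hP]; exact hEC)
    (by
      intro y hy hyB
      rw [← hZ, ← hQ]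
      rcases hC y hy with h | ⟨h1, h2, h4, h5⟩ | ⟨h1, h2⟩
      · exact Or.inl h
      · exfalso
        rcases k4 y hyB with h | h <;> linarith
      · right
        have hre : Z.re ≤ y.re := (k4 y hyB).resolve_left (by linarith)
        have hQim : Q.im = Z.im + ℓ := by simp [hℓ]
        set a := y.re - (Z.re - ℓ * √3) with ha
        set b := y.im - (Z.im + ℓ) with hb
        have hb0 : 0 ≤ b := by linarith
        have ha0 : 0 < a := by linarith
        have hsq := q3_sq
        have heq : a * (a - W) + b * (b - √3 * W) = 0 := by
          have e : (a - W / 2) ^ 2 + (b - W * √3 / 2) ^ 2 = W ^ 2 := by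
            rw [← h2, ha, hb]; ring
          nlinarith
        rcases hb0.eq_or_lt with hb1 | hb1
        · rw [← hb1] at heq
          have : a = W := by
            have : a * (a - W) = 0 := by linarith
            rcases mul_eq_zero.1 this with h | h
            · linarith
            · linarith
          apply Complex.ext
          · linarith
          · linarith
        · exfalso
          have hsum : a + b ≤ W := by
            by_contra hc
            push Not at hc
            exact st.K y hyB ⟨by linarith, by linarith⟩
          have h3l := q3_lo
          have : a * (a - W) < 0 := mul_neg_of_pos_of_neg ha0 (by linarith)
          have : b * (b - √3 * W) < 0 := mul_neg_of_pos_of_neg hb1 (by nlinarith)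
          linarith)
    (by rw [hL]; simp)
  refine ⟨_, g', rfl, hL, ?_⟩
  intro x hx y hxy
  rcases st.comp x hx y hxy with h | h | ⟨d, rfl, h⟩
  · exact Or.inr h
  · exact Or.inl (h.trans Sym2.eq_swap)
  · exact Or.inl h

end pops

section claims
variable {V : Type*} {G : SimpleGraph V} {D : Dr V}

theorem Nb.ne_self {v x : V} {l : List V} (h : Nb G v l) (hx : x ∈ l) : x ≠ v :=
  ((h.2 x).2 hx).ne'

theorem claim0 {X : Set V} {u v : V} {S : Set V} {L : List (V × V)} (h : Dfs G X u v S L) :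
    ∃ D : Dr V, D.S = S ∧ D.L = L ∧ State G D v u ∅ := by
  induction h with
  | @leaf0 X u v hu hv hn =>
    refine ⟨Dr.one v 0 fun _ => Real.pi / 6, rfl, rfl, State.one (Or.inr (Or.inl ⟨_, hn⟩)) rfl ?_ (by simp)⟩
    intro y hy
    left; simpa using (hn.2 y).1 hy
  | @leaf1 X u v y hu hv hy hn =>
    exact opLeaf1 hn (hn.ne_self (by simp))
  | @leaf2 X u v y y' hu hv hy hy' hn =>
    have hnd := hn.1
    simp at hnd
    obtain ⟨D, hS, hL, st, hB⟩ := opLeafInner hn (hn.ne_self (by simp))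
    obtain ⟨D', hS', hL', st'⟩ := opOuter st (by rw [hS]; exact hn.ne_self (by simp)) (by tauto) hB
    exact ⟨D', by rw [hS', hS], by rw [hL', hL]; rfl, st'⟩
  | @pass X u v a S L hu hv hn hd ih =>
    obtain ⟨D, hS, hL, st⟩ := ih
    have Fa := hd.facts
    have F := (Dfs.pass hu hv hn hd).facts
    have hnd := hn.1
    simp at hnd
    obtain ⟨f, hf, hfu, hfa⟩ := res2 hn (Real.pi / 6)
    have hvS : v ∉ D.S := hS ▸ Fa.vS
    obtain ⟨D', hS', hL', st'⟩ := opPass (u := u) st hvS (by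
        rw [hL]; intro d hd' h; exact hv (h ▸ (F.dart d hd').2.1)) hf hfu (by rw [hfa]; ring)
      (by intro y hy; simpa using (hn.2 y).1 hy) hnd
      (st.good.not_ed hvS (by rw [hL]; exact fun h => Fa.XS hu (Fa.dart _ h).1)) (by simp)
    exact ⟨D', by rw [hS', hS], by rw [hL', hL], st'⟩
  | @s1 X u v y a S L hu hv hy hn hd ih =>
    obtain ⟨D, hS, hL, st⟩ := ih
    have Fa := hd.facts
    have F := (Dfs.s1 hu hv hy hn hd).facts
    have hnd := hn.1
    simp at hnd
    have hvS : v ∉ D.S := hS ▸ Fa.vS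
    obtain ⟨D', hS', hL', st', hB⟩ := opHigh (u := u) st hvS (by
        rw [hL]; intro d hd' h; exact hv (h ▸ (F.dart d (by simp [hd'])).2.1)) hn
      (st.good.not_ed hvS (by rw [hL]; exact fun h => Fa.XS hu (Fa.dart _ h).1))
      (st.good.not_ed hvS (by rw [hL]; exact fun h => Fa.XS hy (Fa.dart _ h).1))
    obtain ⟨D₂, hS₂, hL₂, st₂⟩ := opOuter st' (by
        rw [hS', hS]
        rintro (h | h)
        · exact hn.ne_self (by simp) h
        · exact Fa.XS hy h) (by tauto) (fun z hz => (hB z hz).imp_right Or.inl)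
    exact ⟨D₂, by rw [hS₂, hS', hS], by rw [hL₂, hL', hL], st₂⟩
  | @s2 X u v y a S L hu hv hy hn hd ih =>
    obtain ⟨D, hS, hL, st⟩ := ih
    have Fa := hd.facts
    have F := (Dfs.s2 hu hv hy hn hd).facts
    have hvS : v ∉ D.S := hS ▸ Fa.vS
    obtain ⟨D', hS', hL', st'⟩ := opS2 (u := u) st hvS (by
        rw [hL]; intro d hd' h; exact hv (h ▸ (F.dart d (by simp [hd'])).2.1)) hn
      (st.good.not_ed hvS (by rw [hL]; exact fun h => Fa.XS hu (Fa.dart _ h).1))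
      (st.good.not_ed hvS (by rw [hL]; exact fun h => Fa.XS hy (Fa.dart _ h).1))
      (by
        rw [hS]
        rintro (h | h)
        · exact hn.ne_self (by simp) h
        · exact Fa.XS hy h) (by simp)
    exact ⟨D', by rw [hS', hS], by rw [hL', hL], st'⟩
  | @pop X u v a b S L hu hv hn hd ih =>
    obtain ⟨D, hS, hL, st⟩ := ih
    have Fa := hd.facts
    have F := (Dfs.pop hu hv hn hd).facts
    have hvS : v ∉ D.S := hS ▸ Fa.vS
    obtain ⟨D', hS', hL', st'⟩ := opPop (u := u) (st.toPR hL rfl) hvS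
      (fun d hd' h => hv (h ▸ (F.dart d hd').2.1)) hn
      (st.good.not_ed hvS (by rw [hL]; exact fun h => Fa.XS hu (Fa.dart _ h).1)) (by simp)
    exact ⟨D', by rw [hS', hS], hL', st'⟩
  | @branch X u v a b S₁ L₁ S₂ L₂ hu hv hn hd₁ hd₂ hdis ih₁ ih₂ =>
    obtain ⟨D₁, hS₁, hL₁, st₁⟩ := ih₁
    obtain ⟨D₂, hS₂, hL₂, st₂⟩ := ih₂
    have Fa := hd₁.facts
    have Fb := hd₂.facts
    have F := (Dfs.branch hu hv hn hd₁ hd₂ hdis).facts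
    have hv₁ : v ∉ D₁.S := hS₁ ▸ Fa.vS
    have hv₂ : v ∉ D₂.S := hS₂ ▸ Fb.vS
    obtain ⟨D, gap, hS, pr⟩ := opBranch st₁ st₂ hv₁ hv₂ (by rw [hS₁, hS₂]; exact hdis)
      (by rw [hL₁, hS₂]; intro d hd h; exact Fb.XS (F.dart d (by simp [hd])).2.1 h)
      (by rw [hL₂, hS₁]; intro d hd h; exact Fa.XS (F.dart d (by simp [hd])).2.1 h) (by simp)
    rw [hL₁, hL₂] at pr
    have hvS : v ∉ D.S := by rw [hS]; exact fun h => h.elim hv₁ hv₂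
    obtain ⟨D', hS', hL', st'⟩ := opPop (u := u) pr hvS
      (fun d hd' h => hv (h ▸ (F.dart d hd').2.1)) hn
      (pr.good.not_ed hvS (by
        intro h
        have : u ∈ D.S := (pr.good.str _ h).1
        rw [hS, hS₁, hS₂] at this
        exact this.elim (Fa.XS hu) (Fb.XS hu))) (by simp)
    exact ⟨D', by rw [hS', hS, hS₁, hS₂], hL', st'⟩

/-- a reserved dart is not the tree edge to the child -/
theorem DfsFacts.res_ne {X : Set V} {v a : V} {S : Set V} {L : List (V × V)}
    (h : DfsFacts G (insert v X) v a S L) {d : V × V} (hd : d ∈ L) : s(d.1, d.2) ≠ s(a, v) := by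
  intro he
  rcases Sym2.eq_iff.1 he with ⟨h1, h2⟩ | ⟨h1, -⟩
  · exact h.root (by rw [← h1, ← h2]; exact hd)
  · exact h.vS (h1 ▸ (h.dart d hd).1)

theorem claim1 {X : Set V} {u v : V} {S : Set V} {L : List (V × V)} (h : Dfs G X u v S L) :
    ∀ L0 e0, L = L0 ++ [e0] → (∀ y ∈ S, ∀ a b, ¬ Nb G y [a, b]) →
    ∃ D : Dr V, D.S = S ∧ D.L = L0 ∧ State G D v u {e0} := by
  induction h with
  | @leaf0 X u v hu hv hn =>
    intro L0 e0 h; simp at h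
  | @leaf1 X u v y hu hv hy hn =>
    intro L0 e0 _ h; exact absurd hn (h v rfl _ _)
  | @leaf2 X u v y y' hu hv hy hy' hn =>
    intro L0 e0 he _
    have he' : [(v, y')] ++ [(v, y)] = L0 ++ [e0] := he
    obtain ⟨rfl, h2⟩ := List.append_inj' he' rfl
    obtain rfl : (v, y) = e0 := by simpa using h2
    obtain ⟨D, hS, hL, st, hB⟩ := opLeafInner hn (hn.ne_self (by simp))
    exact ⟨D, hS, hL, st⟩
  | @pass X u v a S L hu hv hn hd ih =>
    intro L0 e0 _ h; exact absurd hn (h v (mem_insert _ _) _ _)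
  | @s1 X u v y a S L hu hv hy hn hd ih =>
    intro L0 e0 he _
    obtain ⟨rfl, h2⟩ := List.append_inj' he rfl
    obtain rfl : (v, y) = e0 := by simpa using h2
    obtain ⟨D, hS, hL, st⟩ := claim0 hd
    have Fa := hd.facts
    have F := (Dfs.s1 hu hv hy hn hd).facts
    have hvS : v ∉ D.S := hS ▸ Fa.vS
    obtain ⟨D', hS', hL', st', hB⟩ := opHigh (u := u) st hvS (by
        rw [hL]; intro d hd' h; exact hv (h ▸ (F.dart d (by simp [hd'])).2.1)) hn
      (st.good.not_ed hvS (by rw [hL]; exact fun h => Fa.XS hu (Fa.dart _ h).1))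
      (st.good.not_ed hvS (by rw [hL]; exact fun h => Fa.XS hy (Fa.dart _ h).1))
    exact ⟨D', by rw [hS', hS], by rw [hL', hL], st'⟩
  | @s2 X u v y a S L hu hv hy hn hd ih =>
    intro L0 e0 he hdeg
    have Fa := hd.facts
    have F := (Dfs.s2 hu hv hy hn hd).facts
    rcases List.eq_nil_or_concat L with rfl | ⟨L', e, rfl⟩
    · have he' : [] ++ [(v, y)] = L0 ++ [e0] := he
      obtain ⟨rfl, h2⟩ := List.append_inj' he' rfl
      obtain rfl : (v, y) = e0 := by simpa using h2
      obtain ⟨D, hS, hL, st⟩ := claim0 hd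
      have hvS : v ∉ D.S := hS ▸ Fa.vS
      obtain ⟨D', hS', hL', st', hB⟩ := opHigh (u := u) st hvS (by rw [hL]; simp)
        (hn.perm (by exact (List.Perm.swap _ _ _).cons _))
        (st.good.not_ed hvS (by rw [hL]; simp)) (st.good.not_ed hvS (by rw [hL]; simp))
      exact ⟨D', by rw [hS', hS], by rw [hL', hL], st'⟩
    · rw [List.concat_eq_append] at *
      have he' : ((v, y) :: L') ++ [e] = L0 ++ [e0] := he
      obtain ⟨rfl, h2⟩ := List.append_inj' he' rfl
      obtain rfl : e = e0 := by simpa using h2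
      obtain ⟨D, hS, hL, st⟩ := ih L' e rfl (fun x hx => hdeg x (mem_insert_of_mem _ hx))
      have hvS : v ∉ D.S := hS ▸ Fa.vS
      obtain ⟨D', hS', hL', st'⟩ := opS2 (u := u) st hvS (by
          rw [hL]; intro d hd' h; exact hv (h ▸ (F.dart d (by simp [hd'])).2.1)) hn
        (st.good.not_ed hvS (by rw [hL]; exact fun h => Fa.XS hu (Fa.dart (u, v) (by simp [h])).1))
        (st.good.not_ed hvS (by rw [hL]; exact fun h => Fa.XS hy (Fa.dart (y, v) (by simp [h])).1))
        (by
          rw [hS]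
          rintro (h | h)
          · exact hn.ne_self (by simp) h
          · exact Fa.XS hy h) (by
          rintro d rfl
          refine ⟨Fa.res_ne (by simp), fun h => ?_⟩
          have h1 := (Fa.dart d (by simp)).1
          rcases Sym2.eq_iff.1 h with ⟨h, -⟩ | ⟨h, -⟩
          · exact Fa.vS (h ▸ h1)
          · exact Fa.XS hy (h ▸ h1))
      exact ⟨D', by rw [hS', hS], by rw [hL', hL], st'⟩
  | @pop X u v a b S L hu hv hn hd ih =>
    intro L0 e0 he hdeg
    subst he
    have Fa := hd.facts
    have F := (Dfs.pop hu hv hn hd).facts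
    obtain ⟨D, hS, hL, st⟩ := ih ((b, v) :: L0) e0 rfl (fun x hx => hdeg x (mem_insert_of_mem _ hx))
    have hvS : v ∉ D.S := hS ▸ Fa.vS
    obtain ⟨D', hS', hL', st'⟩ := opPop (u := u) (st.toPR hL rfl) hvS
      (fun d hd' h => hv (h ▸ (F.dart d (by simp [hd'])).2.1)) hn
      (st.good.not_ed hvS (fun h => by
        have := (st.good.str _ h).1
        rw [hS] at this
        exact Fa.XS hu this)) (by
        rintro d rfl
        exact Fa.res_ne (by simp))
    exact ⟨D', by rw [hS', hS], hL', st'⟩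
  | @branch X u v a b S₁ L₁ S₂ L₂ hu hv hn hd₁ hd₂ hdis ih₁ ih₂ =>
    intro L0 e0 he hdeg
    have Fa := hd₁.facts
    have Fb := hd₂.facts
    have F := (Dfs.branch hu hv hn hd₁ hd₂ hdis).facts
    have hX : ∀ x ∈ X, x ∉ S₁ ∪ S₂ := fun x hx h => h.elim (Fa.XS hx) (Fb.XS hx)
    rcases List.eq_nil_or_concat L₁ with rfl | ⟨L', e, rfl⟩
    · rw [List.append_nil] at he
      subst he
      obtain ⟨D₁, hS₁, hL₁, st₁⟩ := ih₂ L0 e0 rfl (fun x hx => hdeg x (mem_insert_of_mem _ (Or.inr hx)))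
      obtain ⟨D₂, hS₂, hL₂, st₂⟩ := claim0 hd₁
      have hv₁ : v ∉ D₁.S := hS₁ ▸ Fb.vS
      have hv₂ : v ∉ D₂.S := hS₂ ▸ Fa.vS
      obtain ⟨D, gap, hS, pr⟩ := opBranch st₁ st₂ hv₁ hv₂ (by rw [hS₁, hS₂]; exact hdis.symm)
        (by rw [hL₁, hS₂]; intro d hd h; exact Fa.XS (F.dart d (by simp [hd])).2.1 h)
        (by rw [hL₂]; simp) (by
          rw [hS₂]; rintro d rfl
          exact Fa.XS (F.dart d (by simp)).2.1)
      rw [hL₁, hL₂, List.nil_append] at pr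
      have hvS : v ∉ D.S := by rw [hS]; exact fun h => h.elim hv₁ hv₂
      obtain ⟨D', hS', hL', st'⟩ := opPop (u := u) pr hvS
        (fun d hd' h => hv (h ▸ (F.dart d (by simp [hd'])).2.1))
        (hn.perm (by exact (List.Perm.swap _ _ _).cons _))
        (pr.good.not_ed hvS (by
          intro h
          have : u ∈ D.S := (pr.good.str _ h).1
          rw [hS, hS₁, hS₂, union_comm] at this
          exact hX _ hu this)) (by
          rintro d rfl
          exact Fb.res_ne (by simp))
      exact ⟨D', by rw [hS', hS, hS₁, hS₂, union_comm], hL', st'⟩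
    · rw [List.concat_eq_append] at *
      rw [← List.append_assoc] at he
      obtain ⟨rfl, h2⟩ := List.append_inj' he rfl
      obtain rfl : e = e0 := by simpa using h2
      obtain ⟨D₁, hS₁, hL₁, st₁⟩ := ih₁ L' e rfl (fun x hx => hdeg x (mem_insert_of_mem _ (Or.inl hx)))
      obtain ⟨D₂, hS₂, hL₂, st₂⟩ := claim0 hd₂
      have hv₁ : v ∉ D₁.S := hS₁ ▸ Fa.vS
      have hv₂ : v ∉ D₂.S := hS₂ ▸ Fb.vS
      obtain ⟨D, gap, hS, pr⟩ := opBranch st₁ st₂ hv₁ hv₂ (by rw [hS₁, hS₂]; exact hdis)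
        (by rw [hL₁, hS₂]; intro d hd h; exact Fb.XS (F.dart d (by simp [hd])).2.1 h)
        (by rw [hL₂, hS₁]; intro d hd h; exact Fa.XS (F.dart d (by simp [hd])).2.1 h) (by
          rw [hS₂]; rintro d rfl
          exact Fb.XS (F.dart d (by simp)).2.1)
      rw [hL₁, hL₂] at pr
      have hvS : v ∉ D.S := by rw [hS]; exact fun h => h.elim hv₁ hv₂
      obtain ⟨D', hS', hL', st'⟩ := opPop (u := u) pr hvS
        (fun d hd' h => hv (h ▸ (F.dart d (by
          rw [← List.append_assoc]; exact List.mem_append_left _ hd')).2.1)) hn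
        (pr.good.not_ed hvS (by
          intro h
          have : u ∈ D.S := (pr.good.str _ h).1
          rw [hS, hS₁, hS₂] at this
          exact hX _ hu this)) (by
          rintro d rfl
          exact Fa.res_ne (by simp))
      exact ⟨D', by rw [hS', hS, hS₁, hS₂], hL', st'⟩

/-- a complete drawing of an adjacency-closed set -/
def Closed (G : SimpleGraph V) (S : Set V) : Prop :=
  ∃ D : Dr V, Good G D ∧ D.S = S ∧ D.L = [] ∧ ∀ x ∈ D.S, ∀ y, G.Adj x y → s(x, y) ∈ D.Ed

theorem RootC.closed {r : V} {S : Set V} (h : RootC G r S)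
    (hdeg : (∃ l, Nb G r l ∧ l.length ≤ 2) ∨ ∀ y ∈ S, ∀ a b, ¬ Nb G y [a, b]) : Closed G S := by
  have h3 : ∀ {a b z : V}, Nb G r [a, b, z] → ∀ y ∈ S, ∀ a b, ¬ Nb G y [a, b] := by
    intro a b z hn
    refine hdeg.resolve_left ?_
    rintro ⟨l, hl, hlen⟩
    have : [a, b, z].Perm l := (List.perm_ext_iff_of_nodup hn.1 hl.1).2 fun x => (hn.2 x).symm.trans (hl.2 x)
    have := this.length_eq
    simp at this
    omega
  cases h with
  | d0 hn =>
    refine ⟨Dr.one r 0 fun _ => 0, Good.one _ _ (Or.inl hn), rfl, rfl, ?_⟩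
    rintro x rfl y hy
    have := (hn.2 y).1 hy
    simp at this
  | @d1 a S hn hd =>
    obtain ⟨D, hS, hL, st⟩ := claim0 hd
    have F := hd.facts
    have har := hn.ne_self (x := a) (by simp)
    have hrS : r ∉ D.S := by rw [hS]; exact fun h => F.disj.notMem_of_mem_left h rfl
    classical
    obtain ⟨D', hS', hL', st'⟩ := opPass (u := r) (f := fun x => if x = r then Real.pi / 6 else 7 * Real.pi / 6)
      st hrS (by rw [hL]; simp) (Or.inr (Or.inl ⟨_, hn⟩)) (by simp) (by simp [har])
      (by intro y hy; right; simpa using (hn.2 y).1 hy) har.symm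
      (st.good.not_ed hrS (by rw [hL]; simp)) (by simp)
    refine ⟨D', st'.good, by rw [hS', hS], by rw [hL', hL], ?_⟩
    intro x hx y hxy
    rcases st'.comp x hx y hxy with h | h | ⟨d, hd, -⟩
    · exact h
    · rcases Sym2.eq_iff.1 h with ⟨rfl, rfl⟩ | ⟨rfl, rfl⟩ <;> exact absurd hxy G.irrefl
    · exact hd.elim
  | @d2 a b S hn hd =>
    obtain ⟨D, hS, hL, st⟩ := claim0 hd
    have F := hd.facts
    have hrS : r ∉ D.S := by rw [hS]; exact fun h => F.disj.notMem_of_mem_left h rfl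
    obtain ⟨D', g, hS', hL', hc⟩ := opRoot2 (st.toPR hL rfl) hrS hn
    exact ⟨D', g, by rw [hS', hS], hL', hc⟩
  | @d2s a b S₁ S₂ hn hd₁ hd₂ hdis =>
    obtain ⟨D₁, hS₁, hL₁, st₁⟩ := claim0 hd₁
    obtain ⟨D₂, hS₂, hL₂, st₂⟩ := claim0 hd₂
    have hv₁ : r ∉ D₁.S := by rw [hS₁]; exact fun h => hd₁.facts.disj.notMem_of_mem_left h rfl
    have hv₂ : r ∉ D₂.S := by rw [hS₂]; exact fun h => hd₂.facts.disj.notMem_of_mem_left h rfl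
    obtain ⟨D, gap, hS, pr⟩ := opBranch st₁ st₂ hv₁ hv₂ (by rw [hS₁, hS₂]; exact hdis)
      (by rw [hL₁]; simp) (by rw [hL₂]; simp) (by simp)
    rw [hL₁, hL₂, List.nil_append] at pr
    obtain ⟨D', g, hS', hL', hc⟩ := opRoot2 pr (by rw [hS]; exact fun h => h.elim hv₁ hv₂) hn
    exact ⟨D', g, by rw [hS', hS, hS₁, hS₂], hL', hc⟩
  | @d3 a b z S hn hd =>
    have F := hd.facts
    obtain ⟨D, hS, hL, st⟩ := claim1 hd [(b, r)] (z, r) rfl (fun y hy => h3 hn y (mem_insert_of_mem _ hy))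
    have hrS : r ∉ D.S := by rw [hS]; exact fun h => F.disj.notMem_of_mem_left h rfl
    obtain ⟨D', hS', hL', st'⟩ := opPop (u := z) (st.toPR hL rfl) hrS (by simp)
      (hn.perm (by exact (List.perm_append_comm (l₁ := [a, b]) (l₂ := [z]))))
      (by rw [Sym2.eq_swap]; exact (st.rs (z, r) rfl).2.2.1) (by
        rintro d rfl h
        have hnd := hn.1
        rcases Sym2.eq_iff.1 h with ⟨h, -⟩ | ⟨h, -⟩
        · simp at hnd h; tauto
        · exact hn.ne_self (by simp) h)
    obtain ⟨D₂, g, hS₂, hL₂, hc⟩ := opRoot3 st' hL' (hn.ne_self (by simp))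
    exact ⟨D₂, g, by rw [hS₂, hS', hS], hL₂, hc⟩
  | @d3s a b z S₁ S₂ hn hd₁ hd₂ hdis =>
    obtain ⟨D₁, hS₁, hL₁, st₁⟩ := claim1 hd₁ [] (z, r) rfl
      (fun y hy => h3 hn y (mem_insert_of_mem _ (Or.inl hy)))
    obtain ⟨D₂, hS₂, hL₂, st₂⟩ := claim0 hd₂
    have hv₁ : r ∉ D₁.S := by rw [hS₁]; exact fun h => hd₁.facts.disj.notMem_of_mem_left h rfl
    have hv₂ : r ∉ D₂.S := by rw [hS₂]; exact fun h => hd₂.facts.disj.notMem_of_mem_left h rfl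
    obtain ⟨D, gap, hS, pr⟩ := opBranch st₁ st₂ hv₁ hv₂ (by rw [hS₁, hS₂]; exact hdis)
      (by rw [hL₁]; simp) (by rw [hL₂]; simp) (by rintro d rfl; exact hv₂)
    rw [hL₁, hL₂, List.nil_append] at pr
    obtain ⟨D', hS', hL', st'⟩ := opPop (u := z) pr (by rw [hS]; exact fun h => h.elim hv₁ hv₂) (by simp)
      (hn.perm (by exact (List.perm_append_comm (l₁ := [a, b]) (l₂ := [z]))))
      (by rw [Sym2.eq_swap]; exact (pr.rs (z, r) rfl).2.2.1) (by
        rintro d rfl h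
        have hnd := hn.1
        rcases Sym2.eq_iff.1 h with ⟨h, -⟩ | ⟨h, -⟩
        · simp at hnd h; tauto
        · exact hn.ne_self (by simp) h)
    obtain ⟨D₃, g, hS₃, hL₃, hc⟩ := opRoot3 st' hL' (hn.ne_self (by simp))
    exact ⟨D₃, g, by rw [hS₃, hS', hS, hS₁, hS₂], hL₃, hc⟩

end claims

section final
variable {V : Type*} {G : SimpleGraph V}

theorem Closed.empty : Closed G (∅ : Set V) := by
  refine ⟨⟨fun _ => 0, fun _ _ => 0, fun _ => ∅, fun _ => 0, ∅, ∅, []⟩, ?_, rfl, rfl, by simp⟩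
  constructor <;> try simp
  exact ⟨0, by rintro z (⟨x, hx, -⟩ | ⟨x, hx, -⟩) <;> exact hx.elim⟩

theorem Closed.union {S T : Set V} (h : Closed G S) (h' : Closed G T) (hd : Disjoint S T) :
    Closed G (S ∪ T) := by
  obtain ⟨D, g, rfl, hL, hc⟩ := h
  obtain ⟨D', g', rfl, hL', hc'⟩ := h'
  obtain ⟨M, hM⟩ := g.bdd
  obtain ⟨M', hM'⟩ := g'.bdd
  have ga := g'.aff one_pos ((M + M' + 1 : ℝ) : ℂ)
  have hB : Disjoint D.B (D'.aff 1 ((M + M' + 1 : ℝ) : ℂ)).B := by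
    rw [Dr.aff_B, disjoint_left]
    rintro z hz ⟨w, hw, rfl⟩
    have h1 := (hM _ hz).1
    have h2 := (hM' _ hw).1
    simp only [aff_re, Complex.ofReal_re] at h1
    have := (abs_le.1 h1).2
    have := (abs_le.1 h2).1
    linarith
  have hLa : (D'.aff 1 ((M + M' + 1 : ℝ) : ℂ)).L = [] := hL'
  obtain ⟨gu, -⟩ := g.un ga hd (by rw [hL]; simp) (by rw [hLa]; simp) hB
    (by rw [hL]; simp) (by rw [hLa]; simp) (by rw [hL]; simp)
  refine ⟨_, gu, rfl, by show D.L ++ _ = _; rw [hL, hLa]; rfl, ?_⟩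
  rintro x (hx | hx) y hxy
  · exact Or.inl (hc x hx y hxy)
  · exact Or.inr (hc' x hx y hxy)

theorem closed_univ [Finite V] (h : ∀ x, Closed G (comp G ∅ x)) : Closed G (univ : Set V) := by
  have key : ∀ T : Set V, T.Finite → Closed G (⋃ x ∈ T, comp G ∅ x) := by
    intro T hT
    induction T, hT using Set.Finite.induction_on with
    | empty => simpa using Closed.empty
    | @insert x T _ _ ih =>
      rw [biUnion_insert]
      by_cases hd : Disjoint (comp G ∅ x) (⋃ x ∈ T, comp G ∅ x)
      · exact (h x).union ih hd
      · rw [not_disjoint_iff] at hd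
        obtain ⟨z, hz, hz'⟩ := hd
        rw [mem_iUnion₂] at hz'
        obtain ⟨y, hy, hzy⟩ := hz'
        rw [union_eq_self_of_subset_left]
        · exact ih
        · rw [← comp_eq_of_mem hz, comp_eq_of_mem hzy]
          exact subset_biUnion_of_mem (u := fun x => comp G ∅ x) hy
  have := key univ finite_univ
  convert this
  symm
  rw [eq_univ_iff_forall]
  intro x
  rw [mem_iUnion₂]
  exact ⟨x, mem_univ _, self_mem_comp (by simp)⟩

/-- the curve `γ` with velocity `γ'` witnesses `EC` -/
def ECb (γ γ' : ℝ → ℂ) (a b : ℂ) (α β : ℝ) (S : Set ℂ) : Prop :=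
  (∃ s : ℝ, 0 < s ∧ s < 1 ∧ IsArcOn γ 0 s ∧ IsArcOn γ s 1) ∧
    (∀ t, HasDerivAt γ (γ' t) t) ∧ Continuous γ' ∧ (∀ t, γ' t ≠ 0) ∧
    InjOn γ (Icc 0 1) ∧ γ '' Icc 0 1 = S ∧ γ 0 = a ∧ γ 1 = b ∧
    (∃ r : ℝ, 0 < r ∧ γ' 0 = r * Complex.exp (Complex.I * α)) ∧
    (∃ r : ℝ, 0 < r ∧ γ' 1 = -(r * Complex.exp (Complex.I * β)))

lemma ECb.symm {γ γ' : ℝ → ℂ} {a b : ℂ} {α β : ℝ} {S : Set ℂ} (h : ECb γ γ' a b α β S) :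
    ECb (fun t => γ (1 - t)) (fun t => - γ' (1 - t)) b a β α S := by
  obtain ⟨⟨s, hs0, hs1, h1, h2⟩, hd, hc, hn, hi, him, h0, h1', ⟨r, hr, hr'⟩, ⟨q, hq, hq'⟩⟩ := h
  refine ⟨⟨1 - s, by linarith, by linarith, ?_, ?_⟩,
    ?_, ?_, ?_, ?_, ?_, ?_, ?_, ⟨q, hq, ?_⟩, ⟨r, hr, ?_⟩⟩
  · simpa using h2.rev
  · simpa using h1.rev
  · intro t
    have := (hd (1 - t)).scomp t ((hasDerivAt_id t).const_sub 1)
    simpa [Function.comp_def] using this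
  · fun_prop
  · intro t; simpa using hn (1 - t)
  · intro x hx y hy hxy
    have := hi (x₁ := 1 - x) (x₂ := 1 - y) ⟨by linarith [hx.2], by linarith [hx.1]⟩
      ⟨by linarith [hy.2], by linarith [hy.1]⟩ hxy
    linarith
  · rw [← him]
    ext z
    constructor
    · rintro ⟨t, ht, rfl⟩
      exact ⟨1 - t, ⟨by linarith [ht.2], by linarith [ht.1]⟩, rfl⟩
    · rintro ⟨t, ht, rfl⟩
      exact ⟨1 - t, ⟨by linarith [ht.2], by linarith [ht.1]⟩, by simp⟩
  · simpa using h1'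
  · simpa using h0
  · simp [hq']
  · simp [hr']

lemma dirAngle_polar {r α : ℝ} (hr : 0 < r) : dirAngle (r * Complex.exp (Complex.I * α)) = (α : Real.Angle) := by
  rw [dirAngle, Complex.arg_real_mul _ hr, mul_comm, Complex.arg_exp_mul_I, Real.Angle.coe_toIocMod]

lemma Nb.equal {v : V} {l : List V} (hn : Nb G v l) {dir : V → ℝ} {θ : ℝ}
    (h : ∀ i : Fin l.length, dir (l.get i) = θ + 2 * Real.pi * ((i : ℕ) : ℝ) / (l.length : ℝ)) :
    ∃ (θ : ℝ) (e : {u // G.Adj v u} ≃ Fin (Nat.card {u // G.Adj v u})),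
      ∀ (u : V) (h : G.Adj v u), dir u = θ + 2 * Real.pi * ((e ⟨u, h⟩ : Fin _) : ℕ) /
            (Nat.card {u // G.Adj v u}) := by
  classical
  let e0 : {u // G.Adj v u} ≃ Fin l.length :=
    (Equiv.subtypeEquivRight hn.2).trans (List.Nodup.getEquiv l hn.1).symm
  have hc : l.length = Nat.card {u // G.Adj v u} := by
    rw [Nat.card_congr e0, Nat.card_eq_fintype_card, Fintype.card_fin]
  refine ⟨θ, e0.trans (finCongr hc), fun u hu => ?_⟩
  have h1 := h (e0 ⟨u, hu⟩)
  have h2 : l.get (e0 ⟨u, hu⟩) = u := by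
    have := (List.Nodup.getEquiv l hn.1).apply_symm_apply ⟨u, (hn.2 u).1 hu⟩
    exact congrArg Subtype.val this
  rw [h2] at h1
  have hc' : (l.length : ℝ) = (Nat.card {u // G.Adj v u} : ℝ) := by exact_mod_cast hc
  rw [h1, hc']
  rfl

lemma Res.equal {v : V} {dir : V → ℝ} (h : Res G dir v) :
    ∃ (θ : ℝ) (e : {u // G.Adj v u} ≃ Fin (Nat.card {u // G.Adj v u})),
      ∀ (u : V) (h : G.Adj v u), dir u = θ + 2 * Real.pi * ((e ⟨u, h⟩ : Fin _) : ℕ) /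
            (Nat.card {u // G.Adj v u}) := by
  rcases h with h | ⟨y, h⟩ | ⟨y, w, h, h1⟩ | ⟨y, w, z, h, h1, h2⟩
  · exact h.equal (θ := 0) (fun i => i.elim0)
  · refine h.equal (θ := dir y) ?_
    simp
  · refine h.equal (θ := dir y) ?_
    refine Fin.forall_fin_two.2 ⟨by simp, ?_⟩
    simp [h1]
  · refine h.equal (θ := dir y) ?_
    refine Fin.forall_fin_succ.2 ⟨by simp, Fin.forall_fin_two.2 ⟨?_, ?_⟩⟩
    · simp [h1]
    · simp [h2]; ring

theorem main_closed [Finite V] (h : Closed G (univ : Set V)) :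
    ∃ D : GraphDrawing V G, D.NonCrossing ∧ D.KArc 2 ∧ D.Smooth ∧ D.PerfectRes := by
  obtain ⟨D, g, hS, hL, hc⟩ := h
  have hm : ∀ x, x ∈ D.S := fun x => hS ▸ mem_univ x
  have hec : ∀ p : {p : V × V // G.Adj p.1 p.2}, ∃ γ γ', ECb γ γ' (D.pos p.1.1) (D.pos p.1.2)
      (D.dir p.1.1 p.1.2) (D.dir p.1.2 p.1.1) (D.img s(p.1.1, p.1.2)) := by
    rintro ⟨⟨u, v⟩, huv⟩
    show EC _ _ _ _ _
    rcases g.ed _ (hc u (hm u) v huv) with ⟨x, y, he, -, -, h⟩ | ⟨d, hd, -⟩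
    · rcases Sym2.eq_iff.1 he with ⟨rfl, rfl⟩ | ⟨rfl, rfl⟩
      · exact h
      · exact h.symm
    · rw [hL] at hd; simp at hd
  choose γ γ' hγ using hec
  obtain ⟨n, ⟨e⟩⟩ := Finite.exists_equiv_fin V
  let c : ∀ u v : V, G.Adj u v → ℝ → ℂ := fun u v h =>
    if e u < e v then γ ⟨(u, v), h⟩ else fun t => γ ⟨(v, u), h.symm⟩ (1 - t)
  have hcc : ∀ u v (h : G.Adj u v), ∃ c', ECb (c u v h) c' (D.pos u) (D.pos v) (D.dir u v) (D.dir v u)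
      (D.img s(u, v)) := by
    intro u v h
    by_cases huv : e u < e v
    · refine ⟨γ' ⟨(u, v), h⟩, ?_⟩
      simp only [c, if_pos huv]
      exact hγ ⟨(u, v), h⟩
    · refine ⟨fun t => - γ' ⟨(v, u), h.symm⟩ (1 - t), ?_⟩
      simp only [c, if_neg huv]
      rw [Sym2.eq_swap]
      exact (hγ ⟨(v, u), h.symm⟩).symm
  choose c' hE using hcc
  have hsym : ∀ u v (h : G.Adj u v) t, c v u h.symm t = c u v h (1 - t) := by
    intro u v h t
    have hne : e u ≠ e v := fun h' => h.ne (e.injective h')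
    rcases lt_or_gt_of_ne hne with h' | h'
    · simp [c, h', h'.not_gt]
    · simp [c, h', h'.not_gt]
  have hd : ∀ u v (h : G.Adj u v) t, HasDerivAt (c u v h) (c' u v h t) t := fun u v h => (hE u v h).2.1
  let GD : GraphDrawing V G :=
    { pos := D.pos
      inj := fun x y hxy => g.inj (hm x) (hm y) hxy
      curve := fun u v h => c u v h
      cont := fun u v h t _ => (hd u v h t).continuousAt.continuousWithinAt
      source_eq := fun u v h => (hE u v h).2.2.2.2.2.2.1
      target_eq := fun u v h => (hE u v h).2.2.2.2.2.2.2.1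
      symm := fun u v h t => hsym u v h t
      simple := fun u v h => (hE u v h).2.2.2.2.1
      vertexFree := by
        intro u v h w hw
        rw [(hE u v h).2.2.2.2.2.1] at hw
        simpa using g.vf _ (hc u (hm u) v h) w (hm w) hw }
  refine ⟨GD, ?_, ?_, ?_, ?_⟩
  · intro u v u' v' h h' hne z hz
    have hz1 : z ∈ c u v h '' Icc 0 1 := hz.1
    have hz2 : z ∈ c u' v' h' '' Icc 0 1 := hz.2
    rw [(hE _ _ _).2.2.2.2.2.1] at hz1 hz2
    obtain ⟨w, -, h1, h2, rfl⟩ := g.nc _ (hc u (hm u) v h) _ (hc u' (hm u') v' h') hne z hz1 hz2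
    have k1 : w = u ∨ w = v := by simpa using h1
    have k2 : w = u' ∨ w = v' := by simpa using h2
    exact ⟨by rcases k1 with rfl | rfl <;> simp [GD], by rcases k2 with rfl | rfl <;> simp [GD]⟩
  · intro u v h
    obtain ⟨s, hs0, hs1, h1, h2⟩ := (hE u v h).1
    refine ⟨2, by norm_num, le_rfl, fun i => if i = 0 then 0 else if i = 1 then s else 1, by simp, by simp, ?_, ?_⟩
    · intro i hi
      interval_cases i <;> simp [hs0, hs1]
    · intro i hi
      interval_cases i
      · simpa using h1
      · simpa using h2
  · intro u v h
    have h0 : deriv (c u v h) = c' u v h := funext fun t => (hd u v h t).deriv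
    constructor
    · apply ContDiff.contDiffOn
      rw [contDiff_one_iff_deriv]
      exact ⟨fun t => (hd u v h t).differentiableAt, by
        show Continuous (deriv (c u v h)); rw [h0]; exact (hE u v h).2.2.1⟩
    · intro t ht
      have := (hd u v h t).hasDerivWithinAt (s := Icc 0 1)
      show derivWithin (c u v h) _ _ ≠ 0
      rw [this.derivWithin (uniqueDiffOn_Icc one_pos t ht)]
      exact (hE u v h).2.2.2.1 t
  · intro v
    obtain ⟨θ, f, hf⟩ := (g.res v (hm v)).equal
    refine ⟨θ, f, fun u h => ⟨c' v u h 0, (hE v u h).2.2.2.1 0, (hd v u h 0).hasDerivWithinAt, ?_⟩⟩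
    obtain ⟨r, hr, hr'⟩ := (hE v u h).2.2.2.2.2.2.2.2.1
    rw [hr', dirAngle_polar hr, hf u h]

theorem main_thm [Fintype V] (G : SimpleGraph V)
    (hdeg : ∀ v : V, Nat.card {u // G.Adj v u} ≤ 3)
    (hplanar : ∃ D : GraphDrawing V G, D.NonCrossing) :
    ∃ D : GraphDrawing V G, D.NonCrossing ∧ D.KArc 2 ∧ D.Smooth ∧ D.PerfectRes := by
  obtain ⟨D, hD⟩ := hplanar
  obtain ⟨M⟩ := exists_gridModel G hdeg D hD
  refine main_closed (closed_univ fun x => ?_)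
  obtain ⟨r, hr, h⟩ := root_exists hdeg M.toRot x
  exact hr.closed h

end final

/-- Every planar graph (i.e. one admitting a crossing-free drawing in the
plane) with maximum degree at most three has a planar smooth 2-Lombardi drawing. -/
theorem planar_maxdeg_three_smooth_two_lombardi
    {V : Type*} [Fintype V] (G : SimpleGraph V)
    (hdeg : ∀ v : V, Nat.card {u // G.Adj v u} ≤ 3)
    (hplanar : ∃ D : GraphDrawing V G, D.NonCrossing) :
    ∃ D : GraphDrawing V G, D.NonCrossing ∧ D.KArc 2 ∧ D.Smooth ∧ D.PerfectRes := by
  exact main_thm G hdeg hplanar
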